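/- arXiv:2505.00960 — 3 statements merged into one kernel-verified Lean document; each statement's English description precedes it below -/
import Mathlib

section
/- Let $m_1,\dots,m_n$ be positive integers and let $D$ be an irreducible divisor in $X=\prod_{i=1}^n \mathbb{P}^{m_i}$ whose associated line bundle is $\boxtimes_i \mathcal{O}_{\mathbb{P}^{m_i}}(1)$ (i.e. $D$ has multidegree $(1,1,\dots,1)$). Then $D$ is a normal variety. -/
open MvPolynomial MeasureTheory Metric
open scoped LinearAlgebra.Projectivization

namespace MultiProj

variable {n : ℕ}

/-- Index type for the homogeneous coordinates on `∏ i, ℙ^(m i)`. -/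
abbrev Idx (m : Fin n → ℕ) : Type := Σ i : Fin n, Fin (m i + 1)

/-- `F` is multihomogeneous of multidegree `a`: every monomial of `F` has degree `a i` in the
block of variables belonging to the `i`-th factor. -/
def IsMultiHomog (m : Fin n → ℕ) (F : MvPolynomial (Idx m) ℂ) (a : Fin n → ℕ) : Prop :=
  ∀ p ∈ F.support, ∀ i : Fin n, (∑ j : Fin (m i + 1), p ⟨i, j⟩) = a i

/-- Dehomogenization of `F` in the standard affine chart where the `c i`-th homogeneous
coordinate of the `i`-th factor is set to `1`. -/
noncomputable def chart (m : Fin n → ℕ) (F : MvPolynomial (Idx m) ℂ)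
    (c : ∀ i : Fin n, Fin (m i + 1)) : MvPolynomial (Idx m) ℂ :=
  aeval (fun v : Idx m => if v.2 = c v.1 then 1 else X v) F

/-- The points of `X = ∏ i, ℙ^(m i)` over `ℂ`. -/
def Pt (m : Fin n → ℕ) : Type := ∀ i : Fin n, ℙ ℂ (Fin (m i + 1) → ℂ)

noncomputable instance (V : Type*) [AddCommGroup V] [Module ℂ V] [TopologicalSpace V] :
    TopologicalSpace (ℙ ℂ V) :=
  inferInstanceAs (TopologicalSpace (Quotient (projectivizationSetoid ℂ V)))

noncomputable instance (m : Fin n → ℕ) : TopologicalSpace (Pt m) :=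
  inferInstanceAs (TopologicalSpace (∀ i : Fin n, ℙ ℂ (Fin (m i + 1) → ℂ)))

/-- The zero locus in `∏ i, ℙ^(m i)` of a multihomogeneous polynomial. -/
noncomputable def zeroLocus (m : Fin n → ℕ) (F : MvPolynomial (Idx m) ℂ) : Set (Pt m) :=
  {x | eval (fun v : Idx m => (x v.1).rep v.2) F = 0}

/-- The pair `(X, ∑ j, q j • {F j = 0})` is Kawamata log terminal: in every standard affine
chart the function `∏ j |F j|^(-2 q j)` is locally integrable (the analytic characterization
of klt for effective pairs on a smooth variety). -/
def IsKltPair (m : Fin n → ℕ) {ι : Type} [Fintype ι] (F : ι → MvPolynomial (Idx m) ℂ)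
    (q : ι → ℚ) : Prop :=
  ∀ c : ∀ i : Fin n, Fin (m i + 1), ∀ x : Idx m → ℂ, ∃ ε > 0,
    IntegrableOn
      (fun y : Idx m → ℂ => ∏ j, ‖eval y (chart m (F j) c)‖ ^ (-2 * (q j : ℝ)))
      (Metric.ball x ε) volume

/-- The pair `(X, Δ)` with `⌊Δ⌋` the prime divisor indexed by `j₀` is purely log terminal:
the pair stays klt after decreasing the coefficient of the `j₀`-th component by any
sufficiently small positive rational. -/
def IsPltPair (m : Fin n → ℕ) {ι : Type} [Fintype ι] [DecidableEq ι]
    (F : ι → MvPolynomial (Idx m) ℂ) (q : ι → ℚ) (j₀ : ι) : Prop :=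
  ∃ ε₀ : ℚ, 0 < ε₀ ∧ ∀ ε : ℚ, 0 < ε → ε ≤ ε₀ →
    IsKltPair m F (Function.update q j₀ (q j₀ - ε))

/-- The hypersurface `{F = 0}` in `∏ i, ℙ^(m i)` is normal: in each standard affine chart
meeting it, its coordinate ring is a normal domain. -/
def IsNormalHypersurface (m : Fin n → ℕ) (F : MvPolynomial (Idx m) ℂ) : Prop :=
  ∀ c : ∀ i : Fin n, Fin (m i + 1), ¬ IsUnit (chart m F c) →
    IsDomain (MvPolynomial (Idx m) ℂ ⧸ Ideal.span {chart m F c}) ∧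
    IsIntegrallyClosed (MvPolynomial (Idx m) ℂ ⧸ Ideal.span {chart m F c})


/-- Analytic log canonical threshold of the hypersurface `{F = 0}` in `∏ i, ℙ^(m i)`:
the supremum of the set of positive `c` for which `|F|^(-2c)` is locally integrable in
every standard affine chart. -/
noncomputable def lct (m : Fin n → ℕ) (F : MvPolynomial (Idx m) ℂ) : ℝ :=
  sSup {c : ℝ | 0 < c ∧ ∀ cc : ∀ i : Fin n, Fin (m i + 1), ∀ x : Idx m → ℂ, ∃ ε > 0,
    IntegrableOn (fun y : Idx m → ℂ => ‖eval y (chart m F cc)‖ ^ (-2 * c))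
      (Metric.ball x ε) volume}

/-- A (rational) divisor class of multidegree `b` on `∏ i, ℙ^(m i)` is ample: some positive
multiple `N • b` is integral and the multihomogeneous forms of multidegree `N • b`
separate the points of `X`. -/
def IsAmpleClass (m : Fin n → ℕ) (b : Fin n → ℚ) : Prop :=
  ∃ (N : ℕ) (b' : Fin n → ℕ), 0 < N ∧ (∀ i, (b' i : ℚ) = N * b i) ∧
    ∀ x y : Pt m, x ≠ y → ∃ G : MvPolynomial (Idx m) ℂ, IsMultiHomog m G b' ∧
      eval (fun v : Idx m => (x v.1).rep v.2) G = 0 ∧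
      eval (fun v : Idx m => (y v.1).rep v.2) G ≠ 0

/-- The hypersurface `D = {F = 0}` has rational singularities.  For a hypersurface `D` in the
smooth variety `X` (so `D` is Gorenstein), this is equivalent to: `D` is normal and the pair
`(X, D)` is plt (by inversion of adjunction, `D` is then klt, hence canonical, hence has
rational singularities). -/
def HasRationalSingularities (m : Fin n → ℕ) (F : MvPolynomial (Idx m) ℂ) : Prop :=
  IsNormalHypersurface m F ∧ IsPltPair m (fun _ : Fin 1 => F) (fun _ => 1) 0

/-- The projection `∏ j, ℙ^(m j) → ∏_{j ≠ i} ℙ^(m j)` forgetting the `i`-th factor. -/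
def projAway (m : Fin n → ℕ) (i : Fin n) (x : Pt m) :
    ∀ j : {j : Fin n // j ≠ i}, ℙ ℂ (Fin (m j.1 + 1) → ℂ) := fun j => x j.1

/-- `Wset m F i` is the set of points `z` of `∏_{j ≠ i} ℙ^(m j)` whose whole fiber under the
projection `π i` is contained in `{F = 0}`. -/
def Wset (m : Fin n → ℕ) (F : MvPolynomial (Idx m) ℂ) (i : Fin n) :
    Set (∀ j : {j : Fin n // j ≠ i}, ℙ ℂ (Fin (m j.1 + 1) → ℂ)) :=
  {z | ∀ x : Pt m, projAway m i x = z → x ∈ zeroLocus m F}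

/-- `x` is a smooth point of the hypersurface `{F = 0}`: some partial derivative of the
multihomogeneous form `F` does not vanish at (a representative of) `x`. -/
def IsSmoothPt (m : Fin n → ℕ) (F : MvPolynomial (Idx m) ℂ) (x : Pt m) : Prop :=
  ∃ v : Idx m, eval (fun w : Idx m => (x w.1).rep w.2) (pderiv v F) ≠ 0

end MultiProj


namespace MultiaffineNormal

section MonicCoordinates

variable {k : Type*} [Field k] {n : ℕ}

/-- The weights `N ^ i` used in the triangular change of coordinates. -/
def weight (N : ℕ) (i : Fin (n + 1)) : ℕ := N ^ i.1

/-- The substitution `X i ↦ X i + c • X 0 ^ N ^ i` for `i ≠ 0`, fixing `X 0`. -/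
noncomputable def shear (N : ℕ) (c : k) :
    MvPolynomial (Fin (n + 1)) k →ₐ[k] MvPolynomial (Fin (n + 1)) k :=
  aeval fun i ↦ if i = 0 then X 0 else X i + c • X 0 ^ weight N i

lemma shear_comp_shear_neg (N : ℕ) (c : k) :
    (shear N c).comp (shear N (-c)) = AlgHom.id k (MvPolynomial (Fin (n + 1)) k) := by
  rw [shear, shear, comp_aeval, ← MvPolynomial.aeval_X_left]
  ext i v
  cases i using Fin.cases <;> simp

/-- The automorphism underlying `shear N 1`. -/
noncomputable def shearEquiv (N : ℕ) :
    MvPolynomial (Fin (n + 1)) k ≃ₐ[k] MvPolynomial (Fin (n + 1)) k :=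
  AlgEquiv.ofAlgHom (shear N 1) (shear N (-1))
    (shear_comp_shear_neg N 1) (by simpa using shear_comp_shear_neg (k := k) N (-1))

lemma finSuccEquiv_shearEquiv_X_zero (N : ℕ) :
    finSuccEquiv k n (shearEquiv N (X 0)) = Polynomial.X := by
  simp [shearEquiv, shear, finSuccEquiv_X_zero]

lemma finSuccEquiv_shearEquiv_X_succ (N : ℕ) (i : Fin n) :
    finSuccEquiv k n (shearEquiv N (X i.succ)) =
      Polynomial.X ^ weight N i.succ + Polynomial.C (X i) := by
  simp [shearEquiv, shear, finSuccEquiv_X_zero, finSuccEquiv_X_succ, add_comm]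

lemma monic_finSuccEquiv_shearEquiv_X {N : ℕ} (hN : 0 < N) (i : Fin (n + 1)) :
    (finSuccEquiv k n (shearEquiv N (X i))).Monic ∧
      (finSuccEquiv k n (shearEquiv N (X i))).natDegree = weight N i := by
  cases i using Fin.cases with
  | zero => simp [finSuccEquiv_shearEquiv_X_zero, weight, Polynomial.monic_X]
  | succ i =>
    rw [finSuccEquiv_shearEquiv_X_succ]
    exact ⟨Polynomial.monic_X_pow_add_C _ (pow_pos hN _).ne', Polynomial.natDegree_X_pow_add_C⟩

lemma finSuccEquiv_shearEquiv_monomial {N : ℕ} (hN : 0 < N) (v : Fin (n + 1) →₀ ℕ) (a : k) :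
    ∃ g : Polynomial (MvPolynomial (Fin n) k), g.Monic ∧
      g.natDegree = ∑ i, weight N i * v i ∧
      finSuccEquiv k n (shearEquiv N (monomial v a)) = Polynomial.C (C a) * g := by
  refine ⟨∏ i, finSuccEquiv k n (shearEquiv N (X i)) ^ v i,
    Polynomial.monic_prod_of_monic _ _ fun i _ ↦
      (monic_finSuccEquiv_shearEquiv_X hN i).1.pow _, ?_, ?_⟩
  · rw [Polynomial.natDegree_prod_of_monic _ _ fun i _ ↦
      (monic_finSuccEquiv_shearEquiv_X hN i).1.pow _]
    refine Finset.sum_congr rfl fun i _ ↦ ?_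
    rw [(monic_finSuccEquiv_shearEquiv_X hN i).1.natDegree_pow,
      (monic_finSuccEquiv_shearEquiv_X hN i).2, mul_comm]
  · rw [monomial_eq, Finsupp.prod_fintype _ _ fun i ↦ pow_zero _]
    simp only [map_mul, map_prod, map_pow]
    congr 1
    simp [shearEquiv, shear, finSuccEquiv_apply]

lemma sum_weight_mul_injective {N : ℕ} (hN : 1 < N) {v w : Fin (n + 1) →₀ ℕ}
    (hv : ∀ i, v i < N) (hw : ∀ i, w i < N)
    (h : ∑ i, weight N i * v i = ∑ i, weight N i * w i) : v = w := by
  refine Finsupp.ext <| congrFun <| List.ofFn_inj.mp ?_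
  apply Nat.ofDigits_inj_of_len_eq hN (by simp) (by simpa only [List.forall_mem_ofFn_iff] using hv)
    (by simpa only [List.forall_mem_ofFn_iff] using hw)
  simpa only [Nat.ofDigits_eq_sum_mapIdx, List.mapIdx_eq_ofFn, List.get_ofFn, List.length_ofFn,
    Fin.val_cast, mul_comm, List.sum_ofFn, weight] using! h

/-- After a suitable automorphism, a nonzero polynomial has unit leading coefficient in the
first variable. -/
lemma exists_algEquiv_isUnit_leadingCoeff {f : MvPolynomial (Fin (n + 1)) k} (hf : f ≠ 0) :
    ∃ φ : MvPolynomial (Fin (n + 1)) k ≃ₐ[k] Polynomial (MvPolynomial (Fin n) k),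
      IsUnit (φ f).leadingCoeff := by
  set N := 2 + f.totalDegree with hNdef
  have hN : 1 < N := by omega
  refine ⟨(shearEquiv N).trans (finSuccEquiv k n), ?_⟩
  have hlt : ∀ v ∈ f.support, ∀ i, v i < N := fun v hv i ↦
    lt_of_le_of_lt ((monomial_le_degreeOf i hv).trans (degreeOf_le_totalDegree f i)) (by omega)
  obtain ⟨v, hv, hmax⟩ := Finset.exists_max_image f.support
    (fun v ↦ ∑ i, weight N i * v i) (support_nonempty.mpr hf)
  choose g hgm hgd hg using finSuccEquiv_shearEquiv_monomial (k := k) (n := n)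
    (zero_lt_one.trans hN)
  have hexp : (shearEquiv N).trans (finSuccEquiv k n) f =
      ∑ w ∈ f.support \ {v}, Polynomial.C (C (coeff w f)) * g w (coeff w f) +
        Polynomial.C (C (coeff v f)) * g v (coeff v f) := by
    have hsum : f = ∑ w ∈ f.support \ {v}, monomial w (coeff w f) + monomial v (coeff v f) := by
      conv_lhs => rw [← f.support_sum_monomial_coeff]
      rw [Finset.sum_eq_add_sum_sdiff_singleton_of_mem hv]
      exact add_comm _ _
    refine (congrArg _ hsum).trans ?_
    simp only [map_add, map_sum, AlgEquiv.trans_apply, hg]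
  have hunit : IsUnit (Polynomial.C (C (coeff v f)) * g v (coeff v f)).leadingCoeff := by
    rw [Polynomial.leadingCoeff_mul_monic (hgm _ _), Polynomial.leadingCoeff_C]
    exact (mem_support_iff.mp hv).isUnit.map C
  have hne : Polynomial.C (C (coeff v f)) ≠ (0 : Polynomial (MvPolynomial (Fin n) k)) := by
    simpa using mem_support_iff.mp hv
  rw [hexp, Polynomial.leadingCoeff_add_of_degree_lt]
  · exact hunit
  refine (Polynomial.degree_sum_le _ _).trans_lt ((Finset.sup_lt_iff ?_).mpr ?_)
  · exact bot_lt_iff_ne_bot.mpr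
      (Polynomial.degree_ne_bot.mpr (mul_ne_zero hne (hgm _ _).ne_zero))
  · intro w hw
    obtain ⟨hw, hwv⟩ := Finset.mem_sdiff.mp hw
    have hne' : Polynomial.C (C (coeff w f)) ≠ (0 : Polynomial (MvPolynomial (Fin n) k)) := by
      simpa using mem_support_iff.mp hw
    rw [Polynomial.degree_mul, Polynomial.degree_mul, Polynomial.degree_C (by simpa using hne'),
      Polynomial.degree_C (by simpa using hne), zero_add, zero_add,
      Polynomial.degree_eq_natDegree (hgm _ _).ne_zero,
      Polynomial.degree_eq_natDegree (hgm _ _).ne_zero, hgd, hgd]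
    refine Nat.cast_lt.mpr (lt_of_le_of_ne (hmax w hw) fun h ↦ hwv ?_)
    exact Finset.mem_singleton.mpr (sum_weight_mul_injective hN (hlt w hw) (hlt v hv) h)

end MonicCoordinates

section Serre

/-- If `A` is free over a factorial subring `S` and `α` is a fraction of `A` outside `A`, then the
elements of `S` carrying `α` into `A` lie in a principal prime ideal. -/
lemma exists_prime_dvd_of_smul_mem {S A : Type*} [CommRing S] [IsDomain S]
    [UniqueFactorizationMonoid S] [CommRing A] [IsDomain A] [Algebra S A]
    [Algebra.IsIntegral S A] [Module.Free S A] (α : FractionRing A)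
    (hα : α ∉ (algebraMap A (FractionRing A)).range) :
    ∃ p : S, Prime p ∧ ∀ s : S, algebraMap A (FractionRing A) (algebraMap S A s) * α ∈
      (algebraMap A (FractionRing A)).range → p ∣ s := by
  have hinj : Function.Injective (algebraMap A (FractionRing A)) :=
    IsFractionRing.injective A (FractionRing A)
  obtain ⟨u, v, hv, rfl⟩ := IsFractionRing.div_surjective (A := A) α
  have hv0 : v ≠ 0 := nonZeroDivisors.ne_zero hv
  have hv0' : algebraMap A (FractionRing A) v ≠ 0 := by simpa using hv0
  have hne : Ideal.comap (algebraMap S A) (Ideal.span {v}) ≠ ⊥ :=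
    Ideal.comap_ne_bot_of_integral_mem hv0 (Ideal.mem_span_singleton_self v)
      (Algebra.IsIntegral.isIntegral v)
  obtain ⟨s₀, hs₀, hs₀0⟩ := Submodule.exists_mem_ne_zero_of_ne_bot hne
  obtain ⟨t, ht⟩ := Ideal.mem_span_singleton.mp (Ideal.mem_comap.mp hs₀)
  have hs₀A : algebraMap S A s₀ ≠ 0 := by
    have : Module.IsTorsionFree S A := inferInstance
    have : FaithfulSMul S A := inferInstance
    simpa using hs₀0
  let b := Module.Free.chooseBasis S A
  have key : ∀ s : S, algebraMap A (FractionRing A) (algebraMap S A s) *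
      (algebraMap A (FractionRing A) u / algebraMap A (FractionRing A) v) ∈
      (algebraMap A (FractionRing A)).range → ∀ i, s₀ ∣ s * b.repr (u * t) i := by
    rintro s ⟨x, hx⟩ i
    have hx' : v * x = algebraMap S A s * u := by
      apply hinj
      rw [map_mul, map_mul, hx]
      field_simp
    have : s₀ • x = s • (u * t) := by
      rw [Algebra.smul_def, Algebra.smul_def, ht]
      linear_combination t * hx'
    refine ⟨b.repr x i, ?_⟩
    have := congrArg (fun y ↦ b.repr y i) this
    simpa using this.symm
  have hex : ∃ i, ¬ s₀ ∣ b.repr (u * t) i := by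
    by_contra! hall
    choose d hd using hall
    apply hα
    have hsum : ∃ y : A, s₀ • y = u * t := by
      refine ⟨∑ i ∈ (b.repr (u * t)).support, d i • b i, ?_⟩
      conv_rhs => rw [← b.linearCombination_repr (u * t)]
      rw [Finsupp.linearCombination_apply, Finsupp.sum, Finset.smul_sum]
      refine Finset.sum_congr rfl fun i _ ↦ ?_
      rw [smul_smul, ← hd]
    obtain ⟨y, hy⟩ := hsum
    refine ⟨y, ?_⟩
    rw [eq_div_iff hv0', ← map_mul]
    congr 1
    rw [Algebra.smul_def, ht] at hy
    have ht0 : t ≠ 0 := by rintro rfl; simp_all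
    apply mul_right_cancel₀ ht0
    linear_combination hy
  obtain ⟨i, hi⟩ := hex
  obtain ⟨s', w', c, hrel, hs', hw'⟩ :=
    UniqueFactorizationMonoid.exists_reduced_factors s₀ hs₀0 (b.repr (u * t) i)
  have hc0 : c ≠ 0 := by rintro rfl; simp_all
  have hs'0 : s' ≠ 0 := by rintro rfl; simp_all
  have hnu : ¬ IsUnit s' := by
    intro hu
    apply hi
    rw [← hs', ← hw']
    exact mul_dvd_mul_left c (hu.dvd)
  obtain ⟨p, hp, hps⟩ := WfDvdMonoid.exists_irreducible_factor hnu hs'0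
  refine ⟨p, hp.prime, fun s hs ↦ hps.trans ?_⟩
  have h1 := key s hs i
  rw [← hs', ← hw', mul_left_comm] at h1
  exact hrel.dvd_of_dvd_mul_right ((mul_dvd_mul_iff_left hc0).mp h1)

/-- A Serre-type criterion: a domain which is finite and free over a factorial ring is normal as
soon as it is normal at its primes of height at most one. -/
theorem isIntegrallyClosed_of_free {S A : Type*} [CommRing S] [IsDomain S]
    [UniqueFactorizationMonoid S] [CommRing A] [IsDomain A] [Algebra S A]
    [Algebra.IsIntegral S A] [Module.Free S A]
    (h : ∀ α : FractionRing A, IsIntegral A α → ∀ Q : Ideal A, Q.IsPrime →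
      (∀ q : Ideal A, q.IsPrime → q ≤ Q → q ≠ ⊥ → q = Q) →
      ∃ r ∉ Q, algebraMap A (FractionRing A) r * α ∈ (algebraMap A (FractionRing A)).range) :
    IsIntegrallyClosed A := by
  rw [isIntegrallyClosed_iff (FractionRing A)]
  intro α hα
  by_contra hmem
  obtain ⟨p, hp, hdvd⟩ := exists_prime_dvd_of_smul_mem (S := S) α hmem
  have : FaithfulSMul S A := inferInstance
  let J : Ideal A :=
    { carrier := {r | algebraMap A (FractionRing A) r * α ∈ (algebraMap A (FractionRing A)).range}
      zero_mem' := by simp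
      add_mem' := fun {x y} hx hy ↦ by
        simp only [Set.mem_ofPred_eq, map_add, add_mul] at *
        exact add_mem hx hy
      smul_mem' := fun x y hy ↦ by
        simp only [Set.mem_ofPred_eq, smul_eq_mul, map_mul, mul_assoc] at *
        exact mul_mem ⟨x, rfl⟩ hy }
  have hP : (Ideal.span {p}).IsPrime := (Ideal.span_singleton_prime hp.ne_zero).mpr hp
  obtain ⟨Q, hJQ, hQ, hQp⟩ := Ideal.exists_ideal_over_prime_of_isIntegral (Ideal.span {p}) J
    (fun s hs ↦ Ideal.mem_span_singleton.mpr (hdvd s hs))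
  obtain ⟨r, hrQ, hr⟩ := h α hα Q hQ fun q hq hqQ hq0 ↦ by
    have hne : Ideal.comap (algebraMap S A) q ≠ ⊥ := fun h0 ↦
      hq0 (Ideal.eq_bot_of_comap_eq_bot h0)
    have hle : Ideal.comap (algebraMap S A) q ≤ Ideal.span {p} :=
      hQp ▸ Ideal.comap_mono hqQ
    have hpq : algebraMap S A p ∈ q := by
      have hprime : (Ideal.comap (algebraMap S A) q).IsPrime := inferInstance
      obtain ⟨y, hy, hyp⟩ := hprime.exists_mem_prime_of_ne_bot hne
      have hpy : p ∣ y := Ideal.mem_span_singleton.mp (hle hy)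
      exact Ideal.mem_of_dvd (Ideal.comap (algebraMap S A) q)
        (hp.irreducible.associated_of_dvd hyp.irreducible hpy).symm.dvd hy
    by_contra hqne
    obtain ⟨x, hxQ, hxq⟩ := SetLike.exists_of_lt (lt_of_le_of_ne hqQ hqne)
    have hlt := Ideal.comap_lt_comap_of_integral_mem_sdiff (R := S) hqQ ⟨hxQ, hxq⟩
      (Algebra.IsIntegral.isIntegral x)
    rw [hQp] at hlt
    exact hlt.not_ge ((Ideal.span_singleton_le_iff_mem _).mpr hpq)
  exact hrQ (hJQ hr)

end Serre

section Linear

/-- Where the coefficient `a` of a linear relation `a x + b = 0` over a normal domain is invertible,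
the resulting ring is normal. -/
lemma exists_pow_mul_mem_of_linear {B A : Type*} [CommRing B] [IsDomain B] [IsIntegrallyClosed B]
    [CommRing A] [IsDomain A] (π : Polynomial B →+* A) (hπ : Function.Surjective π) {a b : B}
    (ha : π (Polynomial.C a) ≠ 0)
    (hker : RingHom.ker π = Ideal.span {Polynomial.C a * Polynomial.X + Polynomial.C b})
    (α : FractionRing A) (hα : IsIntegral A α) :
    ∃ N : ℕ, algebraMap A (FractionRing A) (π (Polynomial.C a) ^ N) * α ∈
      (algebraMap A (FractionRing A)).range := by
  have ha0 : a ≠ 0 := by rintro rfl; simp at ha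
  let L := Localization.Away a
  have hM : Submonoid.powers a ≤ nonZeroDivisors B := powers_le_nonZeroDivisors_of_noZeroDivisors ha0
  have : IsDomain L := IsLocalization.isDomain_localization hM
  have : IsIntegrallyClosed L := isIntegrallyClosed_of_isLocalization L (Submonoid.powers a) hM
  have hBL : Function.Injective (algebraMap B L) := IsLocalization.injective L hM
  have hau : algebraMap B L a * IsLocalization.Away.invSelf a = 1 :=
    IsLocalization.Away.mul_invSelf a
  let y : L := -(algebraMap B L b * IsLocalization.Away.invSelf a)
  have hy : algebraMap B L a * y + algebraMap B L b = 0 := by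
    simp only [y]; linear_combination (-algebraMap B L b) * hau
  let ψ' : Polynomial B →+* L := Polynomial.eval₂RingHom (algebraMap B L) y
  have hpi0 : π (Polynomial.C a) * π Polynomial.X + π (Polynomial.C b) = 0 := by
    rw [← map_mul, ← map_add, ← RingHom.mem_ker, hker]
    exact Ideal.mem_span_singleton_self _
  -- every element becomes congruent to a constant after multiplication by a power of `a`
  have hconst : ∀ r : Polynomial B, ∃ N : ℕ, ∃ c : B,
      π (Polynomial.C a) ^ N * π r = π (Polynomial.C c) ∧ algebraMap B L a ^ N * ψ' r =
        algebraMap B L c := by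
    intro r
    induction r using Polynomial.induction_on' with
    | add p q hp hq =>
      obtain ⟨N, c, h1, h2⟩ := hp
      obtain ⟨M, d, h3, h4⟩ := hq
      refine ⟨N + M, a ^ M * c + a ^ N * d, ?_, ?_⟩
      · simp only [map_add, map_mul, map_pow, ← h1, ← h3]; ring
      · simp only [map_add, map_mul, map_pow, ← h2, ← h4]; ring
    | monomial n s =>
      refine ⟨n, s * (-b) ^ n, ?_, ?_⟩
      · rw [← Polynomial.C_mul_X_pow_eq_monomial]
        simp only [map_mul, map_pow, map_neg]
        rw [← eq_neg_of_add_eq_zero_left hpi0]; ring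
      · rw [← Polynomial.C_mul_X_pow_eq_monomial]
        have : ψ' (Polynomial.C s * Polynomial.X ^ n) = algebraMap B L s * y ^ n := by simp [ψ']
        rw [this]
        simp only [map_mul, map_pow, map_neg]
        rw [← eq_neg_of_add_eq_zero_left hy]; ring
  have hker' : ∀ r, π r = 0 ↔ ψ' r = 0 := by
    have hle : RingHom.ker π ≤ RingHom.ker ψ' := by
      rw [hker, Ideal.span_singleton_le_iff_mem, RingHom.mem_ker]
      simpa [ψ'] using hy
    refine fun r ↦ ⟨fun h ↦ hle h, fun h ↦ ?_⟩
    obtain ⟨N, c, h1, h2⟩ := hconst r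
    rw [h, mul_zero] at h2
    have hc : c = 0 := hBL (by rw [← h2, map_zero])
    rw [hc, map_zero, map_zero] at h1
    exact (mul_eq_zero.mp h1).resolve_left (pow_ne_zero _ ha)
  let ψ : A →+* L := π.liftOfSurjective hπ ⟨ψ', fun r hr ↦ (hker' r).mp hr⟩
  have hψ : ∀ r, ψ (π r) = ψ' r := fun r ↦
    RingHom.liftOfRightInverse_comp_apply π _ _ ⟨ψ', fun r hr ↦ (hker' r).mp hr⟩ r
  have hψinj : Function.Injective ψ := by
    rw [injective_iff_map_eq_zero]
    intro x hx
    obtain ⟨r, rfl⟩ := hπ x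
    exact (hker' r).mpr (hψ r ▸ hx)
  let K := FractionRing A
  let E := FractionRing L
  have hKE : Function.Injective ((algebraMap L E).comp ψ) :=
    (IsFractionRing.injective L E).comp hψinj
  let Ψ : K →+* E := IsFractionRing.lift hKE
  have hΨ : ∀ x, Ψ (algebraMap A K x) = algebraMap L E (ψ x) := fun x ↦
    IsFractionRing.lift_algebraMap hKE x
  have hint : IsIntegral L (Ψ α) := by
    obtain ⟨p, hp, hp0⟩ := hα
    refine ⟨p.map ψ, hp.map ψ, ?_⟩
    have : (algebraMap L E).comp ψ = Ψ.comp (algebraMap A K) := RingHom.ext fun x ↦ (hΨ x).symm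
    rw [Polynomial.eval₂_map, this, ← Polynomial.hom_eval₂, hp0, map_zero]
  obtain ⟨z, hz⟩ := IsIntegrallyClosed.isIntegral_iff.mp hint
  obtain ⟨N, c, hc⟩ := IsLocalization.Away.surj a z
  refine ⟨N, π (Polynomial.C c), Ψ.injective ?_⟩
  have hψC : ∀ s, ψ (π (Polynomial.C s)) = algebraMap B L s := fun s ↦ by simp [hψ, ψ']
  rw [map_mul, hΨ, hΨ, map_pow, hψC, hψC, ← hz, ← map_mul, ← hc, mul_comm]

end Linear

section Multiaffine

/-- Let `A` be defined by one linear relation `a x + b = 0` over `B`. If `A` fails to be normal at a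
prime `Q` of height at most one, then `Q` is extended from `B`. -/
lemma comap_eq_map_C_of_not_normal {B A : Type*} [CommRing B] [IsDomain B] [IsIntegrallyClosed B]
    [CommRing A] [IsDomain A] (π : Polynomial B →+* A) (hπ : Function.Surjective π) {a b : B}
    (ha : π (Polynomial.C a) ≠ 0)
    (hker : RingHom.ker π = Ideal.span {Polynomial.C a * Polynomial.X + Polynomial.C b})
    (α : FractionRing A) (hα : IsIntegral A α) (Q : Ideal A) [hQ : Q.IsPrime]
    (hQ1 : ∀ q : Ideal A, q.IsPrime → q ≤ Q → q ≠ ⊥ → q = Q)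
    (hno : ∀ r ∉ Q, algebraMap A (FractionRing A) r * α ∉ (algebraMap A (FractionRing A)).range) :
    Q.comap π = Ideal.map Polynomial.C ((Q.comap π).comap Polynomial.C) := by
  set p := (Q.comap π).comap Polynomial.C
  have hpQ : Ideal.map Polynomial.C p ≤ Q.comap π := Ideal.map_comap_le
  have haQ : π (Polynomial.C a) ∈ Q := by
    obtain ⟨N, hN⟩ := exists_pow_mul_mem_of_linear π hπ ha hker α hα
    by_contra haQ
    exact hno _ (fun h ↦ haQ (hQ.mem_of_pow_mem N h)) hN
  have hpi0 : π (Polynomial.C a) * π Polynomial.X + π (Polynomial.C b) = 0 := by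
    rw [← map_mul, ← map_add, ← RingHom.mem_ker, hker]
    exact Ideal.mem_span_singleton_self _
  have hbQ : π (Polynomial.C b) ∈ Q := by
    rw [eq_neg_of_add_eq_zero_right hpi0]
    exact Q.neg_mem (Q.mul_mem_right _ haQ)
  have haq : Polynomial.C a ∈ Ideal.map Polynomial.C p := Ideal.mem_map_of_mem _ haQ
  have hbq : Polynomial.C b ∈ Ideal.map Polynomial.C p := Ideal.mem_map_of_mem _ hbQ
  have hkerp : RingHom.ker π ≤ Ideal.map Polynomial.C p := by
    rw [hker, Ideal.span_singleton_le_iff_mem]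
    exact add_mem (Ideal.mul_mem_right _ _ haq) hbq
  have hprime : (Ideal.map π (Ideal.map Polynomial.C p)).IsPrime :=
    Ideal.map_isPrime_of_surjective hπ hkerp
  have hq := hQ1 _ hprime (Ideal.map_le_iff_le_comap.mpr hpQ) fun h ↦
    ha (by simpa [h] using Ideal.mem_map_of_mem π haq)
  rw [← hq, Ideal.comap_map_of_surjective' π hπ, sup_eq_left.mpr hkerp]

variable {k σ : Type*} [Field k]

/-- A polynomial ring modulo a nonzero polynomial is finite free over another polynomial ring. -/
lemma exists_finite_free_of_ker_eq_span [Finite σ] [Nonempty σ] {A : Type*} [CommRing A]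
    (π : MvPolynomial σ k →+* A) (hπ : Function.Surjective π) {f : MvPolynomial σ k} (hf : f ≠ 0)
    (hker : RingHom.ker π = Ideal.span {f}) :
    ∃ (n : ℕ) (_ : Algebra (MvPolynomial (Fin n) k) A),
      Module.Finite (MvPolynomial (Fin n) k) A ∧ Module.Free (MvPolynomial (Fin n) k) A := by
  obtain ⟨n, hn⟩ : ∃ n, Nat.card σ = n + 1 := Nat.exists_eq_succ_of_ne_zero Nat.card_pos.ne'
  let e := renameEquiv k (Finite.equivFinOfCardEq hn)
  obtain ⟨φ, hφ⟩ := exists_algEquiv_isUnit_leadingCoeff (f := e f) (by simpa using hf)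
  set g := φ (e f) with hg
  obtain ⟨u, hu⟩ := hφ
  have hmonic : (Polynomial.C (↑u⁻¹ : MvPolynomial (Fin n) k) * g).Monic := by
    rw [Polynomial.Monic, Polynomial.leadingCoeff_mul, Polynomial.leadingCoeff_C, ← hu,
      Units.inv_mul]
  have hspan : Ideal.span {Polynomial.C (↑u⁻¹ : MvPolynomial (Fin n) k) * g} = Ideal.span {g} :=
    Ideal.span_singleton_mul_left_unit (u⁻¹.isUnit.map Polynomial.C) g
  let E : MvPolynomial σ k ≃+* Polynomial (MvPolynomial (Fin n) k) := (e.trans φ).toRingEquiv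
  let E' : (MvPolynomial σ k ⧸ RingHom.ker π) ≃+* AdjoinRoot
      (Polynomial.C (↑u⁻¹ : MvPolynomial (Fin n) k) * g) :=
    Ideal.quotientEquiv _ _ E (by rw [hspan, hker, Ideal.map_span, Set.image_singleton]; rfl)
  let E'' := E'.symm.trans (RingHom.quotientKerEquivOfSurjective hπ)
  let _ : Algebra (MvPolynomial (Fin n) k) A :=
    (E''.toRingHom.comp (algebraMap (MvPolynomial (Fin n) k) _)).toAlgebra
  let L : AdjoinRoot (Polynomial.C (↑u⁻¹ : MvPolynomial (Fin n) k) * g) ≃ₐ[MvPolynomial (Fin n) k]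
      A := AlgEquiv.ofRingEquiv (f := E'') fun _ ↦ rfl
  have := hmonic.free_adjoinRoot
  have := hmonic.finite_adjoinRoot
  exact ⟨n, inferInstance, Module.Finite.equiv L.toLinearEquiv, Module.Free.of_equiv L.toLinearEquiv⟩

open Classical in
/-- A polynomial ring viewed as a univariate polynomial ring in the variable `v`. -/
noncomputable def splitVar (k : Type*) [Field k] (v : σ) :
    MvPolynomial σ k ≃ₐ[k] Polynomial (MvPolynomial {w // w ≠ v} k) :=
  (renameEquiv k (Equiv.optionSubtypeNe v).symm).trans (optionEquivLeft k {w // w ≠ v})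

open Classical in
lemma natDegree_splitVar (v : σ) (f : MvPolynomial σ k) :
    (splitVar k v f).natDegree = degreeOf v f := by
  rw [degreeOf_eq_natDegree]
  rfl

lemma splitVar_X_self (v : σ) : splitVar k v (X v) = Polynomial.X := by
  simp [splitVar]

lemma splitVar_X_of_ne {v w : σ} (h : w ≠ v) :
    splitVar k v (X w) = Polynomial.C (X ⟨w, h⟩) := by
  simp [splitVar, h]

open Classical in
/-- Substitution of the values `c` for the variables in `s`. -/
noncomputable def specialize (c : σ → k) (s : Finset σ) : MvPolynomial σ k →ₐ[k] MvPolynomial σ k :=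
  aeval fun w ↦ if w ∈ s then C (c w) else X w

lemma specialize_insert (c : σ → k) [DecidableEq σ] (s : Finset σ) (v : σ) :
    specialize c (insert v s) = (specialize c {v}).comp (specialize c s) := by
  ext1 w
  by_cases hs : w ∈ s
  · simp [specialize, hs]
  · simp [specialize, hs]

lemma specialize_vars (c : σ → k) (f : MvPolynomial σ k) :
    specialize c f.vars f = C (eval c f) := by
  have h : specialize c f.vars f = aeval (fun w ↦ (C (c w) : MvPolynomial σ k)) f := by
    rw [specialize, aeval_def, aeval_def]
    exact eval₂Hom_congr' rfl (fun w hw _ ↦ by simp [hw]) rfl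
  rw [h]
  exact aeval_algebraMap_apply (MvPolynomial σ k) c f

lemma splitVar_specialize_singleton (c : σ → k) (v : σ) (r : MvPolynomial σ k) :
    splitVar k v (specialize c {v} r) =
      Polynomial.C (Polynomial.eval (C (c v)) (splitVar k v r)) := by
  let Ψ : MvPolynomial σ k →+* Polynomial (MvPolynomial {w // w ≠ v} k) :=
    Polynomial.C.comp ((Polynomial.evalRingHom (C (c v))).comp (splitVar k v).toRingEquiv.toRingHom)
  have hC : ∀ a : k, splitVar k v (C a) = Polynomial.C (C a) := (splitVar k v).commutes
  have : (splitVar k v).toRingEquiv.toRingHom.comp (specialize c {v}).toRingHom = Ψ := by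
    refine MvPolynomial.ringHom_ext (fun a ↦ ?_) fun w ↦ ?_
    · simp [Ψ, specialize, hC]
    · by_cases h : w = v
      · subst h
        simp [Ψ, specialize, splitVar_X_self, hC]
      · simp [Ψ, specialize, h, splitVar_X_of_ne h]
  exact congrArg (fun g : MvPolynomial σ k →+* _ ↦ g r) this

/-- A prime polynomial of degree at most one in each variable defines a normal hypersurface. -/
theorem isIntegrallyClosed_quotient_of_degreeOf_le_one [Infinite k] [Finite σ]
    {A : Type*} [CommRing A] [IsDomain A] (mk : MvPolynomial σ k →+* A)
    (hmk : Function.Surjective mk) {f : MvPolynomial σ k} (hf : Prime f)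
    (hmk_ker : RingHom.ker mk = Ideal.span {f}) (hdeg : ∀ v, degreeOf v f ≤ 1) :
    IsIntegrallyClosed A := by
  classical
  have hne : Nonempty σ := by
    by_contra hemp
    rw [not_nonempty_iff] at hemp
    have hfc := eq_C_of_isEmpty f
    refine hf.not_isUnit (hfc ▸ IsUnit.map C (isUnit_iff_ne_zero.mpr fun h0 ↦ hf.ne_zero ?_))
    rw [hfc, h0, C_0]
  have hmk0 : ∀ r, mk r = 0 ↔ f ∣ r := fun r ↦ by
    rw [← RingHom.mem_ker, hmk_ker, Ideal.mem_span_singleton]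
  obtain ⟨n, _, _, _⟩ := exists_finite_free_of_ker_eq_span mk hmk hf.ne_zero hmk_ker
  refine isIntegrallyClosed_of_free (S := MvPolynomial (Fin n) k) fun α hα Q hQ hQ1 ↦ ?_
  by_contra! hno
  have hstable : ∀ (c : σ → k), ∀ v ∈ f.vars, ∀ r, mk r ∈ Q → mk (specialize c {v} r) ∈ Q := by
    intro c v hv r hr
    let e := splitVar k v
    have hle : (e f).natDegree ≤ 1 := by rw [natDegree_splitVar]; exact hdeg v
    obtain ⟨a, b, hab⟩ := Polynomial.exists_eq_X_add_C_of_natDegree_le_one hle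
    have hdv : 0 < (e f).natDegree := by
      rw [natDegree_splitVar, pos_iff_ne_zero]
      exact mem_vars_iff_degreeOf_ne_zero.mp hv
    have ha0 : a ≠ 0 := by
      rintro rfl
      simp [hab] at hdv
    let π : Polynomial (MvPolynomial {w // w ≠ v} k) →+* A :=
      mk.comp e.symm.toRingEquiv.toRingHom
    have hπe : ∀ r, π (e r) = mk r := fun r ↦ by simp [π]
    have hπ : Function.Surjective π := fun x ↦ by
      obtain ⟨r, rfl⟩ := hmk x
      exact ⟨e r, hπe r⟩
    have hker : ∀ r, π r = 0 ↔ e f ∣ r := fun r ↦ by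
      obtain ⟨r, rfl⟩ := e.surjective r
      rw [hπe, hmk0, map_dvd_iff]
    have ha : π (Polynomial.C a) ≠ 0 := fun h ↦ by
      have := Polynomial.natDegree_le_of_dvd ((hker _).mp h) (by simpa using ha0)
      rw [Polynomial.natDegree_C] at this
      omega
    have hext := comap_eq_map_C_of_not_normal π hπ ha
      (by ext r; rw [RingHom.mem_ker, hker, ← hab, Ideal.mem_span_singleton]) α hα Q hQ1 hno
    have hmem : e r ∈ Q.comap π := by rwa [Ideal.mem_comap, hπe]
    rw [hext, Ideal.mem_map_C_iff] at hmem
    rw [← hπe, splitVar_specialize_singleton, ← Ideal.mem_comap, ← Ideal.mem_comap,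
      Polynomial.eval_eq_sum_range]
    exact sum_mem fun i _ ↦ Ideal.mul_mem_right _ _ (hmem i)
  have hall : ∀ (c : σ → k) (s : Finset σ), s ⊆ f.vars → mk (specialize c s f) ∈ Q := by
    intro c s hs
    induction s using Finset.induction_on with
    | empty =>
      have : specialize c ∅ f = f := by simp [specialize]
      rw [this, (hmk0 f).mpr dvd_rfl]
      exact zero_mem _
    | insert v s _ ih =>
      rw [specialize_insert]
      exact hstable c v (hs (Finset.mem_insert_self _ _)) _
        (ih ((Finset.subset_insert _ _).trans hs))
  obtain ⟨c, hc⟩ : ∃ c, eval c f ≠ 0 := by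
    by_contra! h
    exact hf.ne_zero (MvPolynomial.funext fun c ↦ by simp [h])
  have hmem := hall c f.vars subset_rfl
  rw [specialize_vars] at hmem
  exact hQ.ne_top (Q.eq_top_of_isUnit_mem hmem (((isUnit_iff_ne_zero.mpr hc).map C).map mk))

end Multiaffine

section Chart

variable {n : ℕ} {m : Fin n → ℕ}

lemma degreeOf_chart_le {F : MvPolynomial (MultiProj.Idx m) ℂ}
    (hF : MultiProj.IsMultiHomog m F fun _ ↦ 1) (c : ∀ i, Fin (m i + 1)) (v : MultiProj.Idx m) :
    degreeOf v (MultiProj.chart m F c) ≤ 1 := by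
  classical
  rw [MultiProj.chart, aeval_def, eval₂_eq']
  refine (degreeOf_sum_le _ _ _).trans (Finset.sup_le fun p hp ↦ ?_)
  refine (degreeOf_C_mul_le _ _ _).trans ((degreeOf_prod_le _ _ _).trans ?_)
  have hle : ∀ w ∈ Finset.univ, degreeOf v
      ((if w.2 = c w.1 then 1 else X w : MvPolynomial (MultiProj.Idx m) ℂ) ^ p w) ≤
      if w = v then p v else 0 := by
    intro w _
    refine (degreeOf_pow_le _ _ _).trans ?_
    by_cases hw : w.2 = c w.1
    · simp [hw, degreeOf_one]
    · rw [if_neg hw, degreeOf_X]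
      by_cases hwv : w = v
      · subst hwv; simp
      · simp [hwv, Ne.symm hwv]
  refine (Finset.sum_le_sum hle).trans ?_
  rw [Finset.sum_ite_eq' Finset.univ v fun _ ↦ p v, if_pos (Finset.mem_univ _)]
  refine le_of_le_of_eq ?_ (hF p hp v.1)
  exact Finset.single_le_sum (f := fun j ↦ p ⟨v.1, j⟩) (fun _ _ ↦ Nat.zero_le _)
    (Finset.mem_univ v.2)

lemma aeval_scale {F : MvPolynomial (MultiProj.Idx m) ℂ}
    (hF : MultiProj.IsMultiHomog m F fun _ ↦ 1) {L : Type*} [CommRing L] [Algebra ℂ L]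
    (t : Fin n → L) (y : MultiProj.Idx m → L) :
    aeval (fun v ↦ t v.1 * y v) F = (∏ i, t i) * aeval y F := by
  rw [aeval_def, aeval_def, eval₂_eq', eval₂_eq', Finset.mul_sum]
  refine Finset.sum_congr rfl fun p hp ↦ ?_
  have : ∏ v : MultiProj.Idx m, t v.1 ^ p v = ∏ i, t i := by
    rw [Fintype.prod_sigma]
    refine Finset.prod_congr rfl fun i _ ↦ ?_
    exact (Finset.prod_pow_eq_pow_sum _ (fun j ↦ p ⟨i, j⟩) (t i)).trans
      ((congrArg (t i ^ ·) (hF p hp i)).trans (pow_one _))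
  simp only [mul_pow, Finset.prod_mul_distrib, this]
  ring

/-- Dehomogenization preserves primality, unless it produces a unit. -/
lemma prime_chart {F : MvPolynomial (MultiProj.Idx m) ℂ} (hirr : Irreducible F)
    (hF : MultiProj.IsMultiHomog m F fun _ ↦ 1) (c : ∀ i, Fin (m i + 1))
    (hunit : ¬ IsUnit (MultiProj.chart m F c)) : Prime (MultiProj.chart m F c) := by
  set f := MultiProj.chart m F c with hf
  have hFp : Prime F := hirr.prime
  let M : MvPolynomial (MultiProj.Idx m) ℂ := ∏ i, X ⟨i, c i⟩
  have hM0 : M ≠ 0 := Finset.prod_ne_zero_iff.mpr fun i _ ↦ X_ne_zero _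
  have hFM : ¬ F ∣ M := by
    intro h
    obtain ⟨i, -, hi⟩ := (hFp.dvd_finsetProd_iff _).mp h
    obtain ⟨w, hw⟩ := hirr.associated_of_dvd (X_prime (R := ℂ)).irreducible hi
    apply hunit
    have h1 : f * aeval (fun v : MultiProj.Idx m ↦
        if v.2 = c v.1 then (1 : MvPolynomial (MultiProj.Idx m) ℂ) else X v)
        (w : MvPolynomial (MultiProj.Idx m) ℂ) = 1 := by
      rw [hf, MultiProj.chart, ← map_mul, hw, aeval_X]
      simp
    exact IsUnit.of_mul_eq_one _ h1
  let L := Localization.Away M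
  have hMle : Submonoid.powers M ≤ nonZeroDivisors _ :=
    powers_le_nonZeroDivisors_of_noZeroDivisors hM0
  have : IsDomain L := IsLocalization.isDomain_localization hMle
  let ι := algebraMap (MvPolynomial (MultiProj.Idx m) ℂ) L
  have hι : Function.Injective ι := IsLocalization.injective L hMle
  have hMu : IsUnit (ι M) := IsLocalization.Away.algebraMap_isUnit M
  have hXu : ∀ i, IsUnit (ι (X ⟨i, c i⟩)) := fun i ↦
    isUnit_of_dvd_unit (map_dvd ι (Finset.dvd_prod_of_mem
      (fun i ↦ (X ⟨i, c i⟩ : MvPolynomial (MultiProj.Idx m) ℂ)) (Finset.mem_univ i))) hMu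
  choose t ht using fun i ↦ (hXu i).exists_right_inv
  have htu : IsUnit (∏ i, t i) := by
    rw [IsUnit.prod_univ_iff]
    exact fun i ↦ IsUnit.of_mul_eq_one (ι (X ⟨i, c i⟩)) (by rw [mul_comm, ht])
  -- `θ` rehomogenizes, and `τ` undoes it after inverting the chart coordinates.
  let θ : MvPolynomial (MultiProj.Idx m) ℂ →ₐ[ℂ] L := aeval fun v ↦
    if v.2 = c v.1 then ι (X v) else t v.1 * ι (X v)
  let τ₀ : MvPolynomial (MultiProj.Idx m) ℂ →ₐ[ℂ] L := aeval fun v ↦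
    if v.2 = c v.1 then ι (X v) else ι (X ⟨v.1, c v.1⟩) * ι (X v)
  have hτ₀c : ∀ i, τ₀ (X ⟨i, c i⟩) = ι (X ⟨i, c i⟩) := fun i ↦ by simp [τ₀]
  have hτ₀M : IsUnit (τ₀.toRingHom M) := by
    have : τ₀.toRingHom M = ι M := by
      simp only [M, map_prod]
      exact Finset.prod_congr rfl fun i _ ↦ hτ₀c i
    rwa [this]
  let τ : L →+* L := IsLocalization.Away.lift M hτ₀M
  have hτι : ∀ r, τ (ι r) = τ₀ r := fun r ↦ IsLocalization.Away.lift_eq M hτ₀M r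
  have hτt : ∀ i, τ (t i) = t i := fun i ↦ by
    have h1 := congrArg τ (ht i)
    rw [map_mul, hτι, hτ₀c, map_one, ← ht i] at h1
    exact (hXu i).mul_left_cancel h1
  have hτθ : ∀ r, τ (θ r) = ι r := by
    have : τ.comp θ.toRingHom = ι := by
      refine MvPolynomial.ringHom_ext (fun a ↦ ?_) fun v ↦ ?_
      · have h1 : θ (C a) = ι (C a) := θ.commutes a
        have h2 : τ₀ (C a) = ι (C a) := τ₀.commutes a
        change τ (θ (C a)) = ι (C a)
        rw [h1, hτι, h2]
      · change τ (θ (X v)) = ι (X v)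
        by_cases hv : v.2 = c v.1
        · simp [θ, τ₀, hv, hτι]
        · simp only [θ, τ₀, aeval_X, hv, if_false, map_mul, hτt, hτι]
          rw [← mul_assoc, mul_comm (t v.1), ht, one_mul]
    exact fun r ↦ congrArg (fun g : _ →+* L ↦ g r) this
  have hθf : θ f = (∏ i, t i) * ι F := by
    have h1 : θ f = aeval (fun v ↦ t v.1 * ι (X v)) F := by
      rw [hf, MultiProj.chart, ← AlgHom.comp_apply, comp_aeval]
      congr 2
      funext v
      by_cases hv : v.2 = c v.1
      · obtain ⟨i, j⟩ := v
        simp only at hv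
        subst hv
        simp [mul_comm (t i), ht]
      · simp [θ, hv]
    have h2 : aeval (fun v ↦ ι (X v)) F = ι F := by
      rw [← aeval_X_left_apply F]
      exact (aeval_algebraMap_apply L X (aeval X F)).trans (by simp [ι])
    rw [h1, aeval_scale hF, h2]
  have hf0 : f ≠ 0 := by
    intro h
    rw [h, map_zero] at hθf
    exact (mul_ne_zero htu.ne_zero ((map_ne_zero_iff ι hι).mpr hFp.ne_zero)) hθf.symm
  have hcop : ∀ N : ℕ, IsRelPrime f (M ^ N) := by
    intro N
    refine IsRelPrime.pow_right (IsRelPrime.prod_right fun i _ ↦ ?_)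
    refine ((X_prime (R := ℂ)).irreducible.isRelPrime_iff_not_dvd.mpr fun hdvd ↦ hf0 ?_).symm
    let ε : MvPolynomial (MultiProj.Idx m) ℂ →ₐ[ℂ] MvPolynomial (MultiProj.Idx m) ℂ :=
      aeval fun v ↦ if v.2 = c v.1 then 0 else X v
    have hεf : ε f = f := by
      rw [hf, MultiProj.chart, ← AlgHom.comp_apply, comp_aeval]
      congr 2
      funext v
      by_cases hv : v.2 = c v.1 <;> simp [ε, hv]
    have h0 := map_dvd ε hdvd
    rw [hεf] at h0
    simpa [ε] using h0
  have hback : ∀ r, ι F ∣ θ r → f ∣ r := by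
    intro r hr
    have h1 : θ f ∣ θ r := by
      rw [hθf]
      exact (htu.mul_left_dvd).mpr hr
    obtain ⟨z, hz⟩ := map_dvd τ h1
    rw [hτθ, hτθ] at hz
    obtain ⟨N, z', hz'⟩ := IsLocalization.Away.surj M z
    have h2 : M ^ N * r = f * z' := hι (by
      rw [map_mul, map_mul, hz, map_pow]
      linear_combination ι f * hz')
    exact (hcop N).dvd_of_dvd_mul_left ⟨z', h2⟩
  refine ⟨hf0, hunit, fun g h hgh ↦ ?_⟩
  have h1 : ι F ∣ θ g * θ h := by
    rw [← map_mul]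
    exact (Dvd.intro_left _ hθf.symm).trans (map_dvd θ hgh)
  obtain ⟨N₁, g', hg'⟩ := IsLocalization.Away.surj M (θ g)
  obtain ⟨N₂, h', hh'⟩ := IsLocalization.Away.surj M (θ h)
  obtain ⟨z, hz⟩ := h1
  obtain ⟨N₃, z', hz'⟩ := IsLocalization.Away.surj M z
  have h2 : F * (M ^ (N₁ + N₂) * z') = M ^ N₃ * (g' * h') := hι (by
    simp only [map_mul, map_pow]
    change _ = ι M ^ N₃ * (algebraMap _ L g' * algebraMap _ L h')
    rw [← hg', ← hh']
    change _ * (_ * algebraMap _ L z') = _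
    rw [← hz']
    linear_combination (-(ι M ^ (N₁ + N₂ + N₃))) * hz)
  have h3 : F ∣ M ^ N₃ * (g' * h') := ⟨_, h2.symm⟩
  have hlift : ∀ (r r' : MvPolynomial (MultiProj.Idx m) ℂ) (N : ℕ),
      θ r * ι M ^ N = ι r' → F ∣ r' → f ∣ r := fun r r' N hrr hd ↦
    hback r (((hMu.pow N).dvd_mul_right).mp (hrr ▸ map_dvd ι hd))
  rcases hFp.dvd_or_dvd h3 with h4 | h4
  · exact absurd (hFp.dvd_of_dvd_pow h4) hFM
  · exact (hFp.dvd_or_dvd h4).imp (hlift g g' N₁ hg') (hlift h h' N₂ hh')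

end Chart

end MultiaffineNormal

/-- an irreducible divisor of multidegree `(1,...,1)` in `∏ i, ℙ^(m i)` is normal. -/
theorem normal_of_irreducible_multidegree_one
    (n : ℕ) (hn : 1 ≤ n) (m : Fin n → ℕ) (hm : ∀ i, 1 ≤ m i)
    (F : MvPolynomial (MultiProj.Idx m) ℂ)
    (hirr : Irreducible F)
    (hdeg : MultiProj.IsMultiHomog m F (fun _ => 1)) :
    MultiProj.IsNormalHypersurface m F := by
  intro c hc
  have hp := MultiaffineNormal.prime_chart hirr hdeg c hc
  have : (Ideal.span {MultiProj.chart m F c}).IsPrime :=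
    (Ideal.span_singleton_prime hp.ne_zero).mpr hp
  exact ⟨inferInstance, MultiaffineNormal.isIntegrallyClosed_quotient_of_degreeOf_le_one
    (Ideal.Quotient.mk _) Ideal.Quotient.mk_surjective hp Ideal.mk_ker
    (MultiaffineNormal.degreeOf_chart_le hdeg c)⟩
end

section
/- Let $m_1,\dots,m_n$ be positive integers and $D$ an irreducible effective Cartier divisor in $X=\prod_{i=1}^n \mathbb{P}^{m_i}$ whose multidegree is a vector consisting only of $0$'s and $1$'s. Then $D$ is normal. -/
open MvPolynomial MeasureTheory Metric
open scoped LinearAlgebra.Projectivization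

theorem exists_pow_mul_eq_algebraMap_of_isIntegral {B R L : Type*} [CommRing B] [IsDomain B]
    [IsIntegrallyClosed B] [CommRing R] [IsDomain R] [Field L] [Algebra B R] [Algebra R L]
    [IsFractionRing R L] [FaithfulSMul B R] {g : B} (hg : g ≠ 0)
    (h : ∀ r : R, ∃ k b, algebraMap B R g ^ k * r = algebraMap B R b) {z : L}
    (hz : IsIntegral R z) :
    ∃ k r, algebraMap R L (algebraMap B R g) ^ k * z = algebraMap R L r := by
  let : Algebra B L := ((algebraMap R L).comp (algebraMap B R)).toAlgebra
  have : IsScalarTower B R L := .of_algebraMap_eq fun _ => rfl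
  have hBR : Function.Injective (algebraMap B R) := FaithfulSMul.algebraMap_injective B R
  have hRL : Function.Injective (algebraMap R L) := IsFractionRing.injective R L
  have hBL : Function.Injective (algebraMap B L) := hRL.comp hBR
  have : FaithfulSMul B L := (faithfulSMul_iff_algebraMap_injective B L).2 hBL
  have hgR : algebraMap B R g ≠ 0 := by simpa using hg
  have : IsFractionRing B L := by
    refine IsFractionRing.of_field B L fun x => ?_
    obtain ⟨r, t, ht, rfl⟩ := IsFractionRing.div_surjective (A := R) x
    obtain ⟨k, b, hb⟩ := h r
    obtain ⟨l, c, hc⟩ := h t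
    have ht0 : t ≠ 0 := nonZeroDivisors.ne_zero ht
    refine ⟨g ^ l * b, g ^ k * c, ?_⟩
    have hb' := congrArg (algebraMap R L) hb
    have hc' := congrArg (algebraMap R L) hc
    simp only [map_mul, map_pow, ← IsScalarTower.algebraMap_apply B R L] at hb' hc' ⊢
    rw [← hb', ← hc']
    have h1 : algebraMap R L t ≠ 0 := by simpa using ht0
    have h2 : algebraMap B L g ≠ 0 := by simpa using hg
    field_simp
  obtain ⟨p, hp, hpz⟩ := hz
  choose k b hb using h
  let K := ∑ i ∈ Finset.range (p.natDegree + 1), k (p.coeff i)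
  have hK : ∀ i ≤ p.natDegree, ∃ c, algebraMap B R g ^ K * p.coeff i = algebraMap B R c := by
    intro i hi
    have hle : k (p.coeff i) ≤ K :=
      Finset.single_le_sum (f := fun i => k (p.coeff i)) (fun _ _ => Nat.zero_le _)
        (Finset.mem_range.2 (Nat.lt_succ_of_le hi))
    refine ⟨g ^ (K - k (p.coeff i)) * b (p.coeff i), ?_⟩
    rw [map_mul, ← hb, map_pow, ← mul_assoc, ← pow_add, Nat.sub_add_cancel hle]
  have hlift : p.scaleRoots (algebraMap B R g ^ K) ∈ Polynomial.lifts (algebraMap B R) := by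
    rw [Polynomial.lifts_iff_coeff_lifts]
    intro i
    rw [Polynomial.coeff_scaleRoots]
    rcases lt_trichotomy i p.natDegree with hi | hi | hi
    · obtain ⟨c, hc⟩ := hK i hi.le
      refine ⟨c * (g ^ K) ^ (p.natDegree - i - 1), ?_⟩
      rw [map_mul, ← hc, map_pow, map_pow]
      obtain ⟨j, hj⟩ : ∃ j, p.natDegree - i = j + 1 := ⟨p.natDegree - i - 1, by omega⟩
      rw [hj, Nat.add_sub_cancel]
      ring
    · subst hi
      exact ⟨1, by simp [hp.coeff_natDegree]⟩
    · exact ⟨0, by simp [Polynomial.coeff_eq_zero_of_natDegree_lt hi]⟩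
  obtain ⟨q, hq, -, hqm⟩ :=
    Polynomial.lifts_and_degree_eq_and_monic hlift ((Polynomial.monic_scaleRoots_iff _).2 hp)
  have hint : IsIntegral B (algebraMap R L (algebraMap B R g ^ K) * z) := by
    refine ⟨q, hqm, ?_⟩
    have := Polynomial.scaleRoots_eval₂_eq_zero (s := algebraMap B R g ^ K) (algebraMap R L) hpz
    rwa [← hq, Polynomial.eval₂_map] at this
  obtain ⟨c, hc⟩ := IsIntegrallyClosed.isIntegral_iff.1 hint
  exact ⟨K, algebraMap B R c, by rw [← map_pow, ← hc]; rfl⟩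

theorem exists_algebraMap_eq_of_forall_prime {C R L : Type*} [CommRing C] [IsDomain C]
    [UniqueFactorizationMonoid C] [CommRing R] [IsDomain R] [Field L] [Algebra C R]
    [Module.Free C R] [Algebra.IsIntegral C R] [Algebra R L] [IsFractionRing R L] {z : L}
    (h : ∀ p : C, Prime p → ∃ s : C, ¬ p ∣ s ∧
      ∃ r, algebraMap R L (algebraMap C R s) * z = algebraMap R L r) :
    ∃ r, algebraMap R L r = z := by
  have hRL : Function.Injective (algebraMap R L) := IsFractionRing.injective R L
  have hCR : Function.Injective (algebraMap C R) := FaithfulSMul.algebraMap_injective C R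
  have descend : ∀ s : C, s ≠ 0 → ∀ y : L,
      (∀ p : C, Prime p → ∃ s : C, ¬ p ∣ s ∧
        ∃ r, algebraMap R L (algebraMap C R s) * y = algebraMap R L r) →
      (∃ r, algebraMap R L (algebraMap C R s) * y = algebraMap R L r) →
      ∃ r, algebraMap R L r = y := by
    intro s
    induction s using UniqueFactorizationMonoid.induction_on_prime with
    | h₁ => exact fun h => absurd rfl h
    | h₂ s hs =>
      rintro - y - ⟨r, hr⟩
      obtain ⟨t, ht⟩ := hs.exists_left_inv
      refine ⟨algebraMap C R t * r, ?_⟩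
      rw [map_mul, ← hr, ← mul_assoc, ← map_mul, ← map_mul, ht, map_one, map_one, one_mul]
    | h₃ s p hs hp ih =>
      rintro - y hy ⟨r, hr⟩
      obtain ⟨t, hpt, r', hr'⟩ := hy p hp
      have hcross : t • r = (p * s) • r' := by
        apply hRL
        rw [Algebra.smul_def, Algebra.smul_def, map_mul, map_mul, ← hr, ← hr']
        ring
      let b := Module.Free.chooseBasis C R
      have hdvd : ∀ i, p ∣ b.repr r i := fun i => by
        have := congrArg (fun x => b.repr x i) hcross
        simp only [map_smul, Finsupp.smul_apply, smul_eq_mul] at this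
        exact (hp.dvd_or_dvd ⟨s * b.repr r' i, by rw [this, mul_assoc]⟩).resolve_left hpt
      have hex : ∃ r₀, r = p • r₀ := by
        choose c hc using hdvd
        refine ⟨(b.repr r).sum fun i _ => c i • b i, ?_⟩
        rw [Finsupp.smul_sum]
        conv_lhs => rw [← b.linearCombination_repr r]
        refine Finsupp.sum_congr fun i _ => ?_
        rw [hc i]
        exact mul_smul p (c i) (b i)
      obtain ⟨r₀, rfl⟩ := hex
      refine ih hs y hy ⟨r₀, ?_⟩
      have hp0 : algebraMap R L (algebraMap C R p) ≠ 0 := by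
        simpa [map_eq_zero_iff _ hRL, map_eq_zero_iff _ hCR] using hp.ne_zero
      apply mul_left_cancel₀ hp0
      rw [← mul_assoc, ← map_mul, ← map_mul, hr, Algebra.smul_def, map_mul]
  obtain ⟨a, b, hb, hab⟩ := IsFractionRing.div_surjective (A := R) z
  have hb0 : b ≠ 0 := nonZeroDivisors.ne_zero hb
  obtain ⟨s, hs, hs0⟩ := Submodule.exists_mem_ne_zero_of_ne_bot
    (Ideal.comap_ne_bot_of_integral_mem hb0 (Ideal.mem_span_singleton_self b)
      (Algebra.IsIntegral.isIntegral (R := C) b))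
  rw [Ideal.mem_comap, Ideal.mem_span_singleton] at hs
  obtain ⟨t, ht⟩ := hs
  refine descend s hs0 z h ⟨t * a, ?_⟩
  have hb1 : algebraMap R L b ≠ 0 := by simpa using hb0
  rw [ht, ← hab, map_mul, map_mul]
  field_simp

theorem Polynomial.natDegree_prod_le_and_coeff_prod {R ι : Type*} [CommSemiring R]
    (s : Finset ι) (F : ι → Polynomial R) (e : ι → ℕ) (h : ∀ i ∈ s, (F i).natDegree ≤ e i) :
    (∏ i ∈ s, F i).natDegree ≤ ∑ i ∈ s, e i ∧
      (∏ i ∈ s, F i).coeff (∑ i ∈ s, e i) = ∏ i ∈ s, (F i).coeff (e i) := by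
  classical
  induction s using Finset.induction_on with
  | empty => simp
  | insert i s hi ih =>
    obtain ⟨ih₁, ih₂⟩ := ih fun j hj => h j (Finset.mem_insert_of_mem hj)
    have hi' := h i (Finset.mem_insert_self i s)
    rw [Finset.prod_insert hi, Finset.sum_insert hi, Finset.prod_insert hi]
    exact ⟨natDegree_mul_le_of_le hi' ih₁, by rw [coeff_mul_add_eq_of_natDegree_le hi' ih₁, ih₂]⟩

namespace MvPolynomial

/-- The linear change of coordinates `X 0 ↦ l 0 * X 0`, `X i ↦ X i + l i * X 0`. -/
noncomputable def shear {k : Type*} [Field k] {n : ℕ} (l : Fin (n + 1) → k) (hl : l 0 ≠ 0) :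
    MvPolynomial (Fin (n + 1)) k ≃ₐ[k] MvPolynomial (Fin (n + 1)) k :=
  have hCl : C (l 0) * C (l 0)⁻¹ = (1 : MvPolynomial (Fin (n + 1)) k) := by
    rw [← C_mul, mul_inv_cancel₀ hl, C_1]
  have hCl' : C (l 0)⁻¹ * C (l 0) = (1 : MvPolynomial (Fin (n + 1)) k) := by
    rw [← C_mul, inv_mul_cancel₀ hl, C_1]
  AlgEquiv.ofAlgHom
    (aeval (Fin.cons (C (l 0) * X 0) fun i => X i.succ + C (l i.succ) * X 0))
    (aeval (Fin.cons (C (l 0)⁻¹ * X 0) fun i => X i.succ - C (l i.succ * (l 0)⁻¹) * X 0))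
    (by
      ext i : 1
      cases i using Fin.cases with
      | zero => simp [← mul_assoc, hCl']
      | succ i => simp [← mul_assoc, mul_assoc (C _) (C _) (C _), hCl'])
    (by
      ext i : 1
      cases i using Fin.cases with
      | zero => simp [← mul_assoc, hCl]
      | succ i => simp [← mul_assoc])

theorem exists_algEquiv_isUnit_leadingCoeff {k : Type*} [Field k] [Infinite k] {n : ℕ}
    {f : MvPolynomial (Fin (n + 1)) k} (hf : f ≠ 0) :
    ∃ e : MvPolynomial (Fin (n + 1)) k ≃ₐ[k] Polynomial (MvPolynomial (Fin n) k),
      IsUnit (e f).leadingCoeff := by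
  set d := f.totalDegree with hd
  have hcomp : homogeneousComponent d f ≠ 0 := by
    obtain ⟨p, hp, hpd⟩ := Finset.exists_mem_eq_sup f.support (support_nonempty.2 hf)
      fun p => p.sum fun _ => id
    have hpd' : p.degree = d := hpd.symm
    intro h
    have := congrArg (coeff p) h
    rw [coeff_homogeneousComponent, if_pos hpd', coeff_zero] at this
    exact mem_support_iff.1 hp this
  obtain ⟨l, hl⟩ : ∃ l, eval l (homogeneousComponent d f * X 0) ≠ 0 := by
    by_contra! h
    exact mul_ne_zero hcomp (X_ne_zero 0) (funext fun l => by rw [h l, map_zero])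
  rw [map_mul, eval_X] at hl
  have hl0 : l 0 ≠ 0 := right_ne_zero_of_mul hl
  let e := (shear l hl0).trans (finSuccEquiv k n)
  have heX : ∀ i, (e (X i)).natDegree ≤ 1 ∧ (e (X i)).coeff 1 = C (l i) := by
    intro i
    cases i using Fin.cases with
    | zero =>
      have : e (X 0) = Polynomial.C (C (l 0)) * Polynomial.X := by
        simp [e, shear, finSuccEquiv_apply]
      rw [this]
      exact ⟨(Polynomial.natDegree_C_mul_le _ _).trans Polynomial.natDegree_X_le, by simp⟩
    | succ i =>
      have : e (X i.succ) = Polynomial.C (C (l i.succ)) * Polynomial.X + Polynomial.C (X i) := by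
        simp [e, shear, finSuccEquiv_apply, add_comm]
      rw [this]
      exact ⟨Polynomial.natDegree_linear_le, by simp [Polynomial.coeff_C]⟩
  have hmon : ∀ p : Fin (n + 1) →₀ ℕ, ∀ c,
      (e (monomial p c)).natDegree ≤ p.degree ∧
      (e (monomial p c)).coeff p.degree = C (c * ∏ i, l i ^ p i) := by
    intro p c
    have hdeg : p.degree = ∑ i, p i := Finsupp.degree_eq_sum p
    have hprod := Polynomial.natDegree_prod_le_and_coeff_prod Finset.univ
      (fun i => e (X i) ^ p i) p fun i _ => by
        simpa using Polynomial.natDegree_pow_le_of_le (p i) (heX i).1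
    have hC : e (C c) = Polynomial.C (C c) := e.commutes c
    rw [monomial_eq, Finsupp.prod_fintype _ _ fun _ => pow_zero _, map_mul, map_prod, hC, hdeg]
    simp only [map_pow]
    refine ⟨(Polynomial.natDegree_C_mul_le _ _).trans hprod.1, ?_⟩
    rw [Polynomial.coeff_C_mul, hprod.2, map_mul, map_prod]
    congr 1
    refine Finset.prod_congr rfl fun i _ => ?_
    have := Polynomial.coeff_pow_of_natDegree_le (m := p i) (heX i).1
    rw [mul_one] at this
    rw [this, (heX i).2, map_pow]
  have hle : ∀ p ∈ f.support, p.degree ≤ d := fun p hp => le_totalDegree hp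
  have hsum : e f = ∑ p ∈ f.support, e (monomial p (coeff p f)) := by
    conv_lhs => rw [f.as_sum, map_sum]
  have hnat : (e f).natDegree ≤ d := by
    rw [hsum]
    exact Polynomial.natDegree_sum_le_of_forall_le _ _ fun p hp => (hmon p _).1.trans (hle p hp)
  have hcoeff : (e f).coeff d = C (eval l (homogeneousComponent d f)) := by
    rw [hsum, Polynomial.finsetSum_coeff, homogeneousComponent_apply, map_sum, map_sum,
      Finset.sum_filter]
    refine Finset.sum_congr rfl fun p hp => ?_
    split_ifs with h
    · rw [← h, (hmon p _).2, eval_monomial, Finsupp.prod_fintype _ _ fun _ => pow_zero _]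
    · exact Polynomial.coeff_eq_zero_of_natDegree_lt
        ((hmon p _).1.trans_lt (lt_of_le_of_ne (hle p hp) h))
  have hne : eval l (homogeneousComponent d f) ≠ 0 := left_ne_zero_of_mul hl
  refine ⟨e, ?_⟩
  have hd' : (e f).natDegree = d := Polynomial.natDegree_eq_of_le_of_coeff_ne_zero hnat
    (by rw [hcoeff]; simpa using hne)
  rw [Polynomial.leadingCoeff, hd', hcoeff]
  exact (isUnit_iff_ne_zero.2 hne).map C

theorem exists_algebra_free_finite {σ k R : Type*} [Fintype σ] [Field k] [Infinite k]
    [CommRing R] [Algebra k R] {n : ℕ} (hn : Fintype.card σ = n + 1) {f : MvPolynomial σ k}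
    (hf : f ≠ 0) (π : MvPolynomial σ k →ₐ[k] R) (hπ : Function.Surjective π)
    (hker : ∀ p, π p = 0 ↔ f ∣ p) :
    ∃ _ : Algebra (MvPolynomial (Fin n) k) R, IsScalarTower k (MvPolynomial (Fin n) k) R ∧
      Module.Free (MvPolynomial (Fin n) k) R ∧ Module.Finite (MvPolynomial (Fin n) k) R := by
  let ρ := renameEquiv k (Fintype.equivFinOfCardEq hn)
  obtain ⟨e', he'⟩ := exists_algEquiv_isUnit_leadingCoeff
    (f := ρ f) ((map_ne_zero_iff ρ ρ.injective).2 hf)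
  let e := ρ.trans e'
  have hu : IsUnit (e f).leadingCoeff := he'
  let Q := hu.unit⁻¹ • e f
  have hQ : Q.Monic := Polynomial.monic_of_isUnit_leadingCoeff_inv_smul hu
  have hassoc : Associated Q (e f) := by
    refine ⟨Units.map (Polynomial.C : _ →+* Polynomial (MvPolynomial (Fin n) k)) hu.unit, ?_⟩
    rw [mul_comm]
    simp only [Q, Units.smul_def, Polynomial.smul_eq_C_mul, Units.coe_map, ← mul_assoc]
    simp [← Polynomial.C_mul]
  let φ : Polynomial (MvPolynomial (Fin n) k) →ₐ[k] R := π.comp e.symm.toAlgHom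
  have hφ : Function.Surjective φ := hπ.comp e.symm.surjective
  have hφker : Ideal.span {Q} = RingHom.ker φ := by
    ext x
    have : φ x = π (e.symm x) := rfl
    rw [Ideal.mem_span_singleton, RingHom.mem_ker, this, hker,
      hassoc.dvd_iff_dvd_left]
    conv_rhs => rw [← map_dvd_iff e, AlgEquiv.apply_symm_apply]
  let E : AdjoinRoot Q ≃ₐ[k] R := (Ideal.quotientEquivAlgOfEq k hφker).trans
    (Ideal.quotientKerAlgEquivOfSurjective hφ)
  let : Algebra (MvPolynomial (Fin n) k) R := (E.toRingHom.comp (AdjoinRoot.of Q)).toAlgebra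
  refine ⟨this, .of_algebraMap_eq fun c => (E.commutes c).symm, ?_⟩
  let E' : AdjoinRoot Q ≃ₗ[MvPolynomial (Fin n) k] R :=
    { E.toAddEquiv with
      map_smul' := fun c x => by
        rw [Algebra.smul_def, Algebra.smul_def]
        exact map_mul E _ _ }
  have := hQ.free_adjoinRoot
  have := hQ.finite_adjoinRoot
  exact ⟨Module.Free.of_equiv E', Module.Finite.equiv E'⟩

theorem exists_ne_and_eq_zero_of_aeval_eq_zero {σ k T ι : Type*} [Fintype σ] [Field k] [CommRing T]
    [IsDomain T] [Algebra k T] {x : σ → T} (hx : Algebra.adjoin k (Set.range x) = ⊤)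
    [Fintype ι] {y : ι → T} (hy : AlgebraicIndependent k y)
    (hcard : Fintype.card σ ≤ Fintype.card ι + 2) (htwo : 2 ≤ Fintype.card σ) :
    ∃ u v : σ, u ≠ v ∧ ∀ s : MvPolynomial σ k, s.degreeOf u = 0 → s.degreeOf v = 0 →
      aeval x s = 0 → s = 0 := by
  classical
  have : Algebra.IsAlgebraic (Algebra.adjoin k (Set.range x)) T := by
    rw [hx]
    exact ⟨fun t => isAlgebraic_algebraMap (⟨t, trivial⟩ : (⊤ : Subalgebra k T))⟩
  obtain ⟨t, htx, ht⟩ := exists_isTranscendenceBasis_subset (R := k) (Set.range x)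
  have hfin : Finite t := (Set.finite_range x).subset htx
  have := Fintype.ofFinite t
  have hle : Fintype.card ι ≤ Fintype.card t := by
    have h₁ := hy.lift_cardinalMk_le_trdeg
    rw [← ht.cardinalMk_eq_trdeg] at h₁
    simpa using h₁
  choose j hj using fun a : t => htx a.2
  have hjinj : Function.Injective j := fun a b hab => Subtype.ext (by rw [← hj a, ← hj b, hab])
  obtain ⟨U, hU, hU2⟩ := Finset.exists_superset_card_eq
    (s := (Finset.univ.image j)ᶜ) (n := 2) (by
      rw [Finset.card_compl, Finset.card_image_of_injective _ hjinj, Finset.card_univ]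
      omega) htwo
  obtain ⟨u, v, huv, rfl⟩ := Finset.card_eq_two.1 hU2
  refine ⟨u, v, huv, fun s hsu hsv hs => ?_⟩
  obtain ⟨q, rfl⟩ := exists_rename_eq_of_vars_subset_range s j hjinj (by
    intro w hw
    by_contra hwj
    have : w ∈ ({u, v} : Finset σ) := hU (by simpa using hwj)
    rw [Finset.mem_coe, mem_vars_iff_degreeOf_ne_zero] at hw
    simp only [Finset.mem_insert, Finset.mem_singleton] at this
    rcases this with rfl | rfl
    · exact hw hsu
    · exact hw hsv)
  rw [aeval_rename, show x ∘ j = ((↑) : t → T) from _root_.funext hj] at hs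
  rw [ht.1.eq_zero_of_aeval_eq_zero _ hs, map_zero]

variable {σ k : Type*} [Field k]

theorem mem_supported_iff_degreeOf {s : Set σ} {p : MvPolynomial σ k} :
    p ∈ supported k s ↔ ∀ w ∉ s, p.degreeOf w = 0 := by
  simp only [mem_supported, Set.subset_def, Finset.mem_coe, mem_vars_iff_degreeOf_ne_zero]
  exact forall_congr' fun w => not_imp_comm

theorem exists_eq_add_X_mul {u : σ} {f : MvPolynomial σ k} (hf : f.degreeOf u ≤ 1) :
    ∃ g₀ g₁ : MvPolynomial σ k, f = g₀ + X u * g₁ ∧ g₀.degreeOf u = 0 ∧ g₁.degreeOf u = 0 ∧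
      ∀ w, g₀.degreeOf w ≤ f.degreeOf w ∧ g₁.degreeOf w ≤ f.degreeOf w := by
  classical
  have h₁ : ∀ p, coeff p (f.divMonomial (Finsupp.single u 1)) ≠ 0 →
      p + Finsupp.single u 1 ∈ f.support := fun p hp => by
    rwa [coeff_divMonomial, add_comm, ← mem_support_iff] at hp
  have h₀ : ∀ p, coeff p (f.modMonomial (Finsupp.single u 1)) ≠ 0 →
      p ∈ f.support ∧ p u = 0 := fun p hp => by
    by_cases hle : Finsupp.single u 1 ≤ p
    · exact absurd (coeff_modMonomial_of_le _ hle) hp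
    · rw [coeff_modMonomial_of_not_le _ hle, ← mem_support_iff] at hp
      exact ⟨hp, by simpa [Finsupp.single_le_iff] using hle⟩
  refine ⟨f.modMonomial (Finsupp.single u 1), f.divMonomial (Finsupp.single u 1), ?_, ?_, ?_, ?_⟩
  · rw [add_comm, divMonomial_add_modMonomial_single]
  · rw [← Nat.le_zero, degreeOf_le_iff]
    exact fun p hp => (h₀ p (mem_support_iff.1 hp)).2.le
  · rw [← Nat.le_zero, degreeOf_le_iff]
    intro p hp
    have := (monomial_le_degreeOf u (h₁ p (mem_support_iff.1 hp))).trans hf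
    simpa using this
  · refine fun w => ⟨degreeOf_le_iff.2 fun p hp => ?_, degreeOf_le_iff.2 fun p hp => ?_⟩
    · exact monomial_le_degreeOf w (h₀ p (mem_support_iff.1 hp)).1
    · refine le_trans ?_ (monomial_le_degreeOf w (h₁ p (mem_support_iff.1 hp)))
      simp

theorem degreeOf_add_X_mul_ne_zero {u : σ} {g₀ g₁ : MvPolynomial σ k} (h₀ : g₀.degreeOf u = 0)
    (h₁ : g₁ ≠ 0) : (g₀ + X u * g₁).degreeOf u ≠ 0 := by
  have h : (X u * g₁).degreeOf u ≠ 0 := by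
    rw [degreeOf_mul_eq (X_ne_zero u) h₁, degreeOf_X_self]
    omega
  rw [add_comm, degreeOf_add_eq_of_degreeOf_lt (by omega)]
  exact h

theorem degreeOf_le_of_dvd {u : σ} {p q : MvPolynomial σ k} (h : p ∣ q) (hq : q ≠ 0) :
    p.degreeOf u ≤ q.degreeOf u := by
  obtain ⟨r, rfl⟩ := h
  rw [degreeOf_mul_eq (left_ne_zero_of_mul hq) (right_ne_zero_of_mul hq)]
  omega

theorem exists_pow_mul_eq_of_isIntegral {R L : Type*} [CommRing R] [IsDomain R] [Algebra k R]
    [Field L] [Algebra R L] [IsFractionRing R L] {π : MvPolynomial σ k →ₐ[k] R}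
    (hπ : Function.Surjective π) {u : σ} {g₀ g₁ : MvPolynomial σ k}
    (hker : ∀ p, π p = 0 ↔ g₀ + X u * g₁ ∣ p)
    (h₀ : g₀.degreeOf u = 0) (h₁ : g₁.degreeOf u = 0) (h₁0 : g₁ ≠ 0) {z : L}
    (hz : IsIntegral R z) :
    ∃ (n : ℕ) (r : R), algebraMap R L (π g₁) ^ n * z = algebraMap R L r := by
  let B := supported k ({u}ᶜ : Set σ)
  have hB : ∀ b : MvPolynomial σ k, b ∈ B ↔ b.degreeOf u = 0 := fun b => by
    simp [B, mem_supported_iff_degreeOf]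
  have : IsIntegrallyClosed B :=
    IsIntegrallyClosed.of_equiv (supportedEquivMvPolynomial ({u}ᶜ : Set σ)).symm.toRingEquiv
  let : Algebra B R := (π.comp B.val).toRingHom.toAlgebra
  have hmk : ∀ b : B, algebraMap B R b = π b := fun _ => rfl
  have : FaithfulSMul B R := by
    rw [faithfulSMul_iff_algebraMap_injective, injective_iff_map_eq_zero]
    intro b hb
    rw [hmk, hker] at hb
    by_contra hne
    have := degreeOf_le_of_dvd (u := u) hb (by simpa using hne)
    rw [(hB b).1 b.2] at this
    exact degreeOf_add_X_mul_ne_zero h₀ h₁0 (Nat.le_zero.1 this)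
  refine exists_pow_mul_eq_algebraMap_of_isIntegral (B := B) (g := ⟨g₁, (hB _).2 h₁⟩)
    (by simpa [Subtype.ext_iff] using h₁0) ?_ hz
  intro r
  obtain ⟨r, rfl⟩ := hπ r
  simp only [hmk]
  induction r using MvPolynomial.induction_on with
  | C a => exact ⟨0, ⟨C a, (hB _).2 (degreeOf_C _ _)⟩, by simp⟩
  | add p q hp hq =>
    obtain ⟨m, b, hb⟩ := hp
    obtain ⟨n, c, hc⟩ := hq
    let G : B := ⟨g₁, (hB _).2 h₁⟩
    refine ⟨m + n, G ^ n * b + G ^ m * c, ?_⟩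
    simp only [B.coe_add, B.coe_mul, B.coe_pow, map_add, map_mul, map_pow, ← hb, ← hc, G]
    ring
  | mul_X p w hp =>
    obtain ⟨m, b, hb⟩ := hp
    by_cases hw : w = u
    · subst hw
      refine ⟨m + 1, -b * ⟨g₀, (hB _).2 h₀⟩, ?_⟩
      have : π (g₀ + X w * g₁) = 0 := (hker _).2 dvd_rfl
      rw [map_add, map_mul] at this
      simp only [B.coe_neg, B.coe_mul, map_mul, map_neg, ← hb]
      linear_combination π g₁ ^ m * π p * this
    · refine ⟨m, b * ⟨X w, (hB _).2 (degreeOf_X_of_ne (Ne.symm hw))⟩, ?_⟩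
      simp only [B.coe_mul, map_mul, ← hb]
      ring

theorem exists_degreeOf_eq_zero_mul_eq {R L : Type*} [CommRing R] [IsDomain R] [Algebra k R]
    [Field L] [Algebra R L] [IsFractionRing R L] {π : MvPolynomial σ k →ₐ[k] R}
    (hπ : Function.Surjective π) {f : MvPolynomial σ k} (hker : ∀ p, π p = 0 ↔ f ∣ p)
    (hf : Prime f) (hdeg : ∀ w, f.degreeOf w ≤ 1) {z : L} (hz : IsIntegral R z) {u v : σ}
    (huv : u ≠ v) :
    ∃ s : MvPolynomial σ k, s ≠ 0 ∧ s.degreeOf u = 0 ∧ s.degreeOf v = 0 ∧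
      ∃ r : R, algebraMap R L (π s) * z = algebraMap R L r := by
  classical
  obtain ⟨g₀, g₁, hfg, hg₀, hg₁, hg⟩ := exists_eq_add_X_mul (hdeg u)
  obtain ⟨a, c, hac, ha, hc, hac'⟩ := exists_eq_add_X_mul ((hg v).1.trans (hdeg v))
  obtain ⟨b, d, hbd, hb, hd, hbd'⟩ := exists_eq_add_X_mul ((hg v).2.trans (hdeg v))
  have hau : a.degreeOf u = 0 := Nat.le_zero.1 (hg₀ ▸ (hac' u).1)
  have hcu : c.degreeOf u = 0 := Nat.le_zero.1 (hg₀ ▸ (hac' u).2)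
  have hbu : b.degreeOf u = 0 := Nat.le_zero.1 (hg₁ ▸ (hbd' u).1)
  have hdu : d.degreeOf u = 0 := Nat.le_zero.1 (hg₁ ▸ (hbd' u).2)
  have hfh : f = (a + X u * b) + X v * (c + X u * d) := by rw [hfg, hac, hbd]; ring
  have hsupp : ∀ p : MvPolynomial σ k,
      p ∈ supported k ({u, v}ᶜ : Set σ) ↔ p.degreeOf u = 0 ∧ p.degreeOf v = 0 := fun p => by
    rw [mem_supported_iff_degreeOf]
    simp only [Set.mem_compl_iff, not_not, Set.mem_insert_iff, Set.mem_singleton_iff,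
      forall_eq_or_imp, forall_eq]
  have hsupp' : ∀ (w : σ) (p : MvPolynomial σ k),
      p ∈ supported k ({w}ᶜ : Set σ) ↔ p.degreeOf w = 0 := fun w p => by
    simp [mem_supported_iff_degreeOf]
  have hh₀ : (a + X u * b).degreeOf v = 0 := by
    rw [← hsupp'] at ha hb ⊢
    exact add_mem ha (mul_mem (X_mem_supported.2 huv) hb)
  have hh₁ : (c + X u * d).degreeOf v = 0 := by
    rw [← hsupp'] at hc hd ⊢
    exact add_mem hc (mul_mem (X_mem_supported.2 huv) hd)
  suffices ∃ s ∈ supported k ({u, v}ᶜ : Set σ), s ≠ 0 ∧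
      ∃ r : R, algebraMap R L (π s) * z = algebraMap R L r by
    obtain ⟨s, hs, hs0, hr⟩ := this
    exact ⟨s, hs0, ((hsupp s).1 hs).1, ((hsupp s).1 hs).2, hr⟩
  have ha' := (hsupp a).2 ⟨hau, ha⟩
  have hb' := (hsupp b).2 ⟨hbu, hb⟩
  have hc' := (hsupp c).2 ⟨hcu, hc⟩
  have hd' := (hsupp d).2 ⟨hdu, hd⟩
  have key : ∀ (w : σ) (p₀ p₁ : MvPolynomial σ k), f = p₀ + X w * p₁ → p₀.degreeOf w = 0 →
      p₁.degreeOf w = 0 → p₁ ≠ 0 →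
      ∃ (n : ℕ) (r : R), algebraMap R L (π p₁) ^ n * z = algebraMap R L r := by
    rintro w p₀ p₁ rfl h₀ h₁ h₁0
    exact exists_pow_mul_eq_of_isIntegral hπ hker h₀ h₁ h₁0 hz
  by_cases hd0 : d = 0
  · by_cases hb0 : b = 0
    · by_cases hc0 : c = 0
      · refine ⟨f, by simpa [hfh, hb0, hc0, hd0] using ha', hf.ne_zero, 0, ?_⟩
        simp [(hker f).2 dvd_rfl]
      · obtain ⟨n, r, hr⟩ := key v _ _ hfh hh₀ hh₁ (by simpa [hd0] using hc0)
        exact ⟨c ^ n, pow_mem hc' n, pow_ne_zero n hc0, r, by simpa [hd0] using hr⟩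
    · obtain ⟨n, r, hr⟩ := key u _ _ hfg hg₀ hg₁ (by simpa [hbd, hd0] using hb0)
      exact ⟨b ^ n, pow_mem hb' n, pow_ne_zero n hb0, r, by simpa [hbd, hd0] using hr⟩
  · have hg₁0 : g₁ ≠ 0 := fun h =>
      degreeOf_add_X_mul_ne_zero hb hd0 (by rw [← hbd, h, degreeOf_zero])
    have hh₁0 : c + X u * d ≠ 0 := fun h =>
      degreeOf_add_X_mul_ne_zero hcu hd0 (by rw [h, degreeOf_zero])
    have hmul : g₁ * (c + X u * d) = f * d + (b * c - a * d) := by rw [hfh, hbd]; ring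
    have he0 : b * c - a * d ≠ 0 := by
      intro he
      rcases hf.dvd_or_dvd (⟨d, by rw [hmul, he, add_zero]⟩ : f ∣ g₁ * (c + X u * d)) with h | h
      · refine degreeOf_add_X_mul_ne_zero hg₀ hg₁0 (Nat.le_zero.1 ?_)
        rw [← hfg, ← hg₁]
        exact degreeOf_le_of_dvd h hg₁0
      · refine degreeOf_add_X_mul_ne_zero hh₀ hh₁0 (Nat.le_zero.1 ?_)
        rw [← hfh, ← hh₁]
        exact degreeOf_le_of_dvd h hh₁0
    obtain ⟨n, r, hr⟩ := key u _ _ hfg hg₀ hg₁ hg₁0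
    refine ⟨(b * c - a * d) ^ n, pow_mem (sub_mem (mul_mem hb' hc') (mul_mem ha' hd')) n,
      pow_ne_zero n he0, π (c + X u * d) ^ n * r, ?_⟩
    have hmk : π (b * c - a * d) = π (c + X u * d) * π g₁ := by
      rw [← map_mul, mul_comm (c + _), hmul, map_add, map_mul, (hker f).2 dvd_rfl, zero_mul,
        zero_add]
    rw [map_pow, hmk, map_mul, ← hr, mul_pow, map_mul, map_pow, map_pow, mul_assoc]

/-- Let `R` be the quotient of a polynomial ring by a prime element `f` of degree at most one in
each variable. Then `R` is integrally closed. -/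
theorem isIntegrallyClosed_of_degreeOf_le_one [Fintype σ] [Infinite k] {R : Type*} [CommRing R]
    [IsDomain R] [Algebra k R] {π : MvPolynomial σ k →ₐ[k] R} (hπ : Function.Surjective π)
    {f : MvPolynomial σ k} (hker : ∀ p, π p = 0 ↔ f ∣ p) (hf : Prime f)
    (hdeg : ∀ w, f.degreeOf w ≤ 1) (htwo : 2 ≤ Fintype.card σ) : IsIntegrallyClosed R := by
  classical
  refine (isIntegrallyClosed_iff (FractionRing R)).2 fun {z} hz => ?_
  obtain ⟨n, hn⟩ : ∃ n, Fintype.card σ = n + 1 := ⟨Fintype.card σ - 1, by omega⟩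
  obtain ⟨_, _, _, _⟩ := exists_algebra_free_finite hn hf.ne_zero π hπ hker
  let I : Ideal R :=
    { carrier := {r | ∃ t, algebraMap R (FractionRing R) r * z = algebraMap R (FractionRing R) t}
      add_mem' := by
        rintro a b ⟨s, hs⟩ ⟨t, ht⟩
        exact ⟨s + t, by rw [map_add, map_add, add_mul, hs, ht]⟩
      zero_mem' := ⟨0, by simp⟩
      smul_mem' := by
        rintro c a ⟨s, hs⟩
        exact ⟨c * s, by rw [smul_eq_mul, map_mul, map_mul, mul_assoc, hs]⟩ }
  refine exists_algebraMap_eq_of_forall_prime (C := MvPolynomial (Fin n) k) fun p hp => ?_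
  by_contra! hall
  have hIp : I.comap (algebraMap (MvPolynomial (Fin n) k) R) ≤ Ideal.span {p} := by
    rintro s ⟨t, ht⟩
    rw [Ideal.mem_span_singleton]
    by_contra hps
    exact hall s hps t ht
  have : (Ideal.span {p}).IsPrime := (Ideal.span_singleton_prime hp.ne_zero).2 hp
  obtain ⟨Q, hIQ, _, hQ⟩ := Ideal.exists_ideal_over_prime_of_isIntegral (Ideal.span {p}) I hIp
  obtain ⟨w, hw⟩ : ∃ w, p.degreeOf w ≠ 0 := by
    by_contra! h
    have : p ∈ supported k (∅ : Set (Fin n)) := mem_supported_iff_degreeOf.2 fun w _ => h w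
    rw [supported_empty, Algebra.mem_bot] at this
    obtain ⟨c, rfl⟩ := this
    exact hp.not_isUnit ((isUnit_iff_ne_zero.2 fun hc => hp.ne_zero (by rw [hc, map_zero])).map _)
  let ψ : MvPolynomial (Fin n) k →ₐ[k] R ⧸ Q :=
    (Ideal.Quotient.mkₐ k Q).comp (IsScalarTower.toAlgHom k (MvPolynomial (Fin n) k) R)
  have hψ : ∀ q, ψ q = 0 → p ∣ q := fun q hq => by
    rw [← Ideal.mem_span_singleton, ← hQ, Ideal.mem_comap]
    exact Ideal.Quotient.eq_zero_iff_mem.1 hq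
  have hy : AlgebraicIndependent k fun j : {j // j ≠ w} => ψ (X j) := by
    rw [algebraicIndependent_iff]
    intro q hq
    have hq' : ψ (rename Subtype.val q) = 0 := by
      rw [← hq]
      exact DFunLike.congr_fun (aeval_unique (ψ.comp (rename Subtype.val))) q |>.trans
        (by simp [Function.comp_def])
    by_contra hq0
    have hren : rename Subtype.val q ≠ 0 :=
      (map_ne_zero_iff _ (rename_injective _ Subtype.val_injective)).2 hq0
    refine hw (Nat.le_zero.1 ((degreeOf_le_of_dvd (hψ _ hq') hren).trans_eq ?_))
    have hmem : rename Subtype.val q ∈ supported k ({w}ᶜ : Set (Fin n)) := by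
      rw [supported_eq_range_rename]
      exact ⟨q, rfl⟩
    exact mem_supported_iff_degreeOf.1 hmem w (by simp)
  let θ : MvPolynomial σ k →ₐ[k] R ⧸ Q := (Ideal.Quotient.mkₐ k Q).comp π
  have hθ : Function.Surjective θ := (Ideal.Quotient.mkₐ_surjective k Q).comp hπ
  have hx : Algebra.adjoin k (Set.range fun i => θ (X i)) = ⊤ := by
    have h := Algebra.adjoin_range_eq_range_aeval k fun i => θ (X i)
    rwa [show aeval (fun i => θ (X i)) = θ from (aeval_unique θ).symm,
      (AlgHom.range_eq_top θ).2 hθ] at h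
  obtain ⟨u, v, huv, h⟩ := exists_ne_and_eq_zero_of_aeval_eq_zero hx hy
    (by simp; omega) htwo
  obtain ⟨s, hs0, hsu, hsv, t, ht⟩ := exists_degreeOf_eq_zero_mul_eq hπ hker hf hdeg hz huv
  refine hs0 (h s hsu hsv ?_)
  rw [show aeval (fun i => θ (X i)) = θ from (aeval_unique θ).symm]
  exact Ideal.Quotient.eq_zero_iff_mem.2 (hIQ ⟨t, ht⟩)
end MvPolynomial

namespace MultiProj

variable {n : ℕ} {m : Fin n → ℕ} (c : ∀ i : Fin n, Fin (m i + 1))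

/-- The monomial substitution `X v ↦ X ⟨v.1, c v.1⟩ * X v` on the coordinates of the chart `c`,
fixing the coordinates `X ⟨i, c i⟩`. -/
noncomputable def homogenize : MvPolynomial (Idx m) ℂ →ₐ[ℂ] MvPolynomial (Idx m) ℂ :=
  aeval fun v => X ⟨v.1, c v.1⟩ * if v.2 = c v.1 then 1 else X v

theorem homogenize_X (v : Idx m) :
    homogenize c (X v) = X ⟨v.1, c v.1⟩ * if v.2 = c v.1 then 1 else X v :=
  aeval_X _ _

@[simp]
theorem homogenize_X_chart (i : Fin n) : homogenize c (X ⟨i, c i⟩) = X ⟨i, c i⟩ := by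
  simp [homogenize_X]

theorem homogenize_injective : Function.Injective (homogenize c) := by
  let K := FractionRing (MvPolynomial (Idx m) ℂ)
  let θ : MvPolynomial (Idx m) ℂ →ₐ[ℂ] K := aeval fun v =>
    algebraMap (MvPolynomial (Idx m) ℂ) K (X v) /
      if v.2 = c v.1 then 1 else algebraMap (MvPolynomial (Idx m) ℂ) K (X ⟨v.1, c v.1⟩)
  have hθ : θ.comp (homogenize c) = IsScalarTower.toAlgHom ℂ (MvPolynomial (Idx m) ℂ) K := by
    ext v
    have hv : algebraMap _ K (X ⟨v.1, c v.1⟩ : MvPolynomial (Idx m) ℂ) ≠ 0 := by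
      simp [X_ne_zero]
    by_cases h : v.2 = c v.1
    · have hv' : v = ⟨v.1, c v.1⟩ := Sigma.ext rfl (heq_of_eq h)
      rw [hv']
      simp [θ]
    · simp only [AlgHom.comp_apply, homogenize_X, if_neg h, map_mul]
      simp only [θ, aeval_X, if_neg h, if_true, div_one, IsScalarTower.coe_toAlgHom']
      exact (mul_div_assoc _ _ _).symm.trans (mul_div_cancel_left₀ _ hv)
  refine Function.Injective.of_comp (f := θ) ?_
  rw [← AlgHom.coe_comp, hθ]
  exact IsFractionRing.injective (MvPolynomial (Idx m) ℂ) K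

theorem chart_monomial (p : Idx m →₀ ℕ) (r : ℂ) :
    chart m (monomial p r) c = C r * ∏ v, (if v.2 = c v.1 then 1 else X v) ^ p v := by
  rw [chart, aeval_monomial, Finsupp.prod_fintype _ _ fun _ => pow_zero _, algebraMap_eq]

theorem homogenize_eq {F : MvPolynomial (Idx m) ℂ} {a : Fin n → ℕ} (hdeg : IsMultiHomog m F a) :
    homogenize c F = (∏ i, X ⟨i, c i⟩ ^ a i) * chart m F c := by
  have hmon : ∀ p ∈ F.support, homogenize c (monomial p (coeff p F)) =
      (∏ i, X ⟨i, c i⟩ ^ a i) * chart m (monomial p (coeff p F)) c := fun p hp => by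
    have hprod : ∏ v : Idx m, (X ⟨v.1, c v.1⟩ : MvPolynomial (Idx m) ℂ) ^ p v =
        ∏ i, X ⟨i, c i⟩ ^ a i := by
      rw [Fintype.prod_sigma]
      refine Finset.prod_congr rfl fun i _ => ?_
      rw [← hdeg p hp i, ← Finset.prod_pow_eq_pow_sum]
    rw [chart_monomial, homogenize, aeval_monomial, Finsupp.prod_fintype _ _ fun _ => pow_zero _,
      algebraMap_eq, ← hprod]
    simp only [mul_pow, Finset.prod_mul_distrib]
    ring
  conv_lhs => rw [F.as_sum, map_sum]
  conv_rhs => rw [F.as_sum]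
  rw [chart, map_sum, Finset.mul_sum]
  exact Finset.sum_congr rfl hmon

theorem exists_homogenize_eq_pow_mul (g : MvPolynomial (Idx m) ℂ) :
    ∃ (k : ℕ) (G : MvPolynomial (Idx m) ℂ), homogenize c G = (∏ i, X ⟨i, c i⟩) ^ k * g := by
  classical
  have hx : homogenize c (∏ i, X ⟨i, c i⟩) = ∏ i, X ⟨i, c i⟩ := by simp [map_prod]
  induction g using MvPolynomial.induction_on with
  | C r => exact ⟨0, C r, by simp [homogenize]⟩
  | add g h hg hh =>
    obtain ⟨k, G, hG⟩ := hg
    obtain ⟨l, H, hH⟩ := hh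
    refine ⟨k + l, (∏ i, X ⟨i, c i⟩) ^ l * G + (∏ i, X ⟨i, c i⟩) ^ k * H, ?_⟩
    rw [map_add, map_mul, map_mul, map_pow, map_pow, hx, hG, hH]
    ring
  | mul_X g v hg =>
    obtain ⟨k, G, hG⟩ := hg
    by_cases h : v.2 = c v.1
    · have hv : v = ⟨v.1, c v.1⟩ := Sigma.ext rfl (heq_of_eq h)
      refine ⟨k, G * X v, ?_⟩
      rw [map_mul, hG, hv, homogenize_X_chart, mul_assoc]
    · refine ⟨k + 1, G * X v * ∏ i ∈ Finset.univ.erase v.1, X ⟨i, c i⟩, ?_⟩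
      rw [map_mul, map_mul, hG, homogenize_X, if_neg h, map_prod, pow_succ]
      simp only [homogenize_X_chart]
      have hv := Finset.mul_prod_erase Finset.univ
        (fun i => (X ⟨i, c i⟩ : MvPolynomial (Idx m) ℂ)) (Finset.mem_univ v.1)
      linear_combination (∏ i, X ⟨i, c i⟩) ^ k * g * X v * hv

theorem isRelPrime_chart {F : MvPolynomial (Idx m) ℂ} (hF : chart m F c ≠ 0) (i : Fin n) :
    IsRelPrime (chart m F c) (X ⟨i, c i⟩) := by
  refine ((MvPolynomial.X_prime (R := ℂ)).irreducible.isRelPrime_iff_not_dvd.2 fun hdvd => hF ?_).symm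
  let ε : MvPolynomial (Idx m) ℂ →ₐ[ℂ] MvPolynomial (Idx m) ℂ :=
    aeval fun v => if v.2 = c v.1 then 0 else X v
  have hε : ε.comp (aeval fun v : Idx m => if v.2 = c v.1 then 1 else X v) =
      aeval fun v : Idx m => if v.2 = c v.1 then 1 else X v := by
    ext v : 1
    by_cases h : v.2 = c v.1 <;> simp [ε, h]
  have h : ε (chart m F c) = chart m F c := DFunLike.congr_fun hε F
  have h0 := map_dvd ε hdvd
  rwa [show ε (X ⟨i, c i⟩) = 0 by simp [ε], zero_dvd_iff, h] at h0

theorem prime_chart {F : MvPolynomial (Idx m) ℂ} {a : Fin n → ℕ} (hirr : Irreducible F)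
    (hdeg : IsMultiHomog m F a) (hu : ¬ IsUnit (chart m F c)) : Prime (chart m F c) := by
  have hF := homogenize_eq c hdeg
  set f := chart m F c
  set x : MvPolynomial (Idx m) ℂ := ∏ i, X ⟨i, c i⟩ with hx_def
  set y : MvPolynomial (Idx m) ℂ := ∏ i, X ⟨i, c i⟩ ^ a i with hy_def
  have hx : homogenize c x = x := by simp [hx_def, map_prod]
  have hy : homogenize c y = y := by simp [hy_def, map_prod]
  have hf0 : f ≠ 0 := fun h => hirr.ne_zero <| homogenize_injective c <| by
    rw [hF, h, mul_zero, map_zero]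
  have hfx : ∀ k, IsRelPrime f (x ^ k) := fun k =>
    (IsRelPrime.prod_right fun i _ => isRelPrime_chart c hf0 i).pow_right
  have hfy : IsRelPrime f y :=
    IsRelPrime.prod_right fun i _ => (isRelPrime_chart c hf0 i).pow_right
  have hdvd : ∀ (g G : MvPolynomial (Idx m) ℂ) (k : ℕ), homogenize c G = x ^ k * g → F ∣ G →
      f ∣ g := fun g G k hG hFG => by
    have h := map_dvd (homogenize c) hFG
    rw [hF, hG] at h
    exact (hfx k).dvd_of_dvd_mul_left (dvd_of_mul_left_dvd h)
  refine ⟨hf0, hu, fun g h => ?_⟩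
  rintro ⟨q, hq⟩
  obtain ⟨i, G, hG⟩ := exists_homogenize_eq_pow_mul c g
  obtain ⟨j, H, hH⟩ := exists_homogenize_eq_pow_mul c h
  obtain ⟨k, Q, hQ⟩ := exists_homogenize_eq_pow_mul c q
  rw [← hx_def] at hG hH hQ
  have hmul : G * H * (x ^ k * y) = F * (Q * x ^ (i + j)) := by
    apply homogenize_injective c
    simp only [map_mul, map_pow, hG, hH, hQ, hx, hy, hF]
    linear_combination x ^ (i + j + k) * y * hq
  have hprime : Prime F := hirr.prime
  rcases hprime.dvd_or_dvd ⟨_, hmul⟩ with hGH | hxy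
  · exact (hprime.dvd_or_dvd hGH).imp (hdvd g G i hG) (hdvd h H j hH)
  · have h := map_dvd (homogenize c) hxy
    rw [hF, map_mul, map_pow, hx, hy] at h
    exact absurd (((hfx k).mul_right hfy) dvd_rfl (dvd_of_mul_left_dvd h)) hu

theorem degreeOf_chart_le {F : MvPolynomial (Idx m) ℂ} (w : Idx m) :
    (chart m F c).degreeOf w ≤ F.degreeOf w := by
  classical
  conv_lhs => rw [F.as_sum]
  rw [chart, map_sum]
  refine (degreeOf_sum_le _ _ _).trans (Finset.sup_le fun p hp => ?_)
  refine le_trans ?_ (monomial_le_degreeOf w hp)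
  have h := chart_monomial c p (coeff p F)
  rw [chart] at h
  rw [h]
  refine (degreeOf_C_mul_le _ _ _).trans ((degreeOf_prod_le _ _ _).trans ?_)
  rw [Finset.sum_eq_single w]
  · refine (degreeOf_pow_le _ _ _).trans ?_
    split_ifs <;> simp
  · intro v _ hv
    refine Nat.le_zero.1 ((degreeOf_pow_le _ _ _).trans ?_)
    split_ifs <;> simp [degreeOf_X_of_ne hv.symm]
  · simp

theorem IsMultiHomog.degreeOf_le {F : MvPolynomial (Idx m) ℂ} {a : Fin n → ℕ}
    (hdeg : IsMultiHomog m F a) (w : Idx m) : F.degreeOf w ≤ a w.1 := by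
  refine degreeOf_le_iff.2 fun p hp => ?_
  rw [← hdeg p hp w.1]
  exact Finset.single_le_sum (f := fun j => p ⟨w.1, j⟩) (fun _ _ => Nat.zero_le _)
    (Finset.mem_univ w.2)

end MultiProj

/-- an irreducible effective Cartier divisor in `∏ i, ℙ^(m i)` whose
multidegree is a vector of `0`'s and `1`'s is normal. -/
theorem normal_of_irreducible_multidegree_zero_one
    (n : ℕ) (hn : 1 ≤ n) (m : Fin n → ℕ) (hm : ∀ i, 1 ≤ m i)
    (F : MvPolynomial (MultiProj.Idx m) ℂ) (a : Fin n → ℕ)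
    (hirr : Irreducible F)
    (hdeg : MultiProj.IsMultiHomog m F a) (h01 : ∀ i, a i ≤ 1) :
    MultiProj.IsNormalHypersurface m F := by
  intro c hu
  have hf := MultiProj.prime_chart c hirr hdeg hu
  have : (Ideal.span {MultiProj.chart m F c}).IsPrime :=
    (Ideal.span_singleton_prime hf.ne_zero).2 hf
  have hdom : IsDomain (MvPolynomial (MultiProj.Idx m) ℂ ⧸ Ideal.span {MultiProj.chart m F c}) :=
    Ideal.Quotient.isDomain _
  refine ⟨hdom, isIntegrallyClosed_of_degreeOf_le_one
    (Ideal.Quotient.mkₐ_surjective ℂ (Ideal.span {MultiProj.chart m F c}))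
    (fun p => Ideal.Quotient.eq_zero_iff_dvd _ p) hf
    (fun w => (MultiProj.degreeOf_chart_le c w).trans ((hdeg.degreeOf_le w).trans (h01 w.1))) ?_⟩
  rw [Fintype.card_sigma]
  calc 2 ≤ Fintype.card (Fin (m ⟨0, hn⟩ + 1)) := by simpa using hm ⟨0, hn⟩
    _ ≤ _ := Finset.single_le_sum (f := fun i => Fintype.card (Fin (m i + 1)))
      (fun _ _ => Nat.zero_le _) (Finset.mem_univ _)
end

section
/- Let $X=\prod_{i=1}^n \mathbb{P}^{m_i}$ and let $\Delta \geq 0$ be a $\mathbb{Q}$-divisor on $X$ of multidegree $(1,1,\dots,1)$ with round-down $\lfloor \Delta \rfloor = 0$. Then the pair $(X,\Delta)$ is Kawamata log terminal (klt). -/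
open MvPolynomial MeasureTheory Metric
open scoped LinearAlgebra.Projectivization

namespace PolydiscIntegrability

/-- The weighted degree of the family `g` is at most one in every variable. -/
def DegreeLeOne {σ ι : Type} [Fintype ι] (g : ι → MvPolynomial σ ℂ) (w : ι → ℝ) : Prop :=
  ∀ v, ∑ i, w i * (degreeOf v (g i) : ℝ) ≤ 1

/-- The weighted multiplicity of the family `g` along every irreducible polynomial is below one. -/
def MultiplicityLtOne {σ ι : Type} [Fintype ι] (g : ι → MvPolynomial σ ℂ) (w : ι → ℝ) : Prop :=
  ∀ p, Irreducible p → ∀ e : ι → ℕ, (∀ i, p ^ e i ∣ g i) → ∑ i, w i * (e i : ℝ) < 1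

/-- Pairwise non-associated irreducible polynomials. -/
def IsReducedFamily {σ ι : Type} (g : ι → MvPolynomial σ ℂ) : Prop :=
  (∀ i, Irreducible (g i)) ∧ ∀ i j, i ≠ j → ¬ Associated (g i) (g j)

theorem IsReducedFamily.multiplicityLtOne {σ ι : Type} [Fintype ι] {g : ι → MvPolynomial σ ℂ}
    (hg : IsReducedFamily g) {w : ι → ℝ} (h1 : ∀ i, w i < 1) :
    MultiplicityLtOne g w := by
  classical
  intro p hp e he
  have key : ∀ i, e i ≠ 0 → e i = 1 ∧ Associated p (g i) := by
    intro i hi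
    have hdvd : p ∣ g i := (dvd_pow_self p hi).trans (he i)
    have hass : Associated p (g i) := hp.associated_of_dvd (hg.1 i) hdvd
    refine ⟨?_, hass⟩
    by_contra hne
    have h2 : p * p ∣ g i := by
      rw [← pow_two]
      exact (pow_dvd_pow p (by omega)).trans (he i)
    have h3 : p * p ∣ p * 1 := by
      rw [mul_one]; exact h2.trans hass.symm.dvd
    have h4 : p ∣ 1 := (mul_dvd_mul_iff_left hp.ne_zero).1 h3
    exact hp.not_isUnit (isUnit_of_dvd_one h4)
  by_cases h : ∃ i, e i ≠ 0
  · obtain ⟨i, hi⟩ := h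
    have : ∑ j, w j * (e j : ℝ) = w i * (e i : ℝ) := by
      refine Finset.sum_eq_single i (fun j _ hji => ?_) (by simp)
      by_cases hj : e j = 0
      · simp [hj]
      · exact absurd ((key j hj).2.symm.trans (key i hi).2) (hg.2 j i hji)
    rw [this, (key i hi).1]
    simpa using h1 i
  · push Not at h
    simp [h]

theorem exists_degreeOf_pos {σ : Type} {p : MvPolynomial σ ℂ} (hp : Irreducible p) :
    ∃ v, 0 < degreeOf v p := by
  by_contra! h
  have : p.totalDegree = 0 := by
    rw [totalDegree_eq_zero_iff]
    intro m hm v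
    have := (degreeOf_le_iff.1 (h v)) m hm
    simpa using this
  rw [totalDegree_eq_zero_iff_eq_C] at this
  apply hp.not_isUnit
  rw [this]
  apply IsUnit.map
  rw [isUnit_iff_ne_zero]
  intro h0
  rw [h0, map_zero] at this
  exact hp.ne_zero this

theorem mul_degreeOf_le_of_pow_dvd {σ : Type} {p f : MvPolynomial σ ℂ} (hf : f ≠ 0) {e : ℕ}
    (h : p ^ e ∣ f) (v : σ) : e * degreeOf v p ≤ degreeOf v f := by
  obtain ⟨c, rfl⟩ := h
  have hc := right_ne_zero_of_mul hf
  have hp := left_ne_zero_of_mul hf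
  rw [degreeOf_mul_eq hp hc]
  rcases eq_or_ne e 0 with rfl | he
  · simp
  · rw [degreeOf_pow_eq _ _ _ (by rintro rfl; simp [he] at hp)]
    omega

/-- Index type of the nonzero coefficients of a family of polynomials in one more variable. -/
abbrev CoeffIdx {N : ℕ} {ι : Type} (F : ι → MvPolynomial (Fin (N + 1)) ℂ) : Type :=
  Σ i, {α // α ∈ (finSuccEquiv ℂ N (F i)).support}

/-- The nonzero coefficients, with respect to the first variable, of a family of polynomials. -/
noncomputable def coeffFamily {N : ℕ} {ι : Type} (F : ι → MvPolynomial (Fin (N + 1)) ℂ)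
    (a : CoeffIdx F) : MvPolynomial (Fin N) ℂ :=
  (finSuccEquiv ℂ N (F a.1)).coeff a.2

/-- The weight of each polynomial, distributed evenly over its nonzero coefficients. -/
noncomputable def coeffWeight {N : ℕ} {ι : Type} (F : ι → MvPolynomial (Fin (N + 1)) ℂ)
    (w : ι → ℝ) (a : CoeffIdx F) : ℝ :=
  w a.1 / ((finSuccEquiv ℂ N (F a.1)).support.card : ℝ)

theorem coeffFamily_ne_zero {N : ℕ} {ι : Type} (F : ι → MvPolynomial (Fin (N + 1)) ℂ)
    (a : CoeffIdx F) : coeffFamily F a ≠ 0 :=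
  Polynomial.mem_support_iff.1 a.2.2

theorem card_support_pos {N : ℕ} {f : MvPolynomial (Fin (N + 1)) ℂ} (hf : f ≠ 0) :
    (0 : ℝ) < ((finSuccEquiv ℂ N f).support.card : ℝ) := by
  rw [Nat.cast_pos, Finset.card_pos, Polynomial.support_nonempty]
  simpa using hf

theorem coeffWeight_nonneg {N : ℕ} {ι : Type} (F : ι → MvPolynomial (Fin (N + 1)) ℂ)
    {w : ι → ℝ} (h0 : ∀ i, 0 ≤ w i) (a : CoeffIdx F) : 0 ≤ coeffWeight F w a :=
  div_nonneg (h0 _) (Nat.cast_nonneg _)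

theorem sum_coeffWeight {N : ℕ} {ι : Type} [Fintype ι] {F : ι → MvPolynomial (Fin (N + 1)) ℂ}
    (hF : ∀ i, F i ≠ 0) (w c : ι → ℝ) :
    ∑ a : CoeffIdx F, coeffWeight F w a * c a.1 = ∑ i, w i * c i := by
  rw [Fintype.sum_sigma]
  refine Finset.sum_congr rfl fun i _ => ?_
  have := (card_support_pos (hF i)).ne'
  simp only [coeffWeight, Finset.sum_const, Finset.card_univ, Fintype.card_coe, nsmul_eq_mul]
  field_simp

theorem degreeLeOne_coeffFamily {N : ℕ} {ι : Type} [Fintype ι]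
    {F : ι → MvPolynomial (Fin (N + 1)) ℂ} (hF : ∀ i, F i ≠ 0) {w : ι → ℝ} (h0 : ∀ i, 0 ≤ w i)
    (hdeg : DegreeLeOne F w) : DegreeLeOne (coeffFamily F) (coeffWeight F w) := by
  intro v
  refine le_trans ?_ (hdeg v.succ)
  rw [← sum_coeffWeight hF w (fun i => (degreeOf v.succ (F i) : ℝ))]
  refine Finset.sum_le_sum fun a _ => ?_
  refine mul_le_mul_of_nonneg_left ?_ (coeffWeight_nonneg F h0 a)
  exact_mod_cast degreeOf_coeff_finSuccEquiv (F a.1) v a.2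

theorem multiplicityLtOne_coeffFamily {N : ℕ} {ι : Type} [Fintype ι]
    {F : ι → MvPolynomial (Fin (N + 1)) ℂ} (hF : ∀ i, F i ≠ 0) {w : ι → ℝ} (h0 : ∀ i, 0 ≤ w i)
    (hdeg : DegreeLeOne F w) (hmult : MultiplicityLtOne F w) :
    MultiplicityLtOne (coeffFamily F) (coeffWeight F w) := by
  classical
  intro p hp e he
  by_contra! hge
  obtain ⟨v, hv⟩ := exists_degreeOf_pos hp
  have hle : ∀ a : CoeffIdx F, e a * degreeOf v p ≤ degreeOf v.succ (F a.1) := fun a =>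
    (mul_degreeOf_le_of_pow_dvd (coeffFamily_ne_zero F a) (he a) v).trans
      (degreeOf_coeff_finSuccEquiv (F a.1) v a.2)
  have hterm : ∀ a ∈ Finset.univ, coeffWeight F w a * ((e a : ℝ) * degreeOf v p) ≤
      coeffWeight F w a * (degreeOf v.succ (F a.1) : ℝ) := fun a _ =>
    mul_le_mul_of_nonneg_left (by exact_mod_cast hle a) (coeffWeight_nonneg F h0 a)
  have hsum : ∑ a, coeffWeight F w a * ((e a : ℝ) * degreeOf v p) =
      ∑ a : CoeffIdx F, coeffWeight F w a * (degreeOf v.succ (F a.1) : ℝ) := by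
    refine le_antisymm (Finset.sum_le_sum hterm) ?_
    rw [sum_coeffWeight hF w (fun i => (degreeOf v.succ (F i) : ℝ))]
    refine (hdeg v.succ).trans ?_
    have h1 : (1 : ℝ) ≤ degreeOf v p := by exact_mod_cast hv
    calc (1 : ℝ) ≤ ∑ a, coeffWeight F w a * (e a : ℝ) := hge
      _ ≤ _ := Finset.sum_le_sum fun a _ => by
        refine mul_le_mul_of_nonneg_left ?_ (coeffWeight_nonneg F h0 a)
        exact le_mul_of_one_le_right (Nat.cast_nonneg _) h1
  have heq := (Finset.sum_eq_sum_iff_of_le hterm).1 hsum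
  -- the exponent only depends on the polynomial, not on the coefficient
  let e' : ι → ℕ := fun i => if w i = 0 then 0 else degreeOf v.succ (F i) / degreeOf v p
  have hee : ∀ a : CoeffIdx F, w a.1 ≠ 0 → e a = e' a.1 := by
    intro a ha
    have hne : coeffWeight F w a ≠ 0 := div_ne_zero ha (card_support_pos (hF _)).ne'
    have h2 := mul_left_cancel₀ hne (heq a (Finset.mem_univ _))
    have h3 : e a * degreeOf v p = degreeOf v.succ (F a.1) := by exact_mod_cast h2
    simp only [e', if_neg ha, ← h3]
    exact (Nat.mul_div_cancel _ hv).symm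
  have hC : Irreducible ((finSuccEquiv ℂ N).symm (Polynomial.C p)) := by
    rw [MulEquiv.irreducible_iff]
    exact (Polynomial.prime_C_iff.2 hp.prime).irreducible
  have hlt := hmult _ hC e' (fun i => by
    by_cases hw : w i = 0
    · simp [e', hw]
    · rw [← map_pow, ← map_dvd_iff (finSuccEquiv ℂ N), AlgEquiv.apply_symm_apply, ← Polynomial.C_pow,
        Polynomial.C_dvd_iff_dvd_coeff]
      intro α
      by_cases hα : α ∈ (finSuccEquiv ℂ N (F i)).support
      · have := he ⟨i, α, hα⟩
        rwa [hee ⟨i, α, hα⟩ hw] at this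
      · rw [Polynomial.notMem_support_iff.1 hα]
        exact dvd_zero _)
  refine absurd hge (not_le.2 ?_)
  refine lt_of_eq_of_lt ?_ hlt
  rw [← sum_coeffWeight hF w (fun i => (e' i : ℝ))]
  refine Finset.sum_congr rfl fun a _ => ?_
  by_cases hw : w a.1 = 0
  · simp [coeffWeight, hw]
  · rw [hee a hw]

theorem exists_reducedFamily {σ ι : Type} [Fintype ι] (g : ι → MvPolynomial σ ℂ)
    (hg : ∀ i, g i ≠ 0) {w : ι → ℝ} (h0 : ∀ i, 0 ≤ w i) (hdeg : DegreeLeOne g w)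
    (hmult : MultiplicityLtOne g w) :
    ∃ (κ : Type) (_ : Fintype κ) (f : κ → MvPolynomial σ ℂ) (q : κ → ℝ),
      IsReducedFamily f ∧ (∀ k, 0 ≤ q k) ∧ (∀ k, q k < 1) ∧ DegreeLeOne f q ∧
      ∃ C : ℝ, ∀ y, (∀ i, eval y (g i) ≠ 0) →
        ∏ i, ‖eval y (g i)‖ ^ (-2 * w i) = C * ∏ k, ‖eval y (f k)‖ ^ (-2 * q k) := by
  classical
  let _ : StrongNormalizationMonoid (MvPolynomial σ ℂ) :=
    UniqueFactorizationMonoid.strongNormalizationMonoid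
  let n : ι → MvPolynomial σ ℂ → ℕ := fun i p =>
    (UniqueFactorizationMonoid.normalizedFactors (g i)).count p
  let K : Finset (MvPolynomial σ ℂ) :=
    Finset.univ.biUnion fun i => (UniqueFactorizationMonoid.normalizedFactors (g i)).toFinset
  have hsub : ∀ i, (UniqueFactorizationMonoid.normalizedFactors (g i)).toFinset ⊆ K := fun i =>
    Finset.subset_biUnion_of_mem (fun i => (UniqueFactorizationMonoid.normalizedFactors (g i)).toFinset)
      (Finset.mem_univ i)
  have hK : ∀ p ∈ K, Irreducible p ∧ normalize p = p := by
    intro p hp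
    obtain ⟨i, -, hi⟩ := Finset.mem_biUnion.1 hp
    rw [Multiset.mem_toFinset] at hi
    exact ⟨UniqueFactorizationMonoid.irreducible_of_normalized_factor _ hi,
      UniqueFactorizationMonoid.normalize_normalized_factor _ hi⟩
  have hfac : ∀ i, ∃ c : ℂ, c ≠ 0 ∧ g i = C c * ∏ p ∈ K, p ^ n i p := by
    intro i
    obtain ⟨u, hu⟩ := UniqueFactorizationMonoid.prod_normalizedFactors (hg i)
    obtain ⟨c, hc, hcu⟩ := isUnit_iff_eq_C_of_isReduced.1 u.isUnit
    refine ⟨c, hc.ne_zero, ?_⟩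
    rw [← Finset.prod_multiset_count_of_subset _ _ (hsub i), ← hcu, mul_comm]
    exact hu.symm
  have hdvd : ∀ i, ∀ p ∈ K, p ^ n i p ∣ g i := by
    intro i p hp
    obtain ⟨c, -, hc⟩ := hfac i
    rw [hc]
    exact (Finset.dvd_prod_of_mem (fun p => p ^ n i p) hp).mul_left _
  refine ⟨K, inferInstance, fun p => p, fun p => ∑ i, w i * (n i p : ℝ), ⟨fun p => (hK p p.2).1, ?_⟩,
    fun p => Finset.sum_nonneg fun i _ => mul_nonneg (h0 i) (Nat.cast_nonneg _), ?_, ?_, ?_⟩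
  · intro p p' hne hass
    apply hne
    apply Subtype.ext
    rw [← (hK p p.2).2, ← (hK p' p'.2).2]
    exact normalize_eq_normalize hass.dvd hass.symm.dvd
  · intro p
    exact hmult p (hK p p.2).1 (fun i => n i p) (fun i => hdvd i p p.2)
  · intro v
    refine le_trans (le_of_eq ?_) (hdeg v)
    have hdegree : ∀ i, (degreeOf v (g i) : ℝ) = ∑ p : K, (n i p : ℝ) * degreeOf v (p : MvPolynomial σ ℂ) := by
      intro i
      obtain ⟨c, hc0, hc⟩ := hfac i
      have hne : ∏ p ∈ K, p ^ n i p ≠ 0 := by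
        intro h
        exact hg i (by rw [hc, h, mul_zero])
      rw [hc, degreeOf_C_mul v c (mem_nonZeroDivisors_of_ne_zero hc0), degreeOf_prod_eq _ _
        (fun p hp => pow_ne_zero _ (hK p hp).1.ne_zero), ← Finset.sum_coe_sort, Nat.cast_sum]
      refine Finset.sum_congr rfl fun p _ => ?_
      rw [degreeOf_pow_eq _ _ _ (hK p p.2).1.ne_zero, Nat.cast_mul]
    simp_rw [hdegree, Finset.mul_sum, Finset.sum_mul]
    rw [Finset.sum_comm]
    simp_rw [mul_assoc]
  · choose c hc0 hc using hfac
    refine ⟨∏ i, ‖c i‖ ^ (-2 * w i), fun y hy => ?_⟩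
    have heval : ∀ i, eval y (g i) = c i * ∏ p : K, eval y (p : MvPolynomial σ ℂ) ^ n i p := by
      intro i
      conv_lhs => rw [hc i]
      rw [map_mul, eval_C, map_prod, ← Finset.prod_coe_sort]
      simp
    have hsplit : ∀ i, ‖eval y (g i)‖ ^ (-2 * w i) = ‖c i‖ ^ (-2 * w i) *
        ∏ p : K, (‖eval y (p : MvPolynomial σ ℂ)‖ ^ n i p) ^ (-2 * w i) := by
      intro i
      rw [heval i, norm_mul, norm_prod, Real.mul_rpow (norm_nonneg _)
        (Finset.prod_nonneg fun _ _ => norm_nonneg _), ← Real.finsetProd_rpow _ _ (fun _ _ => norm_nonneg _)]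
      simp only [norm_pow]
    simp_rw [hsplit]
    rw [Finset.prod_mul_distrib, Finset.prod_comm]
    congr 1
    refine Finset.prod_congr rfl fun p _ => ?_
    have hcase : ∀ i, n i p ≠ 0 → eval y (p : MvPolynomial σ ℂ) ≠ 0 := by
      intro i hi h
      apply hy i
      rw [heval i, Finset.prod_eq_zero (Finset.mem_univ p) (by rw [h, zero_pow hi]), mul_zero]
    by_cases hz : eval y (p : MvPolynomial σ ℂ) = 0
    · have : ∀ i, n i p = 0 := fun i => by
        by_contra h
        exact hcase i h hz
      simp [this]
    · rw [Finset.mul_sum, Real.rpow_sum_of_pos (norm_pos_iff.2 hz)]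
      refine Finset.prod_congr rfl fun i _ => ?_
      rw [← Real.rpow_natCast_mul (norm_nonneg _)]
      congr 1
      ring

theorem exists_mul_add_mul_derivative_prod_eq_C {A : Type} [CommRing A] [IsDomain A] [CharZero A]
    [UniqueFactorizationMonoid A] {ι : Type} {f : ι → Polynomial A} (J : Finset ι)
    (hirr : ∀ j ∈ J, Irreducible (f j)) (hJ : ∀ j ∈ J, (f j).natDegree ≠ 0)
    (hne : ∀ i ∈ J, ∀ j ∈ J, i ≠ j → ¬ Associated (f i) (f j)) :
    ∃ R : A, R ≠ 0 ∧ ∃ a b : Polynomial A,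
      a * (∏ j ∈ J, f j) + b * Polynomial.derivative (∏ j ∈ J, f j) = Polynomial.C R := by
  classical
  have : NormalizedGCDMonoid A := Classical.choice inferInstance
  have : CharZero (FractionRing A) := IsFractionRing.charZero A
  have hφ : Function.Injective (algebraMap A (FractionRing A)) := IsFractionRing.injective _ _
  have hprim : ∀ j ∈ J, (f j).IsPrimitive := fun j hj => (hirr j hj).isPrimitive (hJ j hj)
  have hirrQ : ∀ j ∈ J, Irreducible ((f j).map (algebraMap A (FractionRing A))) := fun j hj =>
    ((hprim j hj).irreducible_iff_irreducible_map_fraction_map).1 (hirr j hj)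
  have hsep : (∏ j ∈ J, (f j).map (algebraMap A (FractionRing A))).Separable := by
    refine Polynomial.separable_prod' (fun i hi j hj hij => ?_) fun j hj => (hirrQ j hj).separable
    refine ((hirrQ i hi).coprime_iff_not_dvd).2 fun hdvd => ?_
    have h1 := (hprim i hi).dvd_of_fraction_map_dvd_fraction_map hdvd
    exact hne i hi j hj hij ((hirr i hi).associated_of_dvd (hirr j hj) h1)
  rw [← Polynomial.map_prod] at hsep
  set G := ∏ j ∈ J, f j
  obtain ⟨a, b, hab⟩ := hsep
  obtain ⟨r, hr, hra⟩ := IsLocalization.integerNormalization_spec (nonZeroDivisors A) a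
  obtain ⟨s, hs, hsb⟩ := IsLocalization.integerNormalization_spec (nonZeroDivisors A) b
  refine ⟨r * s, mul_ne_zero (nonZeroDivisors.ne_zero hr) (nonZeroDivisors.ne_zero hs),
    Polynomial.C s * IsLocalization.integerNormalization (nonZeroDivisors A) a,
    Polynomial.C r * IsLocalization.integerNormalization (nonZeroDivisors A) b, ?_⟩
  apply Polynomial.map_injective _ hφ
  rw [Polynomial.map_add, Polynomial.map_mul, Polynomial.map_mul, Polynomial.map_mul,
    Polynomial.map_mul, hra, hsb, Polynomial.map_C, Polynomial.map_C, Polynomial.map_C,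
    ← Polynomial.derivative_map, Algebra.smul_def, Algebra.smul_def,
    Polynomial.algebraMap_apply, Polynomial.algebraMap_apply, map_mul, Polynomial.C_mul]
  linear_combination (Polynomial.C (algebraMap A (FractionRing A) r) *
    Polynomial.C (algebraMap A (FractionRing A) s)) * hab

theorem IsReducedFamily.exists_mul_add_mul_derivative_eq_C {N : ℕ} {ι : Type}
    {F : ι → MvPolynomial (Fin (N + 1)) ℂ} (hF : IsReducedFamily F) (J : Finset ι)
    (hJ : ∀ j ∈ J, (finSuccEquiv ℂ N (F j)).natDegree ≠ 0) :
    ∃ R : MvPolynomial (Fin N) ℂ, R ≠ 0 ∧ ∃ a b : Polynomial (MvPolynomial (Fin N) ℂ),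
      a * (∏ j ∈ J, finSuccEquiv ℂ N (F j)) +
        b * Polynomial.derivative (∏ j ∈ J, finSuccEquiv ℂ N (F j)) = Polynomial.C R := by
  refine exists_mul_add_mul_derivative_prod_eq_C J
    (fun j _ => (MulEquiv.irreducible_iff (finSuccEquiv ℂ N)).2 (hF.1 j)) hJ
    fun i _ j _ hij h => hF.2 i j hij ?_
  have := h.map (finSuccEquiv ℂ N).symm.toRingEquiv.toRingHom
  simpa using this

theorem exists_inverse_distance (S : Finset ℂ) {t : ℂ} (ht : t ∉ S) :
    ∃ m : ℝ, 1 ≤ m ∧ (∀ r ∈ S, 1 ≤ m * ‖t - r‖) ∧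
      ∀ s : ℝ, 0 ≤ s → m ^ s ≤ 1 + ∑ r ∈ S, ‖t - r‖ ^ (-s) := by
  have hpos : ∀ r ∈ S, 0 < ‖t - r‖ := fun r hr =>
    norm_pos_iff.2 (sub_ne_zero.2 (by rintro rfl; exact ht hr))
  have hterm : ∀ s : ℝ, ∀ r ∈ S, 0 ≤ ‖t - r‖ ^ (-s) := fun s r _ =>
    Real.rpow_nonneg (norm_nonneg _) _
  rcases S.eq_empty_or_nonempty with rfl | hS
  · exact ⟨1, le_rfl, by simp, by simp⟩
  · obtain ⟨r₀, hr₀, hmin⟩ := S.exists_min_image (fun r => ‖t - r‖) hS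
    refine ⟨max 1 ‖t - r₀‖⁻¹, le_max_left _ _, fun r hr => ?_, fun s hs => ?_⟩
    · calc (1 : ℝ) = ‖t - r₀‖⁻¹ * ‖t - r₀‖ := (inv_mul_cancel₀ (hpos r₀ hr₀).ne').symm
        _ ≤ max 1 ‖t - r₀‖⁻¹ * ‖t - r‖ :=
          mul_le_mul (le_max_right _ _) (hmin r hr) (norm_nonneg _) (by positivity)
    · have hsum := Finset.sum_nonneg (hterm s)
      rcases max_choice 1 ‖t - r₀‖⁻¹ with h | h
      · rw [h, Real.one_rpow]
        linarith
      · rw [h, Real.inv_rpow (norm_nonneg _), ← Real.rpow_neg (norm_nonneg _)]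
        linarith [Finset.single_le_sum (hterm s) hr₀]

theorem max_one_norm_le {R m : ℝ} (hR : 1 ≤ R) (hm : 1 ≤ m) {t r : ℂ} (ht : ‖t‖ ≤ R)
    (h : 1 ≤ m * ‖t - r‖) : max 1 ‖r‖ ≤ 2 * R * m * ‖t - r‖ := by
  have h2 : ‖r‖ ≤ ‖t‖ + ‖t - r‖ := by
    have := norm_sub_le t (t - r)
    simpa using this
  have h3 : 0 ≤ ‖t - r‖ := norm_nonneg _
  have h4 : ‖t - r‖ ≤ R * m * ‖t - r‖ := le_mul_of_one_le_left h3 (one_le_mul_of_one_le_of_one_le hR hm)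
  have h5 : R ≤ R * m * ‖t - r‖ := by
    rw [mul_assoc]; exact le_mul_of_one_le_right (by linarith) h
  apply max_le <;> linarith

theorem norm_coeff_le_mul_norm_eval {R m : ℝ} (hR : 1 ≤ R) (hm : 1 ≤ m) (P : Polynomial ℂ) {t : ℂ}
    (ht : ‖t‖ ≤ R) (h : ∀ r ∈ P.roots, 1 ≤ m * ‖t - r‖) (α : ℕ) :
    ‖P.coeff α‖ ≤ (4 * R * m) ^ P.natDegree * ‖P.eval t‖ := by
  have hsplit := IsAlgClosed.splits P
  have h1 : P.mahlerMeasure ≤ (2 * R * m) ^ P.natDegree * ‖P.eval t‖ := by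
    rw [Polynomial.mahlerMeasure_eq_leadingCoeff_mul_prod_roots, hsplit.eval_eq_prod_roots,
      norm_mul, hsplit.natDegree_eq_card_roots]
    have h2 : ∀ s : Multiset ℂ, (∀ r ∈ s, 1 ≤ m * ‖t - r‖) →
        (s.map fun r => max 1 ‖r‖).prod ≤ (2 * R * m) ^ s.card * ‖(s.map fun r => t - r).prod‖ := by
      intro s
      induction s using Multiset.induction_on with
      | empty => simp
      | cons a s ih =>
        intro hs
        have ha := max_one_norm_le hR hm ht (hs a (Multiset.mem_cons_self _ _))
        have hb := ih fun r hr => hs r (Multiset.mem_cons_of_mem hr)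
        simp only [Multiset.map_cons, Multiset.prod_cons, Multiset.card_cons, norm_mul]
        calc _ ≤ (2 * R * m * ‖t - a‖) * ((2 * R * m) ^ s.card * ‖(s.map fun r => t - r).prod‖) := by
              refine mul_le_mul ha hb (Multiset.prod_nonneg fun x hx => ?_) (by positivity)
              obtain ⟨r, -, rfl⟩ := Multiset.mem_map.1 hx
              positivity
          _ = _ := by ring
    have := mul_le_mul_of_nonneg_left (h2 P.roots h) (norm_nonneg P.leadingCoeff)
    linarith
  calc ‖P.coeff α‖ ≤ (P.natDegree.choose α) * P.mahlerMeasure :=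
        Polynomial.norm_coeff_le_choose_mul_mahlerMeasure α P
    _ ≤ 2 ^ P.natDegree * ((2 * R * m) ^ P.natDegree * ‖P.eval t‖) := by
        refine mul_le_mul ?_ h1 (Polynomial.mahlerMeasure_nonneg P) (by positivity)
        exact_mod_cast Nat.choose_le_two_pow _ _
    _ = _ := by
        rw [← mul_assoc, ← mul_pow]; ring_nf

theorem norm_eval_derivative_le {m : ℝ} (P : Polynomial ℂ) {t : ℂ} (ht : P.eval t ≠ 0)
    (h : ∀ r ∈ P.roots, 1 ≤ m * ‖t - r‖) :
    ‖P.derivative.eval t‖ ≤ P.natDegree * m * ‖P.eval t‖ := by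
  have hsplit := IsAlgClosed.splits P
  rw [hsplit.eval_derivative_eq_eval_mul_sum ht, norm_mul, mul_comm]
  refine mul_le_mul_of_nonneg_right ?_ (norm_nonneg _)
  rw [hsplit.natDegree_eq_card_roots]
  refine (norm_multiset_sum_le _).trans ?_
  rw [Multiset.map_map]
  refine (Multiset.sum_le_card_nsmul _ m ?_).trans (by simp)
  intro x hx
  obtain ⟨r, hr, rfl⟩ := Multiset.mem_map.1 hx
  have h1 := h r hr
  have hpos : 0 < ‖t - r‖ := by
    refine (norm_nonneg _).lt_of_ne fun h0 => ?_
    rw [← h0] at h1; linarith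
  simp only [Function.comp, norm_div, norm_one]
  rwa [div_le_iff₀ hpos]

theorem exists_lintegral_norm_sub_rpow_le (R : ℝ) {s : ℝ} (hs0 : 0 ≤ s) (hs : s < 2) :
    ∃ K : ENNReal, K < ⊤ ∧ ∀ r : ℂ,
      ∫⁻ t in closedBall (0 : ℂ) R, ENNReal.ofReal (‖t - r‖ ^ (-s)) ≤ K := by
  let u : ℂ → ENNReal := (ball (0 : ℂ) 1).indicator fun t => ENNReal.ofReal (‖t‖ ^ (-s))
  refine ⟨volume (closedBall (0 : ℂ) R) + ∫⁻ t, u t, ?_, fun r => ?_⟩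
  · refine ENNReal.add_lt_top.2 ⟨measure_closedBall_lt_top, ?_⟩
    rw [lintegral_indicator measurableSet_ball]
    have hloc : LocallyIntegrable (fun t : ℂ => ‖t‖ ^ (-s)) volume := by
      refine locallyIntegrable_of_norm_le_rpow (C := 1) (α := s) (by simp) (by simpa using hs) ?_ ?_
      · refine Filter.Eventually.of_forall fun t => ?_
        rw [Real.norm_of_nonneg (Real.rpow_nonneg (norm_nonneg _) _), one_mul]
      · exact (measurable_norm.pow_const (-s)).aestronglyMeasurable
    have h1 : IntegrableOn (fun t : ℂ => ‖t‖ ^ (-s)) (ball 0 1) :=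
      (hloc.integrableOn_isCompact (isCompact_closedBall 0 1)).mono_set ball_subset_closedBall
    have h2 := h1.lintegral_lt_top
    exact h2
  · have hle : ∀ t : ℂ, ENNReal.ofReal (‖t - r‖ ^ (-s)) ≤ 1 + u (t - r) := by
      intro t
      by_cases ht : t - r ∈ ball (0 : ℂ) 1
      · simp only [u, Set.indicator_of_mem ht]
        exact le_add_self
      · refine le_trans ?_ le_self_add
        rw [mem_ball_zero_iff, not_lt] at ht
        rw [ENNReal.ofReal_le_one]
        exact Real.rpow_le_one_of_one_le_of_nonpos ht (by linarith)
    calc _ ≤ ∫⁻ t in closedBall (0 : ℂ) R, (1 + u (t - r)) := lintegral_mono hle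
      _ = volume (closedBall (0 : ℂ) R) + ∫⁻ t in closedBall (0 : ℂ) R, u (t - r) := by
        rw [lintegral_add_left measurable_const, setLIntegral_const, one_mul]
      _ ≤ _ := by
        refine add_le_add le_rfl ?_
        refine (setLIntegral_le_lintegral _ _).trans ?_
        rw [lintegral_sub_right_eq_self u r]

theorem exists_norm_eval_le {n : ℕ} (P : MvPolynomial (Fin n) ℂ) (ρ : ℝ) :
    ∃ M : ℝ, 1 ≤ M ∧ ∀ x : Fin n → ℂ, (∀ i, ‖x i‖ ≤ ρ) → ‖eval x P‖ ≤ M := by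
  obtain ⟨M, hM⟩ := (isCompact_univ_pi fun _ : Fin n => isCompact_closedBall (0 : ℂ) ρ)
    |>.exists_bound_of_continuousOn (MvPolynomial.continuous_eval P).continuousOn
  refine ⟨max 1 M, le_max_left _ _, fun x hx => (hM x ?_).trans (le_max_right _ _)⟩
  simpa [Set.mem_pi] using hx

theorem eval_cons_eq {n : ℕ} (F : MvPolynomial (Fin (n + 1)) ℂ) (x : Fin n → ℂ) (t : ℂ) :
    eval (Fin.cons t x : Fin (n + 1) → ℂ) F =
      ((finSuccEquiv ℂ n F).map (eval x)).eval t :=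
  eval_eq_eval_mv_eval' x t F

theorem norm_eval_coeff_le {n : ℕ} {ρ m : ℝ} (hρ : 1 ≤ ρ) (hm : 1 ≤ m)
    (F : MvPolynomial (Fin (n + 1)) ℂ) {x : Fin n → ℂ} {t : ℂ} (ht : ‖t‖ ≤ ρ)
    (h : ∀ r ∈ ((finSuccEquiv ℂ n F).map (eval x)).roots, 1 ≤ m * ‖t - r‖) (α : ℕ) :
    ‖eval x ((finSuccEquiv ℂ n F).coeff α)‖ ≤
      (4 * ρ * m) ^ (finSuccEquiv ℂ n F).natDegree * ‖eval (Fin.cons t x : Fin (n + 1) → ℂ) F‖ := by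
  have h1 := norm_coeff_le_mul_norm_eval hρ hm _ ht h α
  rw [Polynomial.coeff_map] at h1
  rw [eval_cons_eq]
  refine h1.trans (mul_le_mul_of_nonneg_right ?_ (norm_nonneg _))
  refine pow_le_pow_right₀ ?_ Polynomial.natDegree_map_le
  nlinarith

theorem rpow_neg_le_of_le_mul {a b c s : ℝ} (hc : 0 < c) (hb : 0 < b) (hs : 0 ≤ s)
    (h : c ≤ b * a) : a ^ (-s) ≤ b ^ s * c ^ (-s) := by
  have h1 : c / b ≤ a := by rwa [div_le_iff₀' hb]
  calc a ^ (-s) ≤ (c / b) ^ (-s) :=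
        Real.rpow_le_rpow_of_nonpos (div_pos hc hb) h1 (by linarith)
    _ = _ := by
        rw [Real.div_rpow hc.le hb.le, Real.rpow_neg hb.le, div_inv_eq_mul, mul_comm]

theorem rpow_neg_le_mul_rpow_neg {c M s s' : ℝ} (hc : 0 < c) (hM : 1 ≤ M) (hcM : c ≤ M)
    (hs : s ≤ s') (hs0 : 0 ≤ s) : c ^ (-s) ≤ M ^ s' * c ^ (-s') := by
  calc c ^ (-s) = c ^ (s' - s) * c ^ (-s') := by
        rw [← Real.rpow_add hc]; ring_nf
    _ ≤ M ^ s' * c ^ (-s') := by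
        refine mul_le_mul_of_nonneg_right ?_ (Real.rpow_nonneg hc.le _)
        exact (Real.rpow_le_rpow hc.le hcM (by linarith)).trans
          (Real.rpow_le_rpow_of_exponent_le hM (by linarith))

theorem norm_eval_rpow_le {n : ℕ} {ρ m : ℝ} (hρ : 1 ≤ ρ) (hm : 1 ≤ m)
    {F : MvPolynomial (Fin (n + 1)) ℂ} (hF : F ≠ 0) {x : Fin n → ℂ} {t : ℂ} (ht : ‖t‖ ≤ ρ)
    (h : ∀ r ∈ ((finSuccEquiv ℂ n F).map (eval x)).roots, 1 ≤ m * ‖t - r‖)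
    (hx : ∀ α ∈ (finSuccEquiv ℂ n F).support, eval x ((finSuccEquiv ℂ n F).coeff α) ≠ 0)
    {q : ℝ} (hq : 0 ≤ q) :
    ‖eval (Fin.cons t x : Fin (n + 1) → ℂ) F‖ ^ (-2 * q) ≤
      (4 * ρ * m) ^ (2 * (q * ((finSuccEquiv ℂ n F).natDegree : ℝ))) *
        ∏ α ∈ (finSuccEquiv ℂ n F).support, ‖eval x ((finSuccEquiv ℂ n F).coeff α)‖ ^
          (-(2 * (q / ((finSuccEquiv ℂ n F).support.card : ℝ)))) := by
  have hcard := card_support_pos hF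
  have hB : 0 < 4 * ρ * m := by positivity
  set f := finSuccEquiv ℂ n F
  set a := ‖eval (Fin.cons t x : Fin (n + 1) → ℂ) F‖ with ha
  set s := 2 * (q / (f.support.card : ℝ)) with hs
  have hs0 : 0 ≤ s := by positivity
  have hle : ∀ α, ‖eval x (f.coeff α)‖ ≤ (4 * ρ * m) ^ f.natDegree * a :=
    norm_eval_coeff_le hρ hm F ht h
  have hsum : s * (f.support.card : ℝ) = 2 * q := by
    rw [hs]; field_simp
  have h1 : a ^ (-2 * q) = ∏ α ∈ f.support, a ^ (-s) := by
    rw [Finset.prod_const, ← Real.rpow_mul_natCast (norm_nonneg _), neg_mul, neg_mul, hsum]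
  have h2 : (4 * ρ * m) ^ (2 * (q * (f.natDegree : ℝ))) =
      ∏ α ∈ f.support, ((4 * ρ * m) ^ f.natDegree) ^ s := by
    rw [Finset.prod_const, ← Real.rpow_mul_natCast (by positivity), hsum,
      ← Real.rpow_natCast_mul hB.le]
    ring_nf
  rw [h1, h2, ← Finset.prod_mul_distrib]
  refine Finset.prod_le_prod (fun _ _ => Real.rpow_nonneg (norm_nonneg _) _) fun α hα => ?_
  exact rpow_neg_le_of_le_mul (norm_pos_iff.2 (hx α hα)) (by positivity) hs0 (hle α)

/-- On a bounded region, the Bézout relation `a G + b G' = R` bounds `R` by `G`, up to the inverse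
distance to the roots of `G`. -/
theorem exists_norm_eval_le_mul {n : ℕ} {ρ : ℝ} (G : MvPolynomial (Fin (n + 1)) ℂ)
    {R : MvPolynomial (Fin n) ℂ} {a b : Polynomial (MvPolynomial (Fin n) ℂ)}
    (hab : a * finSuccEquiv ℂ n G + b * Polynomial.derivative (finSuccEquiv ℂ n G) =
      Polynomial.C R) :
    ∃ B : ℝ, 0 < B ∧ ∀ (x : Fin n → ℂ) (t : ℂ) (m : ℝ), (∀ i, ‖x i‖ ≤ ρ) → ‖t‖ ≤ ρ → 1 ≤ m →
      eval (Fin.cons t x : Fin (n + 1) → ℂ) G ≠ 0 →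
      (∀ r ∈ ((finSuccEquiv ℂ n G).map (eval x)).roots, 1 ≤ m * ‖t - r‖) →
      ‖eval x R‖ ≤ B * m * ‖eval (Fin.cons t x : Fin (n + 1) → ℂ) G‖ := by
  obtain ⟨Ma, hMa, ha⟩ := exists_norm_eval_le ((finSuccEquiv ℂ n).symm a) ρ
  obtain ⟨Mb, hMb, hb⟩ := exists_norm_eval_le ((finSuccEquiv ℂ n).symm b) ρ
  refine ⟨Ma + Mb * (finSuccEquiv ℂ n G).natDegree, by positivity,
    fun x t m hx ht hm hG hroots => ?_⟩
  have hcons : ∀ i, ‖(Fin.cons t x : Fin (n + 1) → ℂ) i‖ ≤ ρ := by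
    intro i
    refine Fin.cases ?_ (fun i => ?_) i
    · simpa using ht
    · simpa using hx i
  have ha' := ha _ hcons
  have hb' := hb _ hcons
  rw [eval_cons_eq, AlgEquiv.apply_symm_apply] at ha' hb'
  rw [eval_cons_eq] at hG ⊢
  have h1 := congrArg (fun p => (p.map (eval x)).eval t) hab
  simp only [Polynomial.map_add, Polynomial.map_mul, Polynomial.eval_add, Polynomial.eval_mul,
    Polynomial.map_C, Polynomial.eval_C, ← Polynomial.derivative_map] at h1
  have h2 := norm_eval_derivative_le _ hG hroots
  set g := (finSuccEquiv ℂ n G).map (eval x)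
  have hdeg : (g.natDegree : ℝ) ≤ (finSuccEquiv ℂ n G).natDegree := by
    exact_mod_cast Polynomial.natDegree_map_le
  rw [← h1]
  refine (norm_add_le _ _).trans ?_
  rw [norm_mul, norm_mul]
  have h3 : ‖(a.map (eval x)).eval t‖ * ‖g.eval t‖ ≤ Ma * m * ‖g.eval t‖ := by
    refine mul_le_mul_of_nonneg_right ?_ (norm_nonneg _)
    exact ha'.trans (le_mul_of_one_le_right (by linarith) hm)
  have h4 : ‖(b.map (eval x)).eval t‖ * ‖g.derivative.eval t‖ ≤
      Mb * ((finSuccEquiv ℂ n G).natDegree * m * ‖g.eval t‖) := by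
    refine mul_le_mul hb' (h2.trans ?_) (norm_nonneg _) (by linarith)
    gcongr
  linarith

theorem exists_norm_eval_rpow_le_leadingCoeff {n : ℕ} {ρ : ℝ} (hρ : 1 ≤ ρ)
    {D : MvPolynomial (Fin (n + 1)) ℂ} {ε ε' : ℝ} (hε : 0 ≤ ε) (hε' : ε ≤ ε') :
    ∃ K : ℝ, 0 ≤ K ∧ ∀ (x : Fin n → ℂ) (t : ℂ) (m : ℝ), (∀ i, ‖x i‖ ≤ ρ) → ‖t‖ ≤ ρ → 1 ≤ m →
      (∀ r ∈ ((finSuccEquiv ℂ n D).map (eval x)).roots, 1 ≤ m * ‖t - r‖) →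
      eval x (finSuccEquiv ℂ n D).leadingCoeff ≠ 0 →
      ‖eval (Fin.cons t x : Fin (n + 1) → ℂ) D‖ ^ (-ε) ≤
        K * m ^ (ε * ((finSuccEquiv ℂ n D).natDegree : ℝ)) *
          ‖eval x (finSuccEquiv ℂ n D).leadingCoeff‖ ^ (-ε') := by
  obtain ⟨M, hM, hMle⟩ := exists_norm_eval_le (finSuccEquiv ℂ n D).leadingCoeff ρ
  refine ⟨(4 * ρ) ^ (ε * ((finSuccEquiv ℂ n D).natDegree : ℝ)) * M ^ ε', by positivity,
    fun x t m hx ht hm hr h0 => ?_⟩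
  have h1 := norm_eval_coeff_le hρ hm D ht hr (finSuccEquiv ℂ n D).natDegree
  rw [Polynomial.coeff_natDegree] at h1
  have h2 := rpow_neg_le_of_le_mul (norm_pos_iff.2 h0) (by positivity) hε h1
  have h3 := rpow_neg_le_mul_rpow_neg (norm_pos_iff.2 h0) hM (hMle x hx) hε' hε
  have h4 : ((4 * ρ * m) ^ (finSuccEquiv ℂ n D).natDegree) ^ ε =
      (4 * ρ) ^ (ε * ((finSuccEquiv ℂ n D).natDegree : ℝ)) *
        m ^ (ε * ((finSuccEquiv ℂ n D).natDegree : ℝ)) := by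
    rw [← Real.mul_rpow (by positivity) (by positivity), ← Real.rpow_natCast_mul (by positivity),
      mul_comm ε]
  rw [h4] at h2
  refine h2.trans ((mul_le_mul_of_nonneg_left h3 (by positivity)).trans (le_of_eq ?_))
  ring

theorem exists_norm_eval_rpow_le_prod_coeff {n : ℕ} {ρ : ℝ} (hρ : 1 ≤ ρ)
    {F : MvPolynomial (Fin (n + 1)) ℂ} (hF : F ≠ 0) {q' q : ℝ} (hq' : 0 ≤ q') (hq : q' ≤ q) :
    ∃ K : ℝ, 0 ≤ K ∧ ∀ (x : Fin n → ℂ) (t : ℂ) (m : ℝ), (∀ i, ‖x i‖ ≤ ρ) → ‖t‖ ≤ ρ → 1 ≤ m →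
      (∀ r ∈ ((finSuccEquiv ℂ n F).map (eval x)).roots, 1 ≤ m * ‖t - r‖) →
      (∀ α ∈ (finSuccEquiv ℂ n F).support, eval x ((finSuccEquiv ℂ n F).coeff α) ≠ 0) →
      ‖eval (Fin.cons t x : Fin (n + 1) → ℂ) F‖ ^ (-2 * q') ≤
        K * m ^ (2 * (q' * ((finSuccEquiv ℂ n F).natDegree : ℝ))) *
          ∏ α : {α // α ∈ (finSuccEquiv ℂ n F).support},
            ‖eval x ((finSuccEquiv ℂ n F).coeff α)‖ ^
              (-2 * (q / ((finSuccEquiv ℂ n F).support.card : ℝ))) := by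
  choose M hM hMle using fun α => exists_norm_eval_le ((finSuccEquiv ℂ n F).coeff α) ρ
  have hcard := card_support_pos hF
  set f := finSuccEquiv ℂ n F with hf
  refine ⟨(4 * ρ) ^ (2 * (q' * (f.natDegree : ℝ))) *
    ∏ α ∈ f.support, M α ^ (2 * (q / (f.support.card : ℝ))),
    mul_nonneg (by positivity) (Finset.prod_nonneg fun α _ =>
      Real.rpow_nonneg (zero_le_one.trans (hM α)) _), fun x t m hx ht hm hr h0 => ?_⟩
  have h1 := norm_eval_rpow_le hρ hm hF ht hr h0 hq'
  rw [← hf] at h1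
  rw [Finset.prod_coe_sort f.support
    (fun α => ‖eval x (f.coeff α)‖ ^ (-2 * (q / (f.support.card : ℝ))))]
  have h2 : ∏ α ∈ f.support, ‖eval x (f.coeff α)‖ ^ (-(2 * (q' / (f.support.card : ℝ)))) ≤
      ∏ α ∈ f.support, (M α ^ (2 * (q / (f.support.card : ℝ))) *
        ‖eval x (f.coeff α)‖ ^ (-2 * (q / (f.support.card : ℝ)))) := by
    refine Finset.prod_le_prod (fun _ _ => Real.rpow_nonneg (norm_nonneg _) _) fun α hα => ?_
    rw [neg_mul]
    refine rpow_neg_le_mul_rpow_neg (norm_pos_iff.2 (h0 α hα)) (hM α) (hMle α x hx) ?_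
      (by positivity)
    gcongr
  rw [Finset.prod_mul_distrib] at h2
  refine h1.trans ((mul_le_mul_of_nonneg_left h2 (by positivity)).trans (le_of_eq ?_))
  rw [Real.mul_rpow (by positivity) (by positivity)]
  ring

theorem exists_norm_eval_prod_rpow_le {n : ℕ} {ρ : ℝ} {ι : Type}
    (F : ι → MvPolynomial (Fin (n + 1)) ℂ) (J : Finset ι)
    {R : MvPolynomial (Fin n) ℂ} {a b : Polynomial (MvPolynomial (Fin n) ℂ)}
    (hab : a * (∏ j ∈ J, finSuccEquiv ℂ n (F j)) +
      b * Polynomial.derivative (∏ j ∈ J, finSuccEquiv ℂ n (F j)) = Polynomial.C R)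
    {δ ε' : ℝ} (hδ : 0 ≤ δ) (hε' : 2 * δ ≤ ε') :
    ∃ K : ℝ, 0 ≤ K ∧ ∀ (x : Fin n → ℂ) (t : ℂ) (m : ℝ), (∀ i, ‖x i‖ ≤ ρ) → ‖t‖ ≤ ρ → 1 ≤ m →
      (∀ j ∈ J, eval (Fin.cons t x : Fin (n + 1) → ℂ) (F j) ≠ 0) →
      (∀ j ∈ J, ∀ r ∈ ((finSuccEquiv ℂ n (F j)).map (eval x)).roots, 1 ≤ m * ‖t - r‖) →
      eval x R ≠ 0 →
      ∏ j ∈ J, ‖eval (Fin.cons t x : Fin (n + 1) → ℂ) (F j)‖ ^ (-2 * δ) ≤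
        K * m ^ (2 * δ) * ‖eval x R‖ ^ (-ε') := by
  classical
  rw [← map_prod] at hab
  obtain ⟨B, hB, hBle⟩ := exists_norm_eval_le_mul (ρ := ρ) _ hab
  obtain ⟨M, hM, hMle⟩ := exists_norm_eval_le R ρ
  refine ⟨B ^ (2 * δ) * M ^ ε', by positivity, fun x t m hx ht hm hF hr hR => ?_⟩
  have hG : eval (Fin.cons t x : Fin (n + 1) → ℂ) (∏ j ∈ J, F j) ≠ 0 := by
    rw [map_prod]; exact Finset.prod_ne_zero_iff.2 hF
  have h1 := hBle x t m hx ht hm hG (fun r hr' => by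
    rw [map_prod, Polynomial.map_prod] at hr'
    have h := Polynomial.isRoot_of_mem_roots hr'
    rw [Polynomial.IsRoot.def, Polynomial.eval_prod, Finset.prod_eq_zero_iff] at h
    obtain ⟨j, hj, h⟩ := h
    refine hr j hj r ((Polynomial.mem_roots ?_).2 h)
    intro h0
    apply hF j hj
    rw [eval_cons_eq, h0, Polynomial.eval_zero])
  have h2 := rpow_neg_le_of_le_mul (norm_pos_iff.2 hR) (by positivity)
    (by positivity : 0 ≤ 2 * δ) h1
  have h3 := rpow_neg_le_mul_rpow_neg (norm_pos_iff.2 hR) hM (hMle x hx) hε' (by positivity)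
  rw [Real.finsetProd_rpow _ _ fun _ _ => norm_nonneg _, ← norm_prod, ← map_prod, neg_mul]
  rw [Real.mul_rpow hB.le (by positivity)] at h2
  refine h2.trans ((mul_le_mul_of_nonneg_left h3 (by positivity)).trans (le_of_eq ?_))
  ring

theorem exists_integrand_le {n : ℕ} {ρ : ℝ} (hρ : 1 ≤ ρ) {ι : Type} [Fintype ι] [DecidableEq ι]
    {F : ι → MvPolynomial (Fin (n + 1)) ℂ} (hF : ∀ i, F i ≠ 0) (D : MvPolynomial (Fin (n + 1)) ℂ)
    {q : ι → ℝ} (hq : ∀ i, 0 ≤ q i) (J : Finset ι)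
    {R : MvPolynomial (Fin n) ℂ} {a b : Polynomial (MvPolynomial (Fin n) ℂ)}
    (hab : a * (∏ j ∈ J, finSuccEquiv ℂ n (F j)) +
      b * Polynomial.derivative (∏ j ∈ J, finSuccEquiv ℂ n (F j)) = Polynomial.C R)
    {δ ε ε' : ℝ} (hδ : 0 ≤ δ) (hδJ : ∀ j ∈ J, δ ≤ q j) (hδε : 2 * δ ≤ ε') (hε : 0 ≤ ε)
    (hεε : ε ≤ ε') :
    ∃ K : ℝ, 0 ≤ K ∧ ∀ (x : Fin n → ℂ) (t : ℂ) (m : ℝ), (∀ i, ‖x i‖ ≤ ρ) → ‖t‖ ≤ ρ → 1 ≤ m →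
      (∀ r ∈ ((finSuccEquiv ℂ n D).map (eval x)).roots, 1 ≤ m * ‖t - r‖) →
      (∀ i, ∀ r ∈ ((finSuccEquiv ℂ n (F i)).map (eval x)).roots, 1 ≤ m * ‖t - r‖) →
      (∀ i, eval (Fin.cons t x : Fin (n + 1) → ℂ) (F i) ≠ 0) →
      eval x ((finSuccEquiv ℂ n D).leadingCoeff * R) ≠ 0 →
      (∀ c, eval x (coeffFamily F c) ≠ 0) →
      ‖eval (Fin.cons t x : Fin (n + 1) → ℂ) D‖ ^ (-ε) *
        ∏ i, ‖eval (Fin.cons t x : Fin (n + 1) → ℂ) (F i)‖ ^ (-2 * q i) ≤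
      K * m ^ (ε * ((finSuccEquiv ℂ n D).natDegree : ℝ) + 2 * δ +
          2 * (∑ i, q i * ((finSuccEquiv ℂ n (F i)).natDegree : ℝ) -
            δ * ∑ j ∈ J, ((finSuccEquiv ℂ n (F j)).natDegree : ℝ))) *
        (‖eval x ((finSuccEquiv ℂ n D).leadingCoeff * R)‖ ^ (-ε') *
          ∏ c, ‖eval x (coeffFamily F c)‖ ^ (-2 * coeffWeight F q c)) := by
  obtain ⟨K₁, hK₁, h₁⟩ := exists_norm_eval_rpow_le_leadingCoeff hρ (D := D) hε hεε
  obtain ⟨K₂, hK₂, h₂⟩ := exists_norm_eval_prod_rpow_le (ρ := ρ) F J hab hδ hδε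
  set q' : ι → ℝ := fun i => q i - if i ∈ J then δ else 0 with hq'
  have hq'0 : ∀ i, 0 ≤ q' i := fun i => by
    simp only [hq']; split_ifs with h
    · linarith [hδJ i h]
    · linarith [hq i]
  have hq'q : ∀ i, q' i ≤ q i := fun i => by
    simp only [hq']; split_ifs <;> linarith
  choose K₃ hK₃ h₃ using fun i => exists_norm_eval_rpow_le_prod_coeff hρ (hF i) (hq'0 i) (hq'q i)
  refine ⟨K₁ * K₂ * ∏ i, K₃ i, mul_nonneg (mul_nonneg hK₁ hK₂)
    (Finset.prod_nonneg fun i _ => hK₃ i), fun x t m hx ht hm hrD hrF hFx hDR hc => ?_⟩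
  have hm0 : 0 < m := by linarith
  rw [map_mul] at hDR
  have e₁ := h₁ x t m hx ht hm hrD (left_ne_zero_of_mul hDR)
  have e₂ := h₂ x t m hx ht hm (fun j _ => hFx j) (fun j _ => hrF j) (right_ne_zero_of_mul hDR)
  have e₃ := fun i => h₃ i x t m hx ht hm (hrF i) fun α hα => hc ⟨i, α, hα⟩
  have e₄ := Finset.prod_le_prod (s := Finset.univ)
    (fun i _ => Real.rpow_nonneg (norm_nonneg _) _) fun i _ => e₃ i
  have split : ∏ i, ‖eval (Fin.cons t x : Fin (n + 1) → ℂ) (F i)‖ ^ (-2 * q i) =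
      (∏ j ∈ J, ‖eval (Fin.cons t x : Fin (n + 1) → ℂ) (F j)‖ ^ (-2 * δ)) *
      ∏ i, ‖eval (Fin.cons t x : Fin (n + 1) → ℂ) (F i)‖ ^ (-2 * q' i) := by
    have hJ := Finset.prod_ite_mem Finset.univ J
      fun i => ‖eval (Fin.cons t x : Fin (n + 1) → ℂ) (F i)‖ ^ (-2 * δ)
    rw [Finset.univ_inter] at hJ
    rw [← hJ, ← Finset.prod_mul_distrib]
    refine Finset.prod_congr rfl fun i _ => ?_
    simp only [hq']
    split_ifs
    · rw [← Real.rpow_add (norm_pos_iff.2 (hFx i))]; ring_nf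
    · simp
  rw [split]
  rw [Finset.prod_mul_distrib, Finset.prod_mul_distrib] at e₄
  have hexp : ∏ i, m ^ (2 * (q' i * ((finSuccEquiv ℂ n (F i)).natDegree : ℝ))) =
      m ^ (2 * (∑ i, q i * ((finSuccEquiv ℂ n (F i)).natDegree : ℝ) -
            δ * ∑ j ∈ J, ((finSuccEquiv ℂ n (F j)).natDegree : ℝ))) := by
    rw [← Real.rpow_sum_of_pos hm0, ← Finset.mul_sum]
    congr 2
    simp only [hq', sub_mul, Finset.sum_sub_distrib, ite_mul, zero_mul, Finset.sum_ite_mem,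
      Finset.univ_inter, Finset.mul_sum]
  rw [hexp] at e₄
  have hprod : ∏ i, ∏ α : {α // α ∈ (finSuccEquiv ℂ n (F i)).support},
      ‖eval x ((finSuccEquiv ℂ n (F i)).coeff α)‖ ^
        (-2 * (q i / ((finSuccEquiv ℂ n (F i)).support.card : ℝ))) =
      ∏ c, ‖eval x (coeffFamily F c)‖ ^ (-2 * coeffWeight F q c) := by
    rw [Fintype.prod_sigma]
    rfl
  rw [hprod] at e₄
  have hpos : ∀ i, 0 ≤ ‖eval (Fin.cons t x : Fin (n + 1) → ℂ) (F i)‖ := fun i => norm_nonneg _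
  have hΨ : 0 ≤ ∏ c, ‖eval x (coeffFamily F c)‖ ^ (-2 * coeffWeight F q c) :=
    Finset.prod_nonneg fun c _ => Real.rpow_nonneg (norm_nonneg _) _
  refine (mul_le_mul e₁ (mul_le_mul e₂ e₄
    (Finset.prod_nonneg fun i _ => Real.rpow_nonneg (hpos i) _) (by positivity))
    (mul_nonneg (Finset.prod_nonneg fun i _ => Real.rpow_nonneg (hpos i) _)
      (Finset.prod_nonneg fun i _ => Real.rpow_nonneg (hpos i) _)) (by positivity)).trans
    (le_of_eq ?_)
  rw [map_mul, norm_mul, Real.mul_rpow (norm_nonneg _) (norm_nonneg _), Real.rpow_add hm0,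
    Real.rpow_add hm0]
  ring

theorem lintegral_pi_succ (μ : Measure ℂ) [SigmaFinite μ] {n : ℕ} {f : (Fin (n + 1) → ℂ) → ENNReal}
    (hf : Measurable f) :
    ∫⁻ z, f z ∂(Measure.pi fun _ : Fin (n + 1) => μ) =
      ∫⁻ x, ∫⁻ t, f (Fin.cons t x) ∂μ ∂(Measure.pi fun _ : Fin n => μ) := by
  have h := (measurePreserving_piFinSuccAbove (fun _ : Fin (n + 1) => μ) 0).symm
  rw [← h.lintegral_comp hf, lintegral_prod_symm]
  swap
  · exact (hf.comp h.measurable).aemeasurable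
  refine lintegral_congr fun x => lintegral_congr fun t => ?_
  simp [MeasurableEquiv.piFinSuccAbove, Fin.insertNthEquiv]

theorem measurable_eval {σ : Type} (P : MvPolynomial σ ℂ) :
    Measurable fun z : σ → ℂ => eval z P := by
  induction P using MvPolynomial.induction_on with
  | C a => simp
  | add p q hp hq => simpa only [map_add] using! hp.add hq
  | mul_X p i hp => simpa only [map_mul, eval_X] using! hp.mul (measurable_pi_apply i)

theorem ae_eval_ne_zero (μ : Measure ℂ) [SigmaFinite μ] [NullSingletonClass μ] {n : ℕ}
    {P : MvPolynomial (Fin n) ℂ} (hP : P ≠ 0) :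
    ∀ᵐ x ∂(Measure.pi fun _ : Fin n => μ), eval x P ≠ 0 := by
  induction n with
  | zero =>
    refine Filter.Eventually.of_forall fun x => ?_
    rw [eq_C_of_isEmpty P] at hP ⊢
    simpa using hP
  | succ n ih =>
    have hlc : (finSuccEquiv ℂ n P).leadingCoeff ≠ 0 := by simpa using hP
    have hm : MeasurableSet {z : Fin (n + 1) → ℂ | eval z P = 0} :=
      measurable_eval P (measurableSet_singleton 0)
    rw [ae_iff]
    simp only [not_not]
    rw [← lintegral_indicator_one hm,
      lintegral_pi_succ μ (measurable_one.indicator hm)]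
    refine lintegral_eq_zero_of_ae_eq_zero ?_
    filter_upwards [ih hlc] with x hx
    refine lintegral_eq_zero_of_ae_eq_zero ?_
    have hmap : (finSuccEquiv ℂ n P).map (eval x) ≠ 0 := fun h => by
      apply hx
      rw [Polynomial.leadingCoeff, ← Polynomial.coeff_map, h, Polynomial.coeff_zero]
    filter_upwards [((finSuccEquiv ℂ n P).map (eval x)).roots.toFinset.measure_zero μ
      |> compl_mem_ae_iff.2] with t ht
    refine Set.indicator_of_notMem (fun h => ht ?_) _
    rw [Set.mem_ofPred_eq, eval_cons_eq] at h
    simpa [hmap] using h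

theorem ae_norm_le_of_pi (ρ : ℝ) (n : ℕ) :
    ∀ᵐ x ∂(Measure.pi fun _ : Fin n => (volume.restrict (closedBall (0 : ℂ) ρ))),
      ∀ i, ‖x i‖ ≤ ρ := by
  rw [ae_all_iff]
  intro i
  have : ∀ᵐ t ∂(volume.restrict (closedBall (0 : ℂ) ρ)), ‖t‖ ≤ ρ := by
    filter_upwards [ae_restrict_mem measurableSet_closedBall] with t ht
    simpa using ht
  exact (Measure.tendsto_eval_ae_ae (μ := fun _ : Fin n => volume.restrict (closedBall (0 : ℂ) ρ))
    (i := i)).eventually this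

theorem exists_lintegral_ofReal_le (ρ : ℝ) (T : ℕ) {s : ℝ} (hs0 : 0 ≤ s) (hs : s < 2) :
    ∃ L : ENNReal, L < ⊤ ∧ ∀ (S : Finset ℂ) (A : ℝ) (Φ : ℂ → ℝ), S.card ≤ T → 0 ≤ A →
      (∀ t ∉ S, ‖t‖ ≤ ρ → ∀ m, 1 ≤ m → (∀ r ∈ S, 1 ≤ m * ‖t - r‖) → Φ t ≤ A * m ^ s) →
      ∫⁻ t in closedBall (0 : ℂ) ρ, ENNReal.ofReal (Φ t) ≤ L * ENNReal.ofReal A := by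
  obtain ⟨K, hK, hKle⟩ := exists_lintegral_norm_sub_rpow_le ρ hs0 hs
  refine ⟨volume (closedBall (0 : ℂ) ρ) + T * K, ?_, fun S A Φ hS hA hΦ => ?_⟩
  · exact ENNReal.add_lt_top.2 ⟨measure_closedBall_lt_top,
      ENNReal.mul_lt_top (ENNReal.natCast_lt_top _) hK⟩
  have hm : ∀ r : ℂ, Measurable fun t : ℂ => ENNReal.ofReal (‖t - r‖ ^ (-s)) := fun r => by
    fun_prop
  have hae : ∀ᵐ t ∂(volume.restrict (closedBall (0 : ℂ) ρ)), ENNReal.ofReal (Φ t) ≤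
      (1 + ∑ r ∈ S, ENNReal.ofReal (‖t - r‖ ^ (-s))) * ENNReal.ofReal A := by
    filter_upwards [ae_restrict_mem measurableSet_closedBall,
      compl_mem_ae_iff.2 (S.measure_zero (volume.restrict (closedBall (0 : ℂ) ρ)))] with t ht htS
    obtain ⟨m, hm1, hmr, hms⟩ := exists_inverse_distance S (t := t) (by simpa using htS)
    have h := (hΦ t (by simpa using htS) (by simpa using ht) m hm1 hmr).trans
      (mul_le_mul_of_nonneg_left (hms s hs0) hA)
    refine (ENNReal.ofReal_le_ofReal h).trans (le_of_eq ?_)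
    have h0 : ∀ r ∈ S, 0 ≤ ‖t - r‖ ^ (-s) := fun r _ => Real.rpow_nonneg (norm_nonneg _) _
    rw [mul_comm, ENNReal.ofReal_mul (by have := Finset.sum_nonneg h0; positivity),
      ENNReal.ofReal_add zero_le_one (Finset.sum_nonneg h0), ENNReal.ofReal_one,
      ENNReal.ofReal_sum_of_nonneg h0]
  refine (lintegral_mono_ae hae).trans ?_
  rw [lintegral_mul_const _ (by fun_prop), lintegral_add_left measurable_const,
    lintegral_finsetSum _ fun r _ => hm r]
  simp only [lintegral_const, one_mul, Measure.restrict_apply, MeasurableSet.univ, Set.univ_inter]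
  gcongr
  calc ∑ r ∈ S, ∫⁻ t in closedBall (0 : ℂ) ρ, ENNReal.ofReal (‖t - r‖ ^ (-s)) ≤ ∑ r ∈ S, K :=
        Finset.sum_le_sum fun r _ => hKle r
    _ ≤ T * K := by
        rw [Finset.sum_const, nsmul_eq_mul]
        gcongr

/-- Either the weighted degree in the first variable is below one, or lowering the weights of the
members of positive weight and positive degree by a small `δ` lowers it by at least `2 * δ`. -/
theorem IsReducedFamily.exists_bezout {N : ℕ} {ι : Type} [Fintype ι]
    {F : ι → MvPolynomial (Fin (N + 1)) ℂ} (hF : IsReducedFamily F) {q : ι → ℝ}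
    (h0 : ∀ i, 0 ≤ q i) (h1 : ∀ i, q i < 1)
    (hdeg : ∑ i, q i * ((finSuccEquiv ℂ N (F i)).natDegree : ℝ) ≤ 1) :
    ∃ (J : Finset ι) (R : MvPolynomial (Fin N) ℂ)
      (a b : Polynomial (MvPolynomial (Fin N) ℂ)) (δ₀ : ℝ), R ≠ 0 ∧ 0 < δ₀ ∧
      a * (∏ j ∈ J, finSuccEquiv ℂ N (F j)) +
        b * Polynomial.derivative (∏ j ∈ J, finSuccEquiv ℂ N (F j)) = Polynomial.C R ∧
      (∀ j ∈ J, δ₀ ≤ q j) ∧ ∀ δ, 0 ≤ δ → δ ≤ δ₀ →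
        ∑ i, q i * ((finSuccEquiv ℂ N (F i)).natDegree : ℝ) -
          δ * ∑ j ∈ J, ((finSuccEquiv ℂ N (F j)).natDegree : ℝ) + 2 * δ ≤ 1 := by
  classical
  rcases hdeg.lt_or_eq with hlt | heq
  · refine ⟨∅, 1, 1, 0, (1 - ∑ i, q i * ((finSuccEquiv ℂ N (F i)).natDegree : ℝ)) / 2,
      one_ne_zero, by linarith, by simp, by simp, fun δ _ hδ => ?_⟩
    simp only [Finset.sum_empty]
    linarith
  · set J : Finset ι := Finset.univ.filter fun i => 0 < q i ∧ (finSuccEquiv ℂ N (F i)).natDegree ≠ 0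
      with hJ
    have hmem : ∀ j ∈ J, 0 < q j ∧ (finSuccEquiv ℂ N (F j)).natDegree ≠ 0 := fun j hj =>
      (Finset.mem_filter.1 hj).2
    have hsum : ∑ j ∈ J, q j * ((finSuccEquiv ℂ N (F j)).natDegree : ℝ) = 1 := by
      rw [← heq]
      refine Finset.sum_subset (Finset.subset_univ J) fun i _ hi => ?_
      by_contra h
      refine hi (Finset.mem_filter.2 ⟨Finset.mem_univ i, (h0 i).lt_of_ne' (left_ne_zero_of_mul h),
        ?_⟩)
      exact_mod_cast right_ne_zero_of_mul h
    have hne : J.Nonempty := by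
      by_contra h
      rw [Finset.not_nonempty_iff_eq_empty.1 h] at hsum
      simp at hsum
    have hgt : (1 : ℝ) < ∑ j ∈ J, ((finSuccEquiv ℂ N (F j)).natDegree : ℝ) := by
      rw [← hsum]
      refine Finset.sum_lt_sum_of_nonempty hne fun j hj => ?_
      have := Nat.cast_pos (α := ℝ).2 (Nat.pos_of_ne_zero (hmem j hj).2)
      nlinarith [h1 j]
    have hge : (2 : ℝ) ≤ ∑ j ∈ J, ((finSuccEquiv ℂ N (F j)).natDegree : ℝ) := by
      exact_mod_cast hgt
    obtain ⟨R, hR, a, b, hab⟩ := hF.exists_mul_add_mul_derivative_eq_C J fun j hj => (hmem j hj).2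
    obtain ⟨j₀, hj₀, hmin⟩ := J.exists_min_image q hne
    refine ⟨J, R, a, b, q j₀, hR, (hmem j₀ hj₀).1, hab, hmin, fun δ hδ _ => ?_⟩
    rw [heq]
    nlinarith

theorem measurable_integrand {σ ι : Type} [Fintype ι] (D : MvPolynomial σ ℂ)
    (F : ι → MvPolynomial σ ℂ) (ε : ℝ) (q : ι → ℝ) :
    Measurable fun z : σ → ℂ => ‖eval z D‖ ^ (-ε) * ∏ i, ‖eval z (F i)‖ ^ (-2 * q i) :=
  ((measurable_eval D).norm.pow_const _).mul
    (Finset.measurable_prod _ fun i _ => (measurable_eval (F i)).norm.pow_const _)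

/-- The integral over the polydisc of radius `ρ` of `|D|^(-ε) ∏ |F i|^(-2 q i)` is finite for
every nonzero `D` and some positive `ε`. -/
def IntegrableOnPolydisc (ρ : ℝ) {n : ℕ} {ι : Type} [Fintype ι] (F : ι → MvPolynomial (Fin n) ℂ)
    (q : ι → ℝ) : Prop :=
  ∀ D : MvPolynomial (Fin n) ℂ, D ≠ 0 → ∃ ε : ℝ, 0 < ε ∧
    ∫⁻ z, ENNReal.ofReal (‖eval z D‖ ^ (-ε) * ∏ i, ‖eval z (F i)‖ ^ (-2 * q i))
      ∂(Measure.pi fun _ : Fin n => volume.restrict (closedBall (0 : ℂ) ρ)) < ⊤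

theorem IsReducedFamily.integrableOnPolydisc_succ {ρ : ℝ} (hρ : 1 ≤ ρ) {N : ℕ} {ι : Type}
    [Fintype ι] {F : ι → MvPolynomial (Fin (N + 1)) ℂ} (hF : IsReducedFamily F) {q : ι → ℝ}
    (h0 : ∀ i, 0 ≤ q i) (h1 : ∀ i, q i < 1) (hdeg : DegreeLeOne F q)
    (ih : IntegrableOnPolydisc ρ (coeffFamily F) (coeffWeight F q)) :
    IntegrableOnPolydisc ρ F q := by
  classical
  intro D hD
  have hF0 : ∀ i, F i ≠ 0 := fun i => (hF.1 i).ne_zero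
  have hdeg0 : ∑ i, q i * ((finSuccEquiv ℂ N (F i)).natDegree : ℝ) ≤ 1 := by
    simpa only [natDegree_finSuccEquiv] using hdeg 0
  obtain ⟨J, R, a, b, δ₀, hR, hδ₀, hab, hδJ, hδ⟩ := hF.exists_bezout h0 h1 hdeg0
  have hlc : (finSuccEquiv ℂ N D).leadingCoeff ≠ 0 := by simpa using hD
  have hDR := mul_ne_zero hlc hR
  obtain ⟨ε', hε', hfin⟩ := ih _ hDR
  obtain ⟨δ, hδpos, hδle, hδε, hδ1⟩ : ∃ δ : ℝ, 0 < δ ∧ δ ≤ δ₀ ∧ 2 * δ ≤ ε' ∧ δ ≤ 1 :=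
    ⟨min δ₀ (min (ε' / 2) 1), by positivity, min_le_left _ _,
      by linarith [(min_le_right δ₀ (min (ε' / 2) 1)).trans (min_le_left _ _)],
      (min_le_right _ _).trans (min_le_right _ _)⟩
  set d : ℝ := ((finSuccEquiv ℂ N D).natDegree : ℝ) with hd
  have hd0 : 0 ≤ d := Nat.cast_nonneg _
  set ε := δ / (d + 1) with hε
  have hεpos : 0 < ε := by positivity
  have hεd : ε * d ≤ δ := by
    rw [hε, div_mul_eq_mul_div, div_le_iff₀ (by positivity)]
    nlinarith
  have hεδ : ε ≤ δ := div_le_self hδpos.le (by linarith)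
  refine ⟨ε, hεpos, ?_⟩
  obtain ⟨K, hK, hKle⟩ := exists_integrand_le hρ hF0 D h0 J hab hδpos.le
    (fun j hj => hδle.trans (hδJ j hj)) hδε hεpos.le (by linarith)
  set s := ε * d + 2 * δ + 2 * (∑ i, q i * ((finSuccEquiv ℂ N (F i)).natDegree : ℝ) -
            δ * ∑ j ∈ J, ((finSuccEquiv ℂ N (F j)).natDegree : ℝ)) with hs
  have hs2 : s < 2 := by linarith [hδ δ hδpos.le hδle]
  have hs0 : 0 ≤ s := by
    have : δ * ∑ j ∈ J, ((finSuccEquiv ℂ N (F j)).natDegree : ℝ) ≤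
        ∑ i, q i * ((finSuccEquiv ℂ N (F i)).natDegree : ℝ) := by
      rw [Finset.mul_sum]
      refine (Finset.sum_le_sum fun j hj => ?_).trans (Finset.sum_le_univ_sum_of_nonneg
        fun i => mul_nonneg (h0 i) (Nat.cast_nonneg _))
      exact mul_le_mul_of_nonneg_right (hδle.trans (hδJ j hj)) (Nat.cast_nonneg _)
    have := mul_nonneg hεpos.le hd0
    linarith
  set T := (finSuccEquiv ℂ N D).natDegree + ∑ i, (finSuccEquiv ℂ N (F i)).natDegree
  obtain ⟨L, hL, hLle⟩ := exists_lintegral_ofReal_le ρ T hs0 hs2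
  set Ψ : (Fin N → ℂ) → ℝ := fun x =>
    ‖eval x ((finSuccEquiv ℂ N D).leadingCoeff * R)‖ ^ (-ε') *
      ∏ c, ‖eval x (coeffFamily F c)‖ ^ (-2 * coeffWeight F q c) with hΨ
  have hΨ0 : ∀ x, 0 ≤ Ψ x := fun x => mul_nonneg (Real.rpow_nonneg (norm_nonneg _) _)
    (Finset.prod_nonneg fun c _ => Real.rpow_nonneg (norm_nonneg _) _)
  rw [lintegral_pi_succ _ (measurable_integrand D F ε q).ennreal_ofReal]
  have hbound : ∀ᵐ x ∂(Measure.pi fun _ : Fin N => volume.restrict (closedBall (0 : ℂ) ρ)),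
      ∫⁻ t in closedBall (0 : ℂ) ρ, ENNReal.ofReal
        (‖eval (Fin.cons t x : Fin (N + 1) → ℂ) D‖ ^ (-ε) *
          ∏ i, ‖eval (Fin.cons t x : Fin (N + 1) → ℂ) (F i)‖ ^ (-2 * q i)) ≤
      L * ENNReal.ofReal K * ENNReal.ofReal (Ψ x) := by
    filter_upwards [ae_norm_le_of_pi ρ N, ae_eval_ne_zero _ hDR,
      ae_all_iff.2 fun c => ae_eval_ne_zero _ (coeffFamily_ne_zero F c)] with x hx hxDR hxc
    have hmapF : ∀ i, (finSuccEquiv ℂ N (F i)).map (eval x) ≠ 0 := fun i h => by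
      have hi : finSuccEquiv ℂ N (F i) ≠ 0 := by simpa using hF0 i
      refine hxc ⟨i, _, Polynomial.natDegree_mem_support_of_nonzero hi⟩ ?_
      rw [coeffFamily, ← Polynomial.coeff_map, h, Polynomial.coeff_zero]
    set S : Finset ℂ := ((finSuccEquiv ℂ N D).map (eval x)).roots.toFinset ∪
      Finset.univ.biUnion fun i => ((finSuccEquiv ℂ N (F i)).map (eval x)).roots.toFinset with hS
    have hroots : ∀ f : MvPolynomial (Fin (N + 1)) ℂ,
        ((finSuccEquiv ℂ N f).map (eval x)).roots.toFinset.card ≤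
          (finSuccEquiv ℂ N f).natDegree := fun f =>
      (Multiset.toFinset_card_le _).trans ((Polynomial.card_roots' _).trans
        Polynomial.natDegree_map_le)
    have hST : S.card ≤ T := (Finset.card_union_le _ _).trans (Nat.add_le_add (hroots D)
      (Finset.card_biUnion_le.trans (Finset.sum_le_sum fun i _ => hroots (F i))))
    have hSD : ∀ r ∈ ((finSuccEquiv ℂ N D).map (eval x)).roots, r ∈ S := fun r hr =>
      Finset.mem_union_left _ (Multiset.mem_toFinset.2 hr)
    have hSF : ∀ i, ∀ r ∈ ((finSuccEquiv ℂ N (F i)).map (eval x)).roots, r ∈ S := fun i r hr =>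
      Finset.mem_union_right _ (Finset.mem_biUnion.2 ⟨i, Finset.mem_univ i,
        Multiset.mem_toFinset.2 hr⟩)
    have h := hLle S (K * Ψ x) (fun t => ‖eval (Fin.cons t x : Fin (N + 1) → ℂ) D‖ ^ (-ε) *
          ∏ i, ‖eval (Fin.cons t x : Fin (N + 1) → ℂ) (F i)‖ ^ (-2 * q i)) hST
      (mul_nonneg hK (hΨ0 x)) fun t htS ht m hm hr => ?_
    · rwa [ENNReal.ofReal_mul hK, ← mul_assoc] at h
    · refine (hKle x t m hx ht hm (fun r hrD => hr r (hSD r hrD))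
        (fun i r hrF => hr r (hSF i r hrF)) (fun i h => htS (hSF i t ?_)) hxDR hxc).trans
        (le_of_eq ?_)
      · rw [eval_cons_eq] at h
        exact (Polynomial.mem_roots (hmapF i)).2 h
      · simp only [hΨ]
        ring
  refine (lintegral_mono_ae hbound).trans_lt ?_
  rw [lintegral_const_mul _ (measurable_integrand _ _ _ _).ennreal_ofReal]
  exact ENNReal.mul_lt_top (ENNReal.mul_lt_top hL ENNReal.ofReal_lt_top) hfin

/-- Passing from a family of nonzero polynomials to its irreducible factors preserves
integrability. -/
theorem integrableOnPolydisc_of_isReducedFamily {ρ : ℝ} {N : ℕ}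
    (H : ∀ (κ : Type) [Fintype κ] (f : κ → MvPolynomial (Fin N) ℂ) (r : κ → ℝ),
      IsReducedFamily f → (∀ k, 0 ≤ r k) → (∀ k, r k < 1) → DegreeLeOne f r →
        IntegrableOnPolydisc ρ f r)
    {ι : Type} [Fintype ι] {g : ι → MvPolynomial (Fin N) ℂ} (hg : ∀ i, g i ≠ 0) {w : ι → ℝ}
    (h0 : ∀ i, 0 ≤ w i) (hdeg : DegreeLeOne g w) (hmult : MultiplicityLtOne g w) :
    IntegrableOnPolydisc ρ g w := by
  intro D hD
  obtain ⟨κ, _, f, q, hf, hq0, hq1, hfdeg, C, hC⟩ := exists_reducedFamily g hg h0 hdeg hmult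
  obtain ⟨ε, hε, hfin⟩ := H κ f q hf hq0 hq1 hfdeg D hD
  refine ⟨ε, hε, ?_⟩
  have hae : ∀ᵐ z ∂(Measure.pi fun _ : Fin N => volume.restrict (closedBall (0 : ℂ) ρ)),
      ENNReal.ofReal (‖eval z D‖ ^ (-ε) * ∏ i, ‖eval z (g i)‖ ^ (-2 * w i)) =
      ENNReal.ofReal (‖eval z D‖ ^ (-ε) * ∏ k, ‖eval z (f k)‖ ^ (-2 * q k)) *
        ENNReal.ofReal C := by
    filter_upwards [ae_all_iff.2 fun i => ae_eval_ne_zero _ (hg i)] with z hz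
    rw [hC z hz, ← ENNReal.ofReal_mul]
    · ring_nf
    · exact mul_nonneg (Real.rpow_nonneg (norm_nonneg _) _)
        (Finset.prod_nonneg fun c _ => Real.rpow_nonneg (norm_nonneg _) _)
  rw [lintegral_congr_ae hae, lintegral_mul_const _ (measurable_integrand _ _ _ _).ennreal_ofReal]
  exact ENNReal.mul_lt_top hfin ENNReal.ofReal_lt_top

theorem IsReducedFamily.integrableOnPolydisc {ρ : ℝ} (hρ : 1 ≤ ρ) {N : ℕ} {ι : Type}
    [Fintype ι] {F : ι → MvPolynomial (Fin N) ℂ} (hF : IsReducedFamily F) {q : ι → ℝ}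
    (h0 : ∀ i, 0 ≤ q i) (h1 : ∀ i, q i < 1) (hdeg : DegreeLeOne F q) :
    IntegrableOnPolydisc ρ F q := by
  induction N generalizing ι with
  | zero =>
    refine fun D _ => ⟨1, one_pos, ?_⟩
    rw [lintegral_unique]
    exact ENNReal.mul_lt_top ENNReal.ofReal_lt_top (measure_lt_top _ _)
  | succ N ih =>
    have hF0 : ∀ i, F i ≠ 0 := fun i => (hF.1 i).ne_zero
    exact hF.integrableOnPolydisc_succ hρ h0 h1 hdeg
      (integrableOnPolydisc_of_isReducedFamily (fun κ _ f r hf hr0 hr1 hr => ih hf hr0 hr1 hr)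
        (coeffFamily_ne_zero F) (coeffWeight_nonneg F h0) (degreeLeOne_coeffFamily hF0 h0 hdeg)
        (multiplicityLtOne_coeffFamily hF0 h0 hdeg (hF.multiplicityLtOne h1)))

/-- The restriction of Lebesgue measure to the closed polydisc of radius `ρ` in `σ → ℂ`. -/
noncomputable abbrev polydiscMeasure (σ : Type) [Fintype σ] (ρ : ℝ) : Measure (σ → ℂ) :=
  Measure.pi fun _ : σ => volume.restrict (closedBall (0 : ℂ) ρ)

theorem polydiscMeasure_eq (σ : Type) [Fintype σ] (ρ : ℝ) :
    polydiscMeasure σ ρ = volume.restrict (Set.univ.pi fun _ : σ => closedBall (0 : ℂ) ρ) := by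
  rw [volume_pi, Measure.restrict_pi_pi]

theorem lintegral_polydisc_lt_top {σ ι : Type} [Fintype σ] [Fintype ι] {ρ : ℝ} (hρ : 1 ≤ ρ)
    {F : ι → MvPolynomial σ ℂ} (hF : IsReducedFamily F) {q : ι → ℝ}
    (h0 : ∀ i, 0 ≤ q i) (h1 : ∀ i, q i < 1) (hdeg : DegreeLeOne F q) :
    ∫⁻ z, ENNReal.ofReal (∏ i, ‖eval z (F i)‖ ^ (-2 * q i)) ∂(polydiscMeasure σ ρ) < ⊤ := by
  set e := Fintype.equivFin σ
  have hF' : IsReducedFamily fun i => rename e (F i) := by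
    refine ⟨fun i => (MulEquiv.irreducible_iff (renameEquiv ℂ e)).2 (hF.1 i),
      fun i j hij h => hF.2 i j hij ?_⟩
    simpa [rename_rename] using h.map (rename e.symm)
  have hdeg' : DegreeLeOne (fun i => rename e (F i)) q := fun v => by
    obtain ⟨v, rfl⟩ := e.surjective v
    simpa only [degreeOf_rename_of_injective e.injective] using hdeg v
  obtain ⟨ε, -, hfin⟩ := hF'.integrableOnPolydisc hρ h0 h1 hdeg' 1 one_ne_zero
  have hmp := measurePreserving_arrowCongr'
    (fun _ : Fin (Fintype.card σ) => volume.restrict (closedBall (0 : ℂ) ρ))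
    (fun _ : σ => volume.restrict (closedBall (0 : ℂ) ρ)) e.symm (MeasurableEquiv.refl ℂ)
    (fun _ => MeasurePreserving.id _)
  have hmeas : Measurable fun z : σ → ℂ =>
      ENNReal.ofReal (∏ i, ‖eval z (F i)‖ ^ (-2 * q i)) := by
    simpa using (measurable_integrand 1 F 1 q).ennreal_ofReal
  rw [← hmp.lintegral_comp hmeas]
  refine lt_of_eq_of_lt (lintegral_congr fun z => ?_) hfin
  simp only [map_one, norm_one, Real.one_rpow, one_mul, eval_rename]
  rfl

/-- The function on `σ` given by `s` where `p` holds and by `u` elsewhere. -/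
def glue {σ : Type} (p : σ → Prop) [DecidablePred p] (s : {v // p v} → ℂ) (u : {v // ¬p v} → ℂ) :
    σ → ℂ :=
  fun v => if h : p v then s ⟨v, h⟩ else u ⟨v, h⟩

theorem measurable_glue {σ : Type} (p : σ → Prop) [DecidablePred p] :
    Measurable fun z : ({v // p v} → ℂ) × ({v // ¬p v} → ℂ) => glue p z.1 z.2 := by
  refine measurable_pi_lambda _ fun v => ?_
  by_cases h : p v
  · simpa only [glue, h, dite_true] using! (measurable_pi_apply _).comp measurable_fst
  · simpa only [glue, h, dite_false] using! (measurable_pi_apply _).comp measurable_snd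

theorem lintegral_polydisc_glue {σ : Type} [Fintype σ] (p : σ → Prop) [DecidablePred p] (ρ : ℝ)
    {Φ : (σ → ℂ) → ENNReal} (hΦ : Measurable Φ) :
    ∫⁻ z, Φ z ∂(polydiscMeasure σ ρ) =
      ∫⁻ s, ∫⁻ u, Φ (glue p s u) ∂(polydiscMeasure {v // ¬p v} ρ)
        ∂(polydiscMeasure {v // p v} ρ) := by
  have h := (measurePreserving_piEquivPiSubtypeProd
    (fun _ : σ => volume.restrict (closedBall (0 : ℂ) ρ)) p).symm
  rw [← h.lintegral_comp hΦ]
  exact lintegral_prod _ (hΦ.comp h.measurable).aemeasurable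

theorem lintegral_polydisc_mul_lt_top {σ : Type} [Fintype σ] {ρ : ℝ} {Φ : (σ → ℂ) → ENNReal}
    (hΦ : Measurable Φ) {τ : σ → ℂ} (hτ0 : ∀ v, τ v ≠ 0) (hτ1 : ∀ v, ‖τ v‖ ≤ 1)
    (hfin : ∫⁻ z, Φ z ∂(polydiscMeasure σ ρ) < ⊤) :
    ∫⁻ u, Φ (fun v => τ v * u v) ∂(polydiscMeasure σ ρ) < ⊤ := by
  set B := Set.univ.pi fun _ : σ => closedBall (0 : ℂ) ρ with hB
  have hBm : MeasurableSet B := MeasurableSet.univ_pi fun _ => measurableSet_closedBall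
  rw [polydiscMeasure_eq] at hfin ⊢
  set L : (σ → ℂ) ≃ₗ[ℝ] (σ → ℂ) :=
    (LinearEquiv.piCongrRight fun v => LinearEquiv.smulOfNeZero ℂ ℂ (τ v) (hτ0 v)).restrictScalars ℝ
  have hL : ∀ u, L u = fun v => τ v * u v := fun u => rfl
  have hLm : Measurable L := L.toContinuousLinearEquiv.continuous.measurable
  have hmap := Measure.map_linearMap_addHaar_eq_smul_addHaar (volume : Measure (σ → ℂ))
    (LinearEquiv.isUnit_det' L).ne_zero
  have hle : ∫⁻ u in B, Φ (fun v => τ v * u v) ≤ ∫⁻ u, B.indicator Φ (L u) := by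
    rw [← lintegral_indicator hBm]
    refine lintegral_mono fun u => ?_
    by_cases hu : u ∈ B
    · have hLu : L u ∈ B := fun v _ => by
        have h1 : ‖u v‖ ≤ ρ := by simpa using hu v (Set.mem_univ v)
        rw [hL, mem_closedBall_zero_iff, norm_mul]
        exact (mul_le_of_le_one_left (norm_nonneg _) (hτ1 v)).trans h1
      rw [Set.indicator_of_mem hu, Set.indicator_of_mem hLu, hL]
    · rw [Set.indicator_of_notMem hu]
      exact zero_le
  refine hle.trans_lt ?_
  have hmap' : Measure.map L volume = _ := hmap
  rw [← lintegral_map (hΦ.indicator hBm) hLm, hmap', lintegral_smul_measure,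
    lintegral_indicator hBm]
  exact ENNReal.mul_lt_top ENNReal.ofReal_lt_top hfin

theorem exists_polydisc_slice {σ : Type} [Fintype σ] (p : σ → Prop) [DecidablePred p] {ρ : ℝ}
    (hρ : 1 ≤ ρ) {Φ : (σ → ℂ) → ENNReal} (hΦ : Measurable Φ)
    (hfin : ∫⁻ z, Φ z ∂(polydiscMeasure σ ρ) < ⊤) :
    ∃ s : {v // p v} → ℂ, (∀ v, s v ≠ 0) ∧ (∀ v, ‖s v‖ ≤ 1) ∧
      ∫⁻ u, Φ (glue p s u) ∂(polydiscMeasure {v // ¬p v} ρ) < ⊤ := by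
  have hmeas : Measurable fun s : {v // p v} → ℂ =>
      ∫⁻ u, Φ (glue p s u) ∂(polydiscMeasure {v // ¬p v} ρ) :=
    (hΦ.comp (measurable_glue p)).lintegral_prod_right'
  rw [lintegral_polydisc_glue p ρ hΦ] at hfin
  have h1 := ae_lt_top hmeas hfin.ne
  have h2 : ∀ᵐ s ∂(polydiscMeasure {v // p v} ρ), ∀ v, s v ≠ 0 := by
    rw [ae_all_iff]
    intro v
    exact (Measure.tendsto_eval_ae_ae (μ := fun _ : {v // p v} =>
      volume.restrict (closedBall (0 : ℂ) ρ)) (i := v)).eventually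
        (compl_mem_ae_iff.2 (measure_singleton (0 : ℂ)))
  have hpos : polydiscMeasure {v // p v} ρ (Set.univ.pi fun _ => closedBall (0 : ℂ) 1) ≠ 0 := by
    rw [Measure.pi_pi]
    refine Finset.prod_ne_zero_iff.2 fun v _ => ?_
    rw [Measure.restrict_apply measurableSet_closedBall,
      Set.inter_eq_left.2 (closedBall_subset_closedBall hρ)]
    exact (measure_closedBall_pos volume _ one_pos).ne'
  obtain ⟨s, hs1, hs2, hs3⟩ := ((frequently_ae_mem_iff.2 hpos).and_eventually (h1.and h2)).exists
  exact ⟨s, hs3, fun v => by simpa using hs1 v (Set.mem_univ v), hs2⟩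

/-- A form of Fubini's theorem for dehomogenization: a function which is integrable on a polydisc
and transforms by a constant under the scaling action stays integrable after the coordinates
satisfying `p` are set to one. -/
theorem lintegral_polydisc_dehomogenize_lt_top {σ : Type} [Fintype σ] (p : σ → Prop)
    [DecidablePred p] {ρ : ℝ} (hρ : 1 ≤ ρ) {Φ : (σ → ℂ) → ENNReal} (hΦ : Measurable Φ)
    (b : {v // ¬p v} → {v // p v})
    (hscale : ∀ s : {v // p v} → ℂ, (∀ v, s v ≠ 0) → ∃ κ : ENNReal, κ ≠ ⊤ ∧ ∀ u,
      Φ (glue p 1 u) ≤ κ * Φ (glue p s fun v => s (b v) * u v))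
    (hfin : ∫⁻ z, Φ z ∂(polydiscMeasure σ ρ) < ⊤) :
    ∫⁻ y, Φ (fun v => if p v then 1 else y v) ∂(polydiscMeasure σ ρ) < ⊤ := by
  obtain ⟨s, hs0, hs1, hs⟩ := exists_polydisc_slice p hρ hΦ hfin
  obtain ⟨κ, hκ, hle⟩ := hscale s hs0
  have hsec : Measurable fun u => Φ (glue p s u) :=
    hΦ.comp ((measurable_glue p).comp measurable_prodMk_left)
  have h1 := lintegral_polydisc_mul_lt_top hsec (fun v => hs0 (b v)) (fun v => hs1 (b v)) hs
  have h2 : ∫⁻ u, Φ (glue p 1 u) ∂(polydiscMeasure {v // ¬p v} ρ) < ⊤ := by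
    refine (lintegral_mono hle).trans_lt ?_
    rw [lintegral_const_mul' _ _ hκ]
    exact ENNReal.mul_lt_top hκ.lt_top h1
  have hm : Measurable fun y : σ → ℂ => (fun v => if p v then 1 else y v : σ → ℂ) := by
    refine measurable_pi_lambda _ fun v => ?_
    split_ifs
    · exact measurable_const
    · exact measurable_pi_apply v
  rw [lintegral_polydisc_glue p ρ (Φ := fun y => Φ fun v => if p v then 1 else y v) (hΦ.comp hm)]
  have h3 : ∀ s u, (fun v => if p v then 1 else glue p s u v : σ → ℂ) = glue p 1 u := by
    intro s u
    funext v
    by_cases h : p v <;> simp [glue, h]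
  simp only [h3, lintegral_const]
  refine ENNReal.mul_lt_top h2 ?_
  rw [Measure.pi_univ]
  refine ENNReal.prod_lt_top fun _ _ => ?_
  rw [Measure.restrict_apply_univ]
  exact measure_closedBall_lt_top

section

open MultiProj

theorem degreeOf_le_of_isMultiHomog {n : ℕ} {m : Fin n → ℕ} {F : MvPolynomial (Idx m) ℂ}
    {a : Fin n → ℕ} (hF : IsMultiHomog m F a) (v : Idx m) : degreeOf v F ≤ a v.1 := by
  rw [degreeOf_le_iff]
  intro p hp
  rw [← hF p hp v.1]
  exact Finset.single_le_sum (f := fun j => p ⟨v.1, j⟩) (fun _ _ => Nat.zero_le _)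
    (Finset.mem_univ v.2)

theorem eval_mul_of_isMultiHomog {n : ℕ} {m : Fin n → ℕ} {F : MvPolynomial (Idx m) ℂ}
    {a : Fin n → ℕ} (hF : IsMultiHomog m F a) (s : Fin n → ℂ) (z : Idx m → ℂ) :
    eval (fun v => s v.1 * z v) F = (∏ i, s i ^ a i) * eval z F := by
  rw [eval_eq', eval_eq', Finset.mul_sum]
  refine Finset.sum_congr rfl fun p hp => ?_
  have h : ∏ v : Idx m, s v.1 ^ p v = ∏ i, s i ^ a i := by
    rw [Fintype.prod_sigma]
    refine Finset.prod_congr rfl fun i _ => ?_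
    rw [← hF p hp i, ← Finset.prod_pow_eq_pow_sum]
  simp only [mul_pow, Finset.prod_mul_distrib, h]
  ring

theorem eval_chart {n : ℕ} (m : Fin n → ℕ) (F : MvPolynomial (Idx m) ℂ)
    (c : ∀ i, Fin (m i + 1)) (y : Idx m → ℂ) :
    eval y (chart m F c) = eval (fun v => if v.2 = c v.1 then 1 else y v) F := by
  rw [chart, ← coe_aeval_eq_eval, ← coe_aeval_eq_eval]
  simp only [RingHom.coe_coe]
  rw [← AlgHom.comp_apply, comp_aeval]
  congr 2
  funext v
  split_ifs <;> simp

theorem lintegral_chart_lt_top {n : ℕ} {m : Fin n → ℕ} {ι : Type} [Fintype ι]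
    {F : ι → MvPolynomial (Idx m) ℂ} {a : ι → Fin n → ℕ} (hhom : ∀ j, IsMultiHomog m (F j) (a j))
    {q : ι → ℝ} (c : ∀ i, Fin (m i + 1)) {ρ : ℝ} (hρ : 1 ≤ ρ)
    (hfin : ∫⁻ z, ENNReal.ofReal (∏ j, ‖eval z (F j)‖ ^ (-2 * q j))
      ∂(polydiscMeasure (Idx m) ρ) < ⊤) :
    ∫⁻ y, ENNReal.ofReal (∏ j, ‖eval y (chart m (F j) c)‖ ^ (-2 * q j))
      ∂(polydiscMeasure (Idx m) ρ) < ⊤ := by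
  simp only [eval_chart]
  have hmeas : Measurable fun z : Idx m → ℂ =>
      ENNReal.ofReal (∏ j, ‖eval z (F j)‖ ^ (-2 * q j)) := by
    simpa using (measurable_integrand 1 F 1 q).ennreal_ofReal
  refine lintegral_polydisc_dehomogenize_lt_top (fun v : Idx m => v.2 = c v.1) hρ hmeas
    (fun v => ⟨⟨v.1.1, c v.1.1⟩, rfl⟩) (fun s hs => ?_) hfin
  set s' : Fin n → ℂ := fun i => s ⟨⟨i, c i⟩, rfl⟩
  set A : ℝ := ∏ j, ‖∏ i, s' i ^ a j i‖ ^ (-2 * q j)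
  have hA : 0 < A := Finset.prod_pos fun j _ => Real.rpow_pos_of_pos
    (norm_pos_iff.2 (Finset.prod_ne_zero_iff.2 fun i _ => pow_ne_zero _ (hs _))) _
  refine ⟨ENNReal.ofReal A⁻¹, ENNReal.ofReal_ne_top, fun u => le_of_eq ?_⟩
  have hglue : glue (fun v : Idx m => v.2 = c v.1) s
      (fun v => s ⟨⟨v.1.1, c v.1.1⟩, rfl⟩ * u v) =
      fun v => s' v.1 * glue (fun v : Idx m => v.2 = c v.1) 1 u v := by
    funext v
    by_cases h : v.2 = c v.1
    · obtain ⟨i, j⟩ := v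
      obtain rfl : j = c i := h
      simp [glue, s']
    · simp [glue, h, s']
  rw [hglue, ← ENNReal.ofReal_mul (inv_nonneg.2 hA.le)]
  simp only [eval_mul_of_isMultiHomog (hhom _), norm_mul,
    Real.mul_rpow (norm_nonneg _) (norm_nonneg _), Finset.prod_mul_distrib]
  rw [← mul_assoc, inv_mul_cancel₀ hA.ne', one_mul]

end

end PolydiscIntegrability

/-- if `Δ = ∑ j, q j • D j ≥ 0` is a `ℚ`-divisor of multidegree `(1,...,1)`
on `X = ∏ i, ℙ^(m i)` with `⌊Δ⌋ = 0`, then `(X, Δ)` is klt.  Here the `D j = {F j = 0}`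
are pairwise distinct prime divisors. -/
theorem klt_of_multidegree_one_floor_zero
    (n : ℕ) (hn : 1 ≤ n) (m : Fin n → ℕ) (hm : ∀ i, 1 ≤ m i)
    (k : ℕ) (F : Fin k → MvPolynomial (MultiProj.Idx m) ℂ)
    (a : Fin k → Fin n → ℕ) (q : Fin k → ℚ)
    (hirr : ∀ j, Irreducible (F j))
    (hhom : ∀ j, MultiProj.IsMultiHomog m (F j) (a j))
    (hdist : ∀ j j', j ≠ j' → ¬ Associated (F j) (F j'))
    (heff : ∀ j, 0 ≤ q j)
    (hdeg : ∀ i, ∑ j, q j * (a j i : ℚ) = 1)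
    (hfloor : ∀ j, q j < 1) :
    MultiProj.IsKltPair m F q := by
  intro c x
  set q' : Fin k → ℝ := fun j => (q j : ℝ) with hq'
  have hred : PolydiscIntegrability.IsReducedFamily F := ⟨hirr, hdist⟩
  have hdegree : PolydiscIntegrability.DegreeLeOne F q' := fun v => by
    have h : ∑ j, q' j * (a j v.1 : ℝ) = 1 := by
      simp only [hq']
      exact_mod_cast hdeg v.1
    rw [← h]
    refine Finset.sum_le_sum fun j _ => mul_le_mul_of_nonneg_left ?_ (Rat.cast_nonneg.2 (heff j))
    exact_mod_cast PolydiscIntegrability.degreeOf_le_of_isMultiHomog (hhom j) v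
  have hρ : 1 ≤ ‖x‖ + 1 := by linarith [norm_nonneg x]
  have hfin := PolydiscIntegrability.lintegral_chart_lt_top hhom c hρ
    (PolydiscIntegrability.lintegral_polydisc_lt_top hρ hred
      (fun j => Rat.cast_nonneg.2 (heff j)) (fun j => by exact_mod_cast hfloor j) hdegree)
  rw [PolydiscIntegrability.polydiscMeasure_eq] at hfin
  have hmeas : Measurable fun y : MultiProj.Idx m → ℂ =>
      ∏ j, ‖eval y (MultiProj.chart m (F j) c)‖ ^ (-2 * q' j) := by
    simpa using PolydiscIntegrability.measurable_integrand 1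
      (fun j => MultiProj.chart m (F j) c) 1 q'
  refine ⟨1, one_pos, IntegrableOn.mono_set (t := Set.univ.pi fun _ => closedBall (0 : ℂ) (‖x‖ + 1))
    ⟨hmeas.aestronglyMeasurable, ?_⟩ fun y hy v _ => ?_⟩
  · rw [hasFiniteIntegral_iff_ofReal]
    · exact hfin
    · exact Filter.Eventually.of_forall fun y => Finset.prod_nonneg fun j _ =>
        Real.rpow_nonneg (norm_nonneg _) _
  · rw [mem_closedBall_zero_iff]
    have h1 : ‖y - x‖ < 1 := by simpa [dist_eq_norm] using hy
    calc ‖y v‖ ≤ ‖y‖ := norm_le_pi_norm y v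
      _ ≤ ‖x‖ + ‖y - x‖ := norm_le_norm_add_norm_sub' y x
      _ ≤ ‖x‖ + 1 := by linarith
end
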